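/- Assume condition (L): p > 2, or p < 2 and α < δ, and assume 1 < q < q*. Then: (ii) the set {a > 0 : L(a) = 0} is unbounded from above, and there exists an increasing sequence (a_m) tending to ∞ such that w(·,a_m) has at least m+1 isolated zeros and L(a_m) = 0; (iii) if moreover p < 2 and α < N, then for any natural number m, ā_m := inf{a > 0 : w(·,a) has at least m+1 isolated zeros} belongs to (0,∞), and if m ≥ 1 then w(·,ā_m) has precisely m zeros and L(ā_m) = 0. -/

import Mathlib

open Set Filter Topology Asymptotics

/-- The p-Laplacian nonlinearity φ_p(x) = |x|^{p-2} x. -/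
noncomputable def phiP (p x : ℝ) : ℝ := |x| ^ (p - 2) * x

/-- `w` is a solution of equation (E) on the interval `I ⊆ (0,∞)`:
`w` is C¹ on `I`, `|w'|^{p-2} w'` is C¹ on `I`, and the equation
`(|w'|^{p-2}w')' + ((N-1)/r)|w'|^{p-2}w' + r w' + α w + |w|^{q-1} w = 0`
holds on `I` (derivatives taken within `I`). -/
def IsSolutionOn (N : ℕ) (p q α : ℝ) (w : ℝ → ℝ) (I : Set ℝ) : Prop :=
  ContDiffOn ℝ 1 w I ∧
  ContDiffOn ℝ 1 (fun r => phiP p (derivWithin w I r)) I ∧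
  ∀ r ∈ I,
    derivWithin (fun s => phiP p (derivWithin w I s)) I r
      + ((N : ℝ) - 1) / r * phiP p (derivWithin w I r)
      + r * derivWithin w I r + α * w r + |w r| ^ (q - 1) * w r = 0

/-- `w` is the global solution of (E) on `[0,∞)` with `w(0) = a`, `w'(0) = 0`:
`w ∈ C¹([0,∞))`, `|w'|^{p-2}w' ∈ C¹([0,∞))`, and (E) holds on `(0,∞)`. -/
def IsGlobalSolution (N : ℕ) (p q α a : ℝ) (w : ℝ → ℝ) : Prop :=
  ContDiffOn ℝ 1 w (Ici 0) ∧
  ContDiffOn ℝ 1 (fun r => phiP p (derivWithin w (Ici 0) r)) (Ici 0) ∧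
  (∀ r ∈ Ioi (0 : ℝ),
    derivWithin (fun s => phiP p (derivWithin w (Ici 0) s)) (Ici 0) r
      + ((N : ℝ) - 1) / r * phiP p (derivWithin w (Ici 0) r)
      + r * derivWithin w (Ici 0) r + α * w r + |w r| ^ (q - 1) * w r = 0) ∧
  w 0 = a ∧ derivWithin w (Ici 0) 0 = 0

/-- `r` is an isolated zero of `w` relative to the set `I`. -/
def IsIsolatedZeroOn (w : ℝ → ℝ) (I : Set ℝ) (r : ℝ) : Prop :=
  r ∈ I ∧ w r = 0 ∧ ∀ᶠ s in 𝓝[I \ {r}] r, w s ≠ 0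

/-- `w` has at least `n` isolated zeros in `(0,∞)`. -/
def HasAtLeastIsolatedZeros (w : ℝ → ℝ) (n : ℕ) : Prop :=
  ∃ z : Fin n → ℝ, StrictMono z ∧ ∀ i, 0 < z i ∧ IsIsolatedZeroOn w (Ici 0) (z i)

section Nonlinearity

lemma phiP_zero (p : ℝ) : phiP p 0 = 0 := by simp [phiP]

lemma phiP_neg (p x : ℝ) : phiP p (-x) = -phiP p x := by simp [phiP]

lemma phiP_of_pos {p x : ℝ} (hx : 0 < x) : phiP p x = x ^ (p - 1) := by
  rw [phiP, abs_of_pos hx]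
  nth_rewrite 2 [← Real.rpow_one x]
  rw [← Real.rpow_add hx]
  ring_nf

lemma phiP_of_nonneg {p x : ℝ} (hp : 1 < p) (hx : 0 ≤ x) : phiP p x = x ^ (p - 1) := by
  rcases hx.eq_or_lt with rfl | h
  · rw [phiP_zero, Real.zero_rpow (by linarith)]
  · exact phiP_of_pos h

lemma phiP_pos {p x : ℝ} (hx : 0 < x) : 0 < phiP p x := by
  rw [phiP_of_pos hx]; positivity

lemma phiP_neg_of_neg {p x : ℝ} (hx : x < 0) : phiP p x < 0 := by
  have h := phiP_pos (p := p) (neg_pos.2 hx)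
  rw [phiP_neg] at h; linarith

lemma phiP_nonneg {p x : ℝ} (hx : 0 ≤ x) : 0 ≤ phiP p x := by
  unfold phiP; positivity

lemma phiP_eq_max {p : ℝ} (hp : 1 < p) (x : ℝ) :
    phiP p x = (max x 0) ^ (p - 1) - (max (-x) 0) ^ (p - 1) := by
  have h0 : (0 : ℝ) ^ (p - 1) = 0 := Real.zero_rpow (by linarith)
  rcases le_total 0 x with h | h
  · rw [phiP_of_nonneg hp h, max_eq_left h, max_eq_right (by linarith), h0, sub_zero]
  · rw [max_eq_right h, max_eq_left (by linarith), h0, zero_sub,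
      ← phiP_of_nonneg hp (by linarith), phiP_neg, neg_neg]

lemma continuous_phiP {p : ℝ} (hp : 1 < p) : Continuous (phiP p) := by
  have : phiP p = fun x => (max x 0) ^ (p - 1) - (max (-x) 0) ^ (p - 1) :=
    funext (phiP_eq_max hp)
  rw [this]
  have h : ∀ x : ℝ, 0 ≤ p - 1 := fun _ => by linarith
  refine Continuous.sub ?_ ?_
  · exact (continuous_id.max continuous_const).rpow_const fun x => Or.inr (by linarith)
  · exact (continuous_neg.max continuous_const).rpow_const fun x => Or.inr (by linarith)

lemma monotone_phiP {p : ℝ} (hp : 1 < p) : Monotone (phiP p) := by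
  intro x y hxy
  rw [phiP_eq_max hp, phiP_eq_max hp]
  have h1 : (max x 0) ^ (p - 1) ≤ (max y 0) ^ (p - 1) :=
    Real.rpow_le_rpow (le_max_right _ _) (max_le_max_right _ hxy) (by linarith)
  have h2 : (max (-y) 0) ^ (p - 1) ≤ (max (-x) 0) ^ (p - 1) :=
    Real.rpow_le_rpow (le_max_right _ _) (max_le_max_right _ (by linarith)) (by linarith)
  linarith

lemma sub_mul_phiP_sub_nonneg {p : ℝ} (hp : 1 < p) (x y : ℝ) :
    0 ≤ (x - y) * (phiP p x - phiP p y) := by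
  rcases le_total x y with h | h
  · exact mul_nonneg_of_nonpos_of_nonpos (by linarith) (by linarith [monotone_phiP hp h])
  · exact mul_nonneg (by linarith) (by linarith [monotone_phiP hp h])

lemma abs_phiP {p : ℝ} (hp : 1 < p) (x : ℝ) : |phiP p x| = |x| ^ (p - 1) := by
  rcases le_total 0 x with h | h
  · rw [abs_of_nonneg (phiP_nonneg h), abs_of_nonneg h, phiP_of_nonneg hp h]
  · have h' : 0 ≤ -x := by linarith
    rw [← abs_neg, ← phiP_neg, abs_of_nonneg (phiP_nonneg h'), abs_of_nonpos h,
      phiP_of_nonneg hp h']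

lemma mul_phiP {p : ℝ} (hp : 1 < p) (x : ℝ) : x * phiP p x = |x| ^ p := by
  have h : 0 ≤ x * phiP p x := by
    have := sub_mul_phiP_sub_nonneg hp x 0
    simpa [phiP_zero] using this
  rw [← abs_of_nonneg h, abs_mul, abs_phiP hp]
  rcases (abs_nonneg x).eq_or_lt with h0 | h0
  · rw [← h0, Real.zero_rpow (by linarith : p ≠ 0), zero_mul]
  · nth_rewrite 1 [← Real.rpow_one |x|]
    rw [← Real.rpow_add h0]; ring_nf

lemma phiP_mul {p c : ℝ} (hc : 0 < c) (x : ℝ) :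
    phiP p (c * x) = c ^ (p - 1) * phiP p x := by
  have : c ^ (p - 1) = c ^ (p - 2) * c := by
    nth_rewrite 3 [← Real.rpow_one c]
    rw [← Real.rpow_add hc]; ring_nf
  rw [phiP, phiP, abs_mul, abs_of_pos hc, Real.mul_rpow hc.le (abs_nonneg x), this]
  ring

lemma phiP_conj {p : ℝ} (hp : 1 < p) (x : ℝ) : phiP (p / (p - 1)) (phiP p x) = x := by
  have hp1 : p - 1 ≠ 0 := by linarith
  have key : ∀ y : ℝ, 0 < y → phiP (p / (p - 1)) (phiP p y) = y := by
    intro y hy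
    rw [phiP_of_pos (phiP_pos hy), phiP_of_pos hy, ← Real.rpow_mul hy.le]
    have : (p - 1) * (p / (p - 1) - 1) = 1 := by field_simp; ring
    rw [this, Real.rpow_one]
  rcases lt_trichotomy x 0 with h | rfl | h
  · have := key (-x) (by linarith)
    rw [phiP_neg, phiP_neg] at this; linarith
  · rw [phiP_zero, phiP_zero]
  · exact key x h

lemma hasDerivAt_abs_rpow_div {p : ℝ} (hp : 1 < p) (x : ℝ) :
    HasDerivAt (fun y => |y| ^ p / p) (phiP p x) x := by
  have := (hasDerivAt_abs_rpow x hp).div_const p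
  have hp0 : p ≠ 0 := by linarith
  have e : phiP p x = p * |x| ^ (p - 2) * x / p := by
    unfold phiP; field_simp
  rw [e]; exact this

lemma phiP_sub_le_of_abs_le {q B x y : ℝ} (hq : 2 ≤ q) (hx : |x| ≤ B) (hy : |y| ≤ B) :
    |phiP q x - phiP q y| ≤ (q - 1) * B ^ (q - 2) * |x - y| := by
  have hB : 0 ≤ B := (abs_nonneg x).trans hx
  have hd : ∀ t ∈ Icc (0:ℝ) B, HasDerivWithinAt (fun s : ℝ => s ^ (q - 1))
      ((q - 1) * t ^ (q - 1 - 1)) (Icc 0 B) t := fun t ht =>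
    (Real.hasDerivAt_rpow_const (Or.inr (by linarith))).hasDerivWithinAt
  have hC : ∀ t ∈ Icc (0:ℝ) B, ‖(q - 1) * t ^ (q - 1 - 1)‖ ≤ (q - 1) * B ^ (q - 2) := by
    intro t ht
    have h1 : 0 ≤ q - 1 := by linarith
    rw [Real.norm_eq_abs, abs_of_nonneg (mul_nonneg h1 (Real.rpow_nonneg ht.1 _))]
    have : q - 1 - 1 = q - 2 := by ring
    rw [this]
    exact mul_le_mul_of_nonneg_left (Real.rpow_le_rpow ht.1 ht.2 (by linarith)) h1
  have hpow : ∀ s ∈ Icc (0:ℝ) B, ∀ t ∈ Icc (0:ℝ) B,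
      |s ^ (q - 1) - t ^ (q - 1)| ≤ (q - 1) * B ^ (q - 2) * |s - t| := by
    intro s hs t ht
    have := (convex_Icc (0:ℝ) B).norm_image_sub_le_of_norm_hasDerivWithin_le hd hC ht hs
    simpa [Real.norm_eq_abs] using this
  have hmem : ∀ z : ℝ, |z| ≤ B → max z 0 ∈ Icc (0:ℝ) B := fun z hz =>
    ⟨le_max_right _ _, max_le ((le_abs_self z).trans hz) hB⟩
  have hx1 := hmem x hx
  have hy1 := hmem y hy
  have hx2 := hmem (-x) (by rwa [abs_neg])
  have hy2 := hmem (-y) (by rwa [abs_neg])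
  rw [phiP_eq_max (by linarith) x, phiP_eq_max (by linarith) y]
  have e1 := hpow _ hx1 _ hy1
  have e2 := hpow _ hx2 _ hy2
  have hsum : |max x 0 - max y 0| + |max (-x) 0 - max (-y) 0| = |x - y| := by
    rcases le_total 0 x with h | h <;> rcases le_total 0 y with h' | h'
    · rw [max_eq_left h, max_eq_left h', max_eq_right (by linarith), max_eq_right (by linarith)]
      simp
    · rw [max_eq_left h, max_eq_right h', max_eq_right (by linarith), max_eq_left (by linarith),
        abs_of_nonneg (by linarith), abs_of_nonpos (by linarith), abs_of_nonneg (by linarith)]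
      ring
    · rw [max_eq_right h, max_eq_left h', max_eq_left (by linarith), max_eq_right (by linarith),
        abs_of_nonpos (by linarith), abs_of_nonneg (by linarith), abs_of_nonpos (by linarith)]
      ring
    · rw [max_eq_right h, max_eq_right h', max_eq_left (by linarith), max_eq_left (by linarith)]
      rw [sub_self, abs_zero, zero_add, ← abs_neg]
      congr 1; ring
  rw [← hsum, mul_add]
  calc _ = |((max x 0) ^ (q - 1) - (max y 0) ^ (q - 1))
          - ((max (-x) 0) ^ (q - 1) - (max (-y) 0) ^ (q - 1))| := by congr 1; ring
    _ ≤ _ := (abs_sub _ _).trans (add_le_add e1 e2)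

lemma abs_rpow_sub_le_of_mem_Icc {s c₁ c₂ r x y : ℝ} (hs : 0 < s) (hc₁ : 0 < c₁) (hr : 0 < r)
    (hx : x ∈ Icc (c₁ * r) (c₂ * r)) (hy : y ∈ Icc (c₁ * r) (c₂ * r)) :
    |x ^ s - y ^ s| ≤ s * (c₁ ^ (s - 1) + c₂ ^ (s - 1)) * r ^ (s - 1) * |x - y| := by
  have hd : ∀ t ∈ Icc (c₁ * r) (c₂ * r), HasDerivWithinAt (fun z : ℝ => z ^ s)
      (s * t ^ (s - 1)) (Icc (c₁ * r) (c₂ * r)) t := fun t ht =>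
    (Real.hasDerivAt_rpow_const (Or.inl ((mul_pos hc₁ hr).trans_le ht.1).ne')).hasDerivWithinAt
  have hC : ∀ t ∈ Icc (c₁ * r) (c₂ * r),
      ‖s * t ^ (s - 1)‖ ≤ s * (c₁ ^ (s - 1) + c₂ ^ (s - 1)) * r ^ (s - 1) := by
    intro t ht
    have ht0 : 0 < t := (mul_pos hc₁ hr).trans_le ht.1
    have hc₂ : 0 < c₂ := by
      have := (mul_pos hc₁ hr).trans_le (ht.1.trans ht.2)
      exact pos_of_mul_pos_left this hr.le
    rw [Real.norm_eq_abs, abs_of_nonneg (by positivity), mul_assoc]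
    refine mul_le_mul_of_nonneg_left ?_ hs.le
    rw [add_mul, ← Real.mul_rpow hc₁.le hr.le, ← Real.mul_rpow hc₂.le hr.le]
    rcases le_total 0 (s - 1) with h | h
    · have := Real.rpow_le_rpow ht0.le ht.2 h
      have h2 : 0 ≤ (c₁ * r) ^ (s - 1) := by positivity
      linarith
    · have := Real.rpow_le_rpow_of_nonpos (mul_pos hc₁ hr) ht.1 h
      have h2 : 0 ≤ (c₂ * r) ^ (s - 1) := by positivity
      linarith
  have := (convex_Icc (c₁ * r) (c₂ * r)).norm_image_sub_le_of_norm_hasDerivWithin_le hd hC hy hx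
  simpa [Real.norm_eq_abs] using this

end Nonlinearity

section Monotonicity

lemma antitoneOn_of_hasDerivAt_nonpos {D : Set ℝ} (hD : Convex ℝ D) {f f' : ℝ → ℝ}
    (hf : ∀ x ∈ D, HasDerivAt f (f' x) x) (hf' : ∀ x ∈ D, f' x ≤ 0) : AntitoneOn f D :=
  antitoneOn_of_deriv_nonpos hD (fun x hx => (hf x hx).continuousAt.continuousWithinAt)
    (fun x hx => (hf x (interior_subset hx)).differentiableAt.differentiableWithinAt)
    (fun x hx => by rw [(hf x (interior_subset hx)).deriv]; exact hf' x (interior_subset hx))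

lemma monotoneOn_of_hasDerivAt_nonneg {D : Set ℝ} (hD : Convex ℝ D) {f f' : ℝ → ℝ}
    (hf : ∀ x ∈ D, HasDerivAt f (f' x) x) (hf' : ∀ x ∈ D, 0 ≤ f' x) : MonotoneOn f D :=
  monotoneOn_of_deriv_nonneg hD (fun x hx => (hf x hx).continuousAt.continuousWithinAt)
    (fun x hx => (hf x (interior_subset hx)).differentiableAt.differentiableWithinAt)
    (fun x hx => by rw [(hf x (interior_subset hx)).deriv]; exact hf' x (interior_subset hx))

lemma AntitoneOn.le_of_tendsto_zero_right {f : ℝ → ℝ} {R ℓ r : ℝ} (hf : AntitoneOn f (Ioc 0 R))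
    (hℓ : Tendsto f (𝓝[>] 0) (𝓝 ℓ)) (hr : r ∈ Ioc 0 R) : f r ≤ ℓ := by
  refine ge_of_tendsto hℓ ?_
  filter_upwards [Ioo_mem_nhdsGT hr.1] with s hs
  exact hf ⟨hs.1, hs.2.le.trans hr.2⟩ hr hs.2.le

/-- A Grönwall inequality: `V' ≤ Φ' V` implies that `V e^{-Φ}` is nonincreasing. -/
lemma antitoneOn_mul_exp_neg {D : Set ℝ} (hD : Convex ℝ D) {V V' Φ Φ' : ℝ → ℝ}
    (hV : ∀ x ∈ D, HasDerivAt V (V' x) x) (hΦ : ∀ x ∈ D, HasDerivAt Φ (Φ' x) x)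
    (h : ∀ x ∈ D, V' x ≤ Φ' x * V x) : AntitoneOn (fun x => V x * Real.exp (-Φ x)) D := by
  refine antitoneOn_of_hasDerivAt_nonpos hD
    (fun x hx => (hV x hx).mul ((hΦ x hx).neg.exp)) fun x hx => ?_
  have := mul_nonneg (sub_nonneg.2 (h x hx)) (Real.exp_pos (-Φ x)).le
  simp only [Pi.neg_apply]
  nlinarith [this]

end Monotonicity

/-- First-order form of the radial equation, in the unknowns `w` and `u = φ_p(w')`, with
`m = p/(p-1)` and a parameter `κ` in front of the drift terms. -/
structure FluxSol (ν m q α κ : ℝ) (w u : ℝ → ℝ) : Prop where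
  hw : ∀ r, 0 < r → HasDerivAt w (phiP m (u r)) r
  hu : ∀ r, 0 < r → HasDerivAt u
    (-((ν - 1) / r * u r) - κ * (r * phiP m (u r) + α * w r) - phiP (q + 1) (w r)) r

/-- The initial conditions `w(0) = a`, `u(0) = 0`. -/
structure StartsAt (a : ℝ) (w u : ℝ → ℝ) : Prop where
  hw : Tendsto w (𝓝[>] 0) (𝓝 a)
  hu : Tendsto u (𝓝[>] 0) (𝓝 0)

/-- The energy of a solution. -/
noncomputable def energy (m q α κ : ℝ) (w u : ℝ → ℝ) (r : ℝ) : ℝ :=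
  |u r| ^ m / m + κ * α * (w r ^ 2 / 2) + |w r| ^ (q + 1) / (q + 1)

/-- The energy at `r = 0` of a solution starting at `a`. -/
noncomputable def energyZero (q α κ a : ℝ) : ℝ :=
  κ * α * (a ^ 2 / 2) + |a| ^ (q + 1) / (q + 1)

section FluxSol

variable {ν m q α κ a : ℝ} {w u : ℝ → ℝ}

lemma FluxSol.neg (h : FluxSol ν m q α κ w u) :
    FluxSol ν m q α κ (fun r => -w r) (fun r => -u r) := by
  refine ⟨fun r hr => ?_, fun r hr => ?_⟩
  · rw [phiP_neg]; exact (h.hw r hr).neg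
  · rw [phiP_neg, phiP_neg]
    refine (h.hu r hr).neg.congr_deriv ?_
    ring

lemma StartsAt.neg (h : StartsAt a w u) : StartsAt (-a) (fun r => -w r) (fun r => -u r) :=
  ⟨h.hw.neg, by simpa using h.hu.neg⟩

lemma FluxSol.continuousAt_w (h : FluxSol ν m q α κ w u) {r : ℝ} (hr : 0 < r) :
    ContinuousAt w r := (h.hw r hr).continuousAt

lemma FluxSol.continuousAt_u (h : FluxSol ν m q α κ w u) {r : ℝ} (hr : 0 < r) :
    ContinuousAt u r := (h.hu r hr).continuousAt

lemma FluxSol.hasDerivAt_energy (h : FluxSol ν m q α κ w u) (hm : 1 < m) (hq : 1 < q)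
    {r : ℝ} (hr : 0 < r) :
    HasDerivAt (energy m q α κ w u)
      (-((ν - 1) / r * |u r| ^ m) - κ * r * phiP m (u r) ^ 2) r := by
  have h1 := (hasDerivAt_abs_rpow_div hm (u r)).comp r (h.hu r hr)
  have h2 := (((h.hw r hr).pow 2).div_const 2).const_mul (κ * α)
  have h3 := (hasDerivAt_abs_rpow_div (by linarith : 1 < q + 1) (w r)).comp r (h.hw r hr)
  refine ((h1.add h2).add h3).congr_deriv ?_
  rw [← mul_phiP hm]
  push_cast
  ring

lemma FluxSol.energy_antitoneOn (h : FluxSol ν m q α κ w u) (hν : 1 ≤ ν) (hm : 1 < m)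
    (hq : 1 < q) (hκ : 0 ≤ κ) : AntitoneOn (energy m q α κ w u) (Ioi 0) := by
  refine antitoneOn_of_hasDerivAt_nonpos (convex_Ioi 0)
    (fun r hr => h.hasDerivAt_energy hm hq hr) fun r hr => ?_
  have hr' : (0 : ℝ) < r := hr
  have h1 : 0 ≤ (ν - 1) / r * |u r| ^ m :=
    mul_nonneg (div_nonneg (by linarith) hr'.le) (by positivity)
  have h2 : 0 ≤ κ * r * phiP m (u r) ^ 2 := by positivity
  linarith

lemma StartsAt.tendsto_energy (h0 : StartsAt a w u) (hm : 1 < m) (hq : 1 < q) :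
    Tendsto (energy m q α κ w u) (𝓝[>] 0) (𝓝 (energyZero q α κ a)) := by
  have h1 : Tendsto (fun r => |u r| ^ m / m) (𝓝[>] 0) (𝓝 (|0| ^ m / m)) :=
    (h0.hu.abs.rpow_const (Or.inr (by linarith))).div_const m
  have h2 := ((h0.hw.pow 2).div_const 2).const_mul (κ * α)
  have h3 : Tendsto (fun r => |w r| ^ (q + 1) / (q + 1)) (𝓝[>] 0) (𝓝 (|a| ^ (q + 1) / (q + 1))) :=
    (h0.hw.abs.rpow_const (Or.inr (by linarith))).div_const (q + 1)
  have h4 := (h1.add h2).add h3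
  rw [abs_zero, Real.zero_rpow (by linarith), zero_div, zero_add] at h4
  exact h4

lemma FluxSol.energy_le (h : FluxSol ν m q α κ w u) (h0 : StartsAt a w u) (hν : 1 ≤ ν)
    (hm : 1 < m) (hq : 1 < q) (hκ : 0 ≤ κ) {r : ℝ} (hr : 0 < r) :
    energy m q α κ w u r ≤ energyZero q α κ a :=
  ((h.energy_antitoneOn hν hm hq hκ).mono Ioc_subset_Ioi_self).le_of_tendsto_zero_right
    (h0.tendsto_energy hm hq) (right_mem_Ioc.2 hr)

lemma abs_rpow_div_le_energy (hα : 0 ≤ α) (hq : 1 < q) (hκ : 0 ≤ κ) (r : ℝ) :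
    |u r| ^ m / m ≤ energy m q α κ w u r := by
  have h1 : 0 ≤ κ * α * (w r ^ 2 / 2) := by positivity
  have h2 : 0 ≤ |w r| ^ (q + 1) / (q + 1) := by
    have : 0 < q + 1 := by linarith
    positivity
  unfold energy; linarith

lemma energyZero_le_energy (hm : 1 < m) (r : ℝ) :
    energyZero q α κ (w r) ≤ energy m q α κ w u r := by
  have h1 : 0 ≤ |u r| ^ m / m := by
    have : 0 < m := by linarith
    positivity
  unfold energy energyZero; linarith

lemma abs_le_of_energyZero_le {b : ℝ} (hα : 0 ≤ α) (hq : 1 < q) (hκ : 0 ≤ κ)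
    (h : energyZero q α κ b ≤ energyZero q α κ a) : |b| ≤ |a| := by
  by_contra! hlt
  have h1 : |a| ^ (q + 1) < |b| ^ (q + 1) :=
    Real.rpow_lt_rpow (abs_nonneg a) hlt (by linarith)
  have h2 : a ^ 2 ≤ b ^ 2 := sq_le_sq.2 hlt.le
  have h3 : |a| ^ (q + 1) / (q + 1) < |b| ^ (q + 1) / (q + 1) :=
    div_lt_div_of_pos_right h1 (by linarith)
  have h4 : κ * α * (a ^ 2 / 2) ≤ κ * α * (b ^ 2 / 2) :=
    mul_le_mul_of_nonneg_left (by linarith) (by positivity)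
  unfold energyZero at h; linarith

lemma FluxSol.abs_w_le (h : FluxSol ν m q α κ w u) (h0 : StartsAt a w u) (hν : 1 ≤ ν)
    (hm : 1 < m) (hq : 1 < q) (hα : 0 ≤ α) (hκ : 0 ≤ κ) {r : ℝ} (hr : 0 < r) : |w r| ≤ |a| :=
  abs_le_of_energyZero_le hα hq hκ
    ((energyZero_le_energy hm r).trans (h.energy_le h0 hν hm hq hκ hr))

lemma FluxSol.abs_u_le (h : FluxSol ν m q α κ w u) (h0 : StartsAt a w u) (hν : 1 ≤ ν)
    (hm : 1 < m) (hq : 1 < q) (hα : 0 ≤ α) (hκ : 0 ≤ κ) {r : ℝ} (hr : 0 < r) :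
    |u r| ≤ (m * energyZero q α κ a) ^ (1 / m) := by
  have hm0 : 0 < m := by linarith
  have h1 := (abs_rpow_div_le_energy (m := m) (w := w) (u := u) hα hq hκ r).trans
    (h.energy_le h0 hν hm hq hκ hr)
  rw [div_le_iff₀ hm0, mul_comm] at h1
  have h2 := Real.rpow_le_rpow (by positivity) h1 (by positivity : 0 ≤ 1 / m)
  rwa [← Real.rpow_mul (abs_nonneg _), mul_one_div_cancel hm0.ne', Real.rpow_one] at h2

lemma FluxSol.eq_zero_of_eq_zero (h : FluxSol ν m q α κ w u) (hν : 1 ≤ ν)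
    (hm : 1 < m) (hq : 1 < q) (hα : 0 ≤ α) (hκ : 0 ≤ κ) {r : ℝ} (hr : 0 < r)
    (hw : w r = 0) (hu : u r = 0) {s : ℝ} (hs : r ≤ s) : w s = 0 := by
  have h1 := h.energy_antitoneOn hν hm hq hκ hr (hr.trans_le hs) hs
  have h2 : energy m q α κ w u r = 0 := by
    unfold energy
    rw [hw, hu, abs_zero, Real.zero_rpow (by linarith), Real.zero_rpow (by linarith)]
    simp
  have h3 : energyZero q α κ 0 = 0 := by
    unfold energyZero
    rw [abs_zero, Real.zero_rpow (by linarith)]; simp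
  have h4 : energyZero q α κ (w s) ≤ energyZero q α κ 0 := by
    rw [h3, ← h2]; exact (energyZero_le_energy hm s).trans h1
  simpa using abs_le_of_energyZero_le hα hq hκ h4

lemma FluxSol.hasDerivAt_weighted (h : FluxSol ν m q α κ w u) {r : ℝ} (hr : 0 < r) :
    HasDerivAt (fun s => s ^ (ν - 1) * u s)
      (-(r ^ (ν - 1) * (κ * (r * phiP m (u r) + α * w r) + phiP (q + 1) (w r)))) r := by
  have h1 := (Real.hasDerivAt_rpow_const (p := ν - 1) (Or.inl hr.ne')).mul (h.hu r hr)
  refine h1.congr_deriv ?_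
  rw [Real.rpow_sub_one hr.ne' (ν - 1)]
  field_simp
  ring

lemma tendsto_rpow_zero_right {s : ℝ} (hs : 0 < s) :
    Tendsto (fun r : ℝ => r ^ s) (𝓝[>] 0) (𝓝 0) := by
  have := (Real.continuousAt_rpow_const 0 s (Or.inr hs.le)).tendsto
  rw [Real.zero_rpow hs.ne'] at this
  exact this.mono_left nhdsWithin_le_nhds

lemma StartsAt.tendsto_weighted (h0 : StartsAt a w u) (hν : 1 ≤ ν) :
    Tendsto (fun s => s ^ (ν - 1) * u s) (𝓝[>] 0) (𝓝 0) := by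
  have := (Real.continuousAt_rpow_const 0 (ν - 1) (Or.inr (by linarith))).tendsto
  simpa using (this.mono_left nhdsWithin_le_nhds).mul h0.hu

lemma FluxSol.u_le_of_le (h : FluxSol ν m q α κ w u) (h0 : StartsAt a w u) (hν : 1 ≤ ν)
    {R c : ℝ} (hc : ∀ s ∈ Ioc 0 R,
      c ≤ κ * (s * phiP m (u s) + α * w s) + phiP (q + 1) (w s))
    {r : ℝ} (hr : r ∈ Ioc 0 R) : u r ≤ -(c / ν * r) := by
  have hν0 : 0 < ν := by linarith
  have hanti : AntitoneOn (fun s => s ^ (ν - 1) * u s + c / ν * s ^ ν) (Ioc 0 R) := by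
    refine antitoneOn_of_hasDerivAt_nonpos (convex_Ioc 0 R) (fun s hs =>
      (h.hasDerivAt_weighted hs.1).add
        ((Real.hasDerivAt_rpow_const (p := ν) (Or.inl hs.1.ne')).const_mul (c / ν)))
      fun s hs => ?_
    have h1 := mul_le_mul_of_nonneg_left (hc s hs) (Real.rpow_nonneg hs.1.le (ν - 1))
    have h2 : c / ν * (ν * s ^ (ν - 1)) = s ^ (ν - 1) * c := by field_simp
    rw [h2]; linarith
  have hlim : Tendsto (fun s => s ^ (ν - 1) * u s + c / ν * s ^ ν) (𝓝[>] 0) (𝓝 0) := by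
    simpa using (h0.tendsto_weighted hν).add ((tendsto_rpow_zero_right hν0).const_mul (c / ν))
  have h1 := hanti.le_of_tendsto_zero_right hlim hr
  have hpos : 0 < r ^ (ν - 1) := Real.rpow_pos_of_pos hr.1 _
  have h2 : r ^ ν = r ^ (ν - 1) * r := by
    rw [Real.rpow_sub_one hr.1.ne']; field_simp [hr.1.ne']
  simp only [h2] at h1
  have h3 : r ^ (ν - 1) * (u r + c / ν * r) ≤ 0 := by linarith
  have h4 := nonpos_of_mul_nonpos_right h3 hpos
  linarith

lemma FluxSol.le_u_of_le (h : FluxSol ν m q α κ w u) (h0 : StartsAt a w u) (hν : 1 ≤ ν)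
    {R c : ℝ} (hc : ∀ s ∈ Ioc 0 R,
      κ * (s * phiP m (u s) + α * w s) + phiP (q + 1) (w s) ≤ c)
    {r : ℝ} (hr : r ∈ Ioc 0 R) : -(c / ν * r) ≤ u r := by
  have := h.neg.u_le_of_le h0.neg hν (c := -c) (R := R) (fun s hs => by
    simp only [phiP_neg]; linarith [hc s hs]) hr
  have e : -c / ν * r = -(c / ν * r) := by ring
  rw [e] at this; linarith

end FluxSol

section ContinuousDependence

variable {ν m q α : ℝ}

lemma energyZero_mono {κ a b : ℝ} (hα : 0 ≤ α) (hq : 1 < q) (hκ : 0 ≤ κ) (h : |a| ≤ |b|) :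
    energyZero q α κ a ≤ energyZero q α κ b := by
  have h1 : |a| ^ (q + 1) / (q + 1) ≤ |b| ^ (q + 1) / (q + 1) :=
    div_le_div_of_nonneg_right (Real.rpow_le_rpow (abs_nonneg a) h (by linarith)) (by linarith)
  have h4 : κ * α * (a ^ 2 / 2) ≤ κ * α * (b ^ 2 / 2) :=
    mul_le_mul_of_nonneg_left (by linarith [sq_le_sq.2 h]) (by positivity)
  unfold energyZero; linarith

lemma energyZero_nonneg {κ a : ℝ} (hα : 0 ≤ α) (hq : 1 < q) (hκ : 0 ≤ κ) :
    0 ≤ energyZero q α κ a := by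
  have : 0 < q + 1 := by linarith
  unfold energyZero; positivity

lemma FluxSol.abs_phiP_u_le {κ a B : ℝ} {w u : ℝ → ℝ} (h : FluxSol ν m q α κ w u)
    (h0 : StartsAt a w u) (hν : 1 ≤ ν) (hm : 1 < m) (hq : 1 < q) (hα : 0 ≤ α) (hκ : 0 ≤ κ)
    (ha : |a| ≤ |B|) {r : ℝ} (hr : 0 < r) :
    |phiP m (u r)| ≤ ((m * energyZero q α κ B) ^ (1 / m)) ^ (m - 1) := by
  have hm0 : 0 < m := by linarith
  rw [abs_phiP hm]
  refine Real.rpow_le_rpow (abs_nonneg _) ((h.abs_u_le h0 hν hm hq hα hκ hr).trans ?_)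
    (by linarith)
  exact Real.rpow_le_rpow (mul_nonneg hm0.le (energyZero_nonneg hα hq hκ))
    (mul_le_mul_of_nonneg_left (energyZero_mono hα hq hκ ha) hm0.le) (by positivity)

lemma FluxSol.le_w {κ a M : ℝ} {w u : ℝ → ℝ} (h : FluxSol ν m q α κ w u)
    (h0 : StartsAt a w u) {R : ℝ} (hM : ∀ s ∈ Ioc 0 R, |phiP m (u s)| ≤ M) {r : ℝ}
    (hr : r ∈ Ioc 0 R) : a - M * r ≤ w r := by
  have hanti : AntitoneOn (fun s => -w s - M * s) (Ioc 0 R) := by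
    refine antitoneOn_of_hasDerivAt_nonpos (convex_Ioc 0 R) (fun s hs =>
      (h.hw s hs.1).neg.sub ((hasDerivAt_id s).const_mul M)) fun s hs => ?_
    linarith [neg_abs_le (phiP m (u s)), hM s hs]
  have hlim : Tendsto (fun s => -w s - M * s) (𝓝[>] 0) (𝓝 (-a)) := by
    have h1 : Tendsto (fun s : ℝ => M * s) (𝓝[>] 0) (𝓝 0) := by
      have : Continuous fun s : ℝ => M * s := by fun_prop
      simpa using (this.tendsto 0).mono_left nhdsWithin_le_nhds
    simpa using h0.hw.neg.sub h1
  have := hanti.le_of_tendsto_zero_right hlim hr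
  linarith

/-- Near `r = 0` the flux is comparable to `-r`. -/
lemma FluxSol.exists_neg_u_mem_Icc {a₀ : ℝ} (hν : 1 ≤ ν) (hm : 1 < m) (hq : 1 < q) (hα : 0 < α)
    (ha₀ : 0 < a₀) : ∃ r₀ > 0, ∃ c₁ > 0, ∃ c₂ > 0, ∀ a ∈ Icc (a₀ / 2) (2 * a₀), ∀ w u : ℝ → ℝ,
      FluxSol ν m q α 1 w u → StartsAt a w u → ∀ r ∈ Ioc 0 r₀,
        -u r ∈ Icc (c₁ * r) (c₂ * r) := by
  have hν0 : 0 < ν := by linarith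
  set B := 2 * a₀ with hB
  have hB0 : 0 < B := by positivity
  set M := ((m * energyZero q α 1 B) ^ (1 / m)) ^ (m - 1) with hM
  have hM0 : 0 ≤ M := by
    have := energyZero_nonneg (a := B) hα.le hq zero_le_one
    positivity
  set r₀ := min 1 (min (a₀ / (4 * (M + 1))) (α * a₀ / (8 * (M + 1)))) with hr₀
  have hr₀0 : 0 < r₀ := by positivity
  refine ⟨r₀, hr₀0, α * a₀ / 8 / ν, by positivity, (M + α * B + B ^ q) / ν, by positivity, ?_⟩
  intro a ha w u h h0 r hr
  have ha0 : 0 < a := by linarith [ha.1]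
  have haB : |a| ≤ |B| := by rw [abs_of_pos ha0, abs_of_pos hB0]; exact ha.2
  have hψ : ∀ s ∈ Ioc 0 r₀, |phiP m (u s)| ≤ M := fun s hs =>
    h.abs_phiP_u_le h0 hν hm hq hα.le zero_le_one haB hs.1
  have hw1 : ∀ s ∈ Ioc 0 r₀, M * s ≤ a₀ / 4 ∧ M * s ≤ α * a₀ / 8 ∧ s ≤ 1 := by
    intro s hs
    have e1 : s ≤ a₀ / (4 * (M + 1)) :=
      hs.2.trans ((min_le_right _ _).trans (min_le_left _ _))
    have e2 : s ≤ α * a₀ / (8 * (M + 1)) :=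
      hs.2.trans ((min_le_right _ _).trans (min_le_right _ _))
    rw [le_div_iff₀ (by positivity)] at e1 e2
    have := hs.1
    refine ⟨by nlinarith, by nlinarith, hs.2.trans (min_le_left _ _)⟩
  have hlow : ∀ s ∈ Ioc 0 r₀, a₀ / 4 ≤ w s := fun s hs => by
    linarith [h.le_w h0 hψ hs, (hw1 s hs).1, ha.1]
  have hsψ : ∀ s ∈ Ioc 0 r₀, |s * phiP m (u s)| ≤ M * s := fun s hs => by
    rw [abs_mul, abs_of_pos hs.1, mul_comm]
    exact mul_le_mul_of_nonneg_right (hψ s hs) hs.1.le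
  have hwB : ∀ s ∈ Ioc 0 r₀, w s ≤ B := fun s hs => by
    have := h.abs_w_le h0 hν hm hq hα.le zero_le_one hs.1
    rw [abs_of_pos hB0] at haB
    exact (le_abs_self _).trans (this.trans haB)
  constructor
  · have := h.u_le_of_le h0 hν (c := α * a₀ / 8) (fun s hs => by
      have e1 := neg_abs_le (s * phiP m (u s))
      have e2 := hsψ s hs
      have e3 := (hw1 s hs).2.1
      have e4 : α * (a₀ / 4) ≤ α * w s := mul_le_mul_of_nonneg_left (hlow s hs) hα.le
      have e5 : 0 ≤ phiP (q + 1) (w s) := phiP_nonneg (by linarith [hlow s hs])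
      linarith) hr
    linarith
  · have := h.le_u_of_le h0 hν (c := M + α * B + B ^ q) (fun s hs => by
      have e1 := le_abs_self (s * phiP m (u s))
      have e2 := hsψ s hs
      have e3 := mul_le_mul_of_nonneg_left (hw1 s hs).2.2 hM0
      have e4 : α * w s ≤ α * B := mul_le_mul_of_nonneg_left (hwB s hs) hα.le
      have hw0 : 0 ≤ w s := by linarith [hlow s hs]
      have e5 : phiP (q + 1) (w s) ≤ B ^ q := by
        rw [phiP_of_nonneg (by linarith) hw0]
        have : q + 1 - 1 = q := by ring
        rw [this]; exact Real.rpow_le_rpow hw0 (hwB s hs) (by linarith)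
      linarith) hr
    linarith

lemma abs_reaction_sub_le {B x y : ℝ} (hq : 1 < q) (hα : 0 < α) (hx : |x| ≤ B) (hy : |y| ≤ B) :
    |(α * x + phiP (q + 1) x) - (α * y + phiP (q + 1) y)|
      ≤ (α + q * B ^ (q - 1)) * |x - y| := by
  have h1 := phiP_sub_le_of_abs_le (q := q + 1) (by linarith) hx hy
  have e1 : q + 1 - 1 = q := by ring
  have e2 : q + 1 - 2 = q - 1 := by ring
  rw [e1, e2] at h1
  have h2 : |α * (x - y)| = α * |x - y| := by rw [abs_mul, abs_of_pos hα]
  calc _ = |α * (x - y) + (phiP (q + 1) x - phiP (q + 1) y)| := by congr 1; ring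
    _ ≤ |α * (x - y)| + |phiP (q + 1) x - phiP (q + 1) y| := abs_add_le _ _
    _ ≤ _ := by rw [h2]; linarith

/-- The derivative of the squared difference of two fluxes: the diffusion and drift terms are
dissipative. -/
lemma two_mul_flux_sub_le {r x₁ x₂ g₁ g₂ G d : ℝ} (hν : 1 ≤ ν) (hm : 1 < m) (hr : 0 < r)
    (hg : |g₁ - g₂| ≤ G * |d|) :
    2 * ((x₁ - x₂) * ((-((ν - 1) / r * x₁) - r * phiP m x₁ - g₁)
      - (-((ν - 1) / r * x₂) - r * phiP m x₂ - g₂))) ≤ 2 * (|x₁ - x₂| * (G * |d|)) := by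
  have h1 : 0 ≤ (ν - 1) / r * (x₁ - x₂) ^ 2 :=
    mul_nonneg (div_nonneg (by linarith) hr.le) (sq_nonneg _)
  have h2 := mul_nonneg hr.le (sub_mul_phiP_sub_nonneg hm x₁ x₂)
  have h3 : -((x₁ - x₂) * (g₁ - g₂)) ≤ |x₁ - x₂| * (G * |d|) := by
    refine (neg_le_abs _).trans ?_
    rw [abs_mul]
    exact mul_le_mul_of_nonneg_left hg (abs_nonneg _)
  nlinarith

lemma FluxSol.exists_dist_sq_le_near {a₀ : ℝ} (hν : 1 ≤ ν) (hm : 1 < m) (hq : 1 < q)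
    (hα : 0 < α) (ha₀ : 0 < a₀) : ∃ r₀ > 0, ∃ C > 0, ∀ a ∈ Icc (a₀ / 2) (2 * a₀),
      ∀ b ∈ Icc (a₀ / 2) (2 * a₀), ∀ w₁ u₁ w₂ u₂ : ℝ → ℝ,
      FluxSol ν m q α 1 w₁ u₁ → StartsAt a w₁ u₁ → FluxSol ν m q α 1 w₂ u₂ → StartsAt b w₂ u₂ →
      ∀ r ∈ Ioc 0 r₀, (w₁ r - w₂ r) ^ 2 + (u₁ r - u₂ r) ^ 2 ≤ C * (a - b) ^ 2 := by
  obtain ⟨r₀, hr₀, c₁, hc₁, c₂, hc₂, hu⟩ :=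
    FluxSol.exists_neg_u_mem_Icc (a₀ := a₀) hν hm hq hα ha₀
  set B := 2 * a₀ with hB
  have hB0 : 0 < B := by positivity
  set G := α + q * B ^ (q - 1) with hG
  have hG0 : 0 < G := by positivity
  set K := (m - 1) * (c₁ ^ (m - 1 - 1) + c₂ ^ (m - 1 - 1)) with hK
  have hK0 : 0 < K := mul_pos (by linarith) (by positivity)
  have hm1 : 0 < m - 1 := by linarith
  refine ⟨r₀, hr₀, Real.exp (G * r₀ + K / (m - 1) * r₀ ^ (m - 1)), Real.exp_pos _, ?_⟩
  intro a ha b hb w₁ u₁ w₂ u₂ h₁ h₁0 h₂ h₂0 r hr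
  have hab : ∀ a ∈ Icc (a₀ / 2) B, |a| ≤ B := fun a ha => by
    rw [abs_of_nonneg (by linarith [ha.1])]; exact ha.2
  have hanti := antitoneOn_mul_exp_neg (convex_Ioc 0 r₀)
    (V := fun r => (w₁ r - w₂ r) ^ 2 + (u₁ r - u₂ r) ^ 2)
    (Φ := fun r => G * r + K / (m - 1) * r ^ (m - 1))
    (Φ' := fun r => G + K * r ^ (m - 1 - 1))
    (fun s hs => (((h₁.hw s hs.1).sub (h₂.hw s hs.1)).pow 2).add
      (((h₁.hu s hs.1).sub (h₂.hu s hs.1)).pow 2))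
    (fun s hs => by
      refine (((hasDerivAt_id s).const_mul G).add
        ((Real.hasDerivAt_rpow_const (p := m - 1) (Or.inl hs.1.ne')).const_mul
          (K / (m - 1)))).congr_deriv ?_
      field_simp) (fun s hs => by
      have e1 := (h₁.abs_w_le h₁0 hν hm hq hα.le zero_le_one hs.1).trans (hab a ha)
      have e2 := (h₂.abs_w_le h₂0 hν hm hq hα.le zero_le_one hs.1).trans (hab b hb)
      have e3 := two_mul_flux_sub_le (x₁ := u₁ s) (x₂ := u₂ s) hν hm hs.1
        (abs_reaction_sub_le hq hα e1 e2)
      have e4 : |phiP m (u₁ s) - phiP m (u₂ s)| ≤ K * s ^ (m - 1 - 1) * |u₁ s - u₂ s| := by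
        have f1 := hu a ha w₁ u₁ h₁ h₁0 s hs
        have f2 := hu b hb w₂ u₂ h₂ h₂0 s hs
        have g1 : ∀ x, -x ∈ Icc (c₁ * s) (c₂ * s) → phiP m x = -((-x) ^ (m - 1)) := by
          intro x hx
          rw [← phiP_of_pos ((mul_pos hc₁ hs.1).trans_le hx.1), phiP_neg, neg_neg]
        rw [g1 _ f1, g1 _ f2]
        have := abs_rpow_sub_le_of_mem_Icc hm1 hc₁ hs.1 f1 f2
        rw [← abs_neg, neg_sub]
        have e : -u₁ s - -u₂ s = -(u₁ s - u₂ s) := by ring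
        rw [e, abs_neg] at this
        convert this using 2
        ring
      have e5 : 2 * ((w₁ s - w₂ s) * (phiP m (u₁ s) - phiP m (u₂ s))) ≤
          2 * (|w₁ s - w₂ s| * (K * s ^ (m - 1 - 1) * |u₁ s - u₂ s|)) := by
        have := le_abs_self ((w₁ s - w₂ s) * (phiP m (u₁ s) - phiP m (u₂ s)))
        rw [abs_mul] at this
        have := mul_le_mul_of_nonneg_left e4 (abs_nonneg (w₁ s - w₂ s))
        linarith
      have hKs : 0 ≤ K * s ^ (m - 1 - 1) := mul_nonneg hK0.le (Real.rpow_nonneg hs.1.le _)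
      have e6 : 2 * (|w₁ s - w₂ s| * |u₁ s - u₂ s|) ≤
          (w₁ s - w₂ s) ^ 2 + (u₁ s - u₂ s) ^ 2 := by
        rw [← sq_abs (w₁ s - w₂ s), ← sq_abs (u₁ s - u₂ s)]
        nlinarith [sq_nonneg (|w₁ s - w₂ s| - |u₁ s - u₂ s|)]
      have e7 := mul_le_mul_of_nonneg_left e6 hKs
      have e8 := mul_le_mul_of_nonneg_left e6 hG0.le
      simp only [Pi.sub_apply]
      push_cast
      rw [← hG] at e3
      linarith)
  have hlim : Tendsto (fun r => ((w₁ r - w₂ r) ^ 2 + (u₁ r - u₂ r) ^ 2) *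
      Real.exp (-(G * r + K / (m - 1) * r ^ (m - 1)))) (𝓝[>] 0) (𝓝 ((a - b) ^ 2)) := by
    have l1 := ((h₁0.hw.sub h₂0.hw).pow 2).add ((h₁0.hu.sub h₂0.hu).pow 2)
    have l2 : Tendsto (fun r : ℝ => G * r) (𝓝[>] 0) (𝓝 0) := by
      have : Continuous fun s : ℝ => G * s := by fun_prop
      simpa using (this.tendsto 0).mono_left nhdsWithin_le_nhds
    have l3 := (l2.add ((tendsto_rpow_zero_right hm1).const_mul (K / (m - 1)))).neg.rexp
    have := l1.mul l3
    simpa using this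
  have hfin := hanti.le_of_tendsto_zero_right hlim hr
  rw [Real.exp_neg, ← div_eq_mul_inv, div_le_iff₀ (Real.exp_pos _)] at hfin
  refine hfin.trans ?_
  rw [mul_comm]
  refine mul_le_mul_of_nonneg_right (Real.exp_le_exp.2 ?_) (sq_nonneg _)
  have := Real.rpow_le_rpow hr.1.le hr.2 hm1.le
  have hk : 0 ≤ K / (m - 1) := by positivity
  exact add_le_add (mul_le_mul_of_nonneg_left hr.2 hG0.le) (mul_le_mul_of_nonneg_left this hk)

lemma add_shifted_flux_sub_le {z d s k G g T : ℝ} (hν : 1 ≤ ν) (hG0 : 0 ≤ G) (hs0 : 0 < s)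
    (hsk : 1 / s ≤ k) (eg : |g| ≤ G * |d|) (hT : T ≤ 2 * (|z| * (G * |d|))) :
    T + 2 * ((z + s * d) * (-((ν - 1) * (1 / s) * z) + d - g)) ≤
      (8 * G * k + 8 * k + 2 * (ν - 1) * k) * (z ^ 2 + (z + s * d) ^ 2) := by
  have hk0 : 0 < k := (by positivity : 0 < 1 / s).trans_le hsk
  obtain ⟨F, hF⟩ : ∃ F, F = z + s * d := ⟨_, rfl⟩
  rw [← hF]
  have hdk : |d| ≤ k * (|F| + |z|) := by
    have : d = 1 / s * (F - z) := by rw [hF]; field_simp; ring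
    rw [this, abs_mul, abs_of_pos (by positivity : 0 < 1 / s)]
    exact mul_le_mul hsk (abs_sub _ _) (abs_nonneg _) hk0.le
  have e4 : 2 * (F * (-((ν - 1) * (1 / s) * z) + d - g)) ≤
      2 * (|F| * ((ν - 1) * k * |z| + (1 + G) * (k * (|F| + |z|)))) := by
    have f1 : |-((ν - 1) * (1 / s) * z) + d - g| ≤
        (ν - 1) * k * |z| + (1 + G) * (k * (|F| + |z|)) := by
      have t1 : |(ν - 1) * (1 / s) * z| ≤ (ν - 1) * k * |z| := by
        rw [abs_mul, abs_mul, abs_of_nonneg (by linarith : 0 ≤ ν - 1),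
          abs_of_pos (by positivity : 0 < 1 / s)]
        have : 0 ≤ ν - 1 := by linarith
        gcongr
      have t2 := abs_sub (-((ν - 1) * (1 / s) * z) + d) g
      have t3 := abs_add_le (-((ν - 1) * (1 / s) * z)) d
      rw [abs_neg] at t3
      have t4 : G * |d| ≤ G * (k * (|F| + |z|)) := mul_le_mul_of_nonneg_left hdk hG0
      linarith
    have f2 := le_abs_self (F * (-((ν - 1) * (1 / s) * z) + d - g))
    rw [abs_mul] at f2
    have := mul_le_mul_of_nonneg_left f1 (abs_nonneg F)
    linarith
  have e5 : |z| * (G * |d|) ≤ |z| * (G * (k * (|F| + |z|))) := by gcongr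
  have e6 : 2 * (|z| * |F|) ≤ z ^ 2 + F ^ 2 := by
    rw [← sq_abs z, ← sq_abs F]
    nlinarith [sq_nonneg (|z| - |F|)]
  have hz2 : |z| * |z| = z ^ 2 := by rw [← sq_abs z]; ring
  have hF2 : |F| * |F| = F ^ 2 := by rw [← sq_abs F]; ring
  have e7 : 2 * (|z| * (G * |d|)) +
      2 * (|F| * ((ν - 1) * k * |z| + (1 + G) * (k * (|F| + |z|)))) ≤
      (8 * G * k + 8 * k + 2 * (ν - 1) * k) * (z ^ 2 + F ^ 2) := by
    have hGk : 0 ≤ G * k := by positivity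
    have hνk : 0 ≤ (ν - 1) * k := mul_nonneg (by linarith) hk0.le
    have t1 := mul_le_mul_of_nonneg_left e6 hGk
    have t2 := mul_le_mul_of_nonneg_left e6 hνk
    have t3 := mul_le_mul_of_nonneg_left e6 hk0.le
    have t4 := mul_nonneg hGk (sq_nonneg z)
    have t5 := mul_nonneg hGk (sq_nonneg F)
    have t6 := mul_nonneg hk0.le (sq_nonneg z)
    have t7 := mul_nonneg hk0.le (sq_nonneg F)
    have t8 := mul_nonneg hνk (sq_nonneg z)
    have t9 := mul_nonneg hνk (sq_nonneg F)
    have x1 : |z| * (G * (k * (|F| + |z|))) = G * k * (|z| * |F|) + G * k * z ^ 2 := by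
      rw [← hz2]; ring
    have x2 : |F| * ((ν - 1) * k * |z| + (1 + G) * (k * (|F| + |z|))) =
        (ν - 1) * k * (|z| * |F|) + (k + G * k) * F ^ 2 + (k + G * k) * (|z| * |F|) := by
      rw [← hF2]; ring
    rw [x1] at e5
    rw [x2]
    linarith
  linarith

lemma sq_add_sq_le_shifted {z d r k : ℝ} (hrk : 1 ≤ k * r) :
    d ^ 2 + z ^ 2 ≤ (1 + 4 * k ^ 2) * (z ^ 2 + (z + r * d) ^ 2) := by
  have t1 : d ^ 2 ≤ (k * r * d) ^ 2 := by
    rw [mul_pow]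
    exact le_mul_of_one_le_left (sq_nonneg d) (one_le_pow₀ hrk)
  have t2 : (k * r * d) ^ 2 ≤ 4 * k ^ 2 * (z ^ 2 + (z + r * d) ^ 2) := by
    have : (r * d) ^ 2 ≤ 4 * (z ^ 2 + (z + r * d) ^ 2) := by
      nlinarith [sq_nonneg (2 * z + r * d)]
    have := mul_le_mul_of_nonneg_left this (sq_nonneg k)
    linarith
  linarith [sq_nonneg (z + r * d)]

/-- Locally Lipschitz dependence of solutions on the value at the origin. -/
lemma FluxSol.exists_dist_sq_le {a₀ : ℝ} (hν : 1 ≤ ν) (hm : 1 < m) (hq : 1 < q)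
    (hα : 0 < α) (ha₀ : 0 < a₀) (R : ℝ) : ∃ C > 0, ∀ a ∈ Icc (a₀ / 2) (2 * a₀),
      ∀ b ∈ Icc (a₀ / 2) (2 * a₀), ∀ w₁ u₁ w₂ u₂ : ℝ → ℝ,
      FluxSol ν m q α 1 w₁ u₁ → StartsAt a w₁ u₁ → FluxSol ν m q α 1 w₂ u₂ → StartsAt b w₂ u₂ →
      ∀ r ∈ Ioc 0 R, (w₁ r - w₂ r) ^ 2 + (u₁ r - u₂ r) ^ 2 ≤ C * (a - b) ^ 2 := by
  obtain ⟨r₀, hr₀, C, hC, hnear⟩ :=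
    FluxSol.exists_dist_sq_le_near (a₀ := a₀) hν hm hq hα ha₀
  set B := 2 * a₀ with hB
  have hB0 : 0 < B := by positivity
  set G := α + q * B ^ (q - 1) with hG
  have hG0 : 0 < G := by positivity
  set k := 1 / r₀ with hk
  have hk0 : 0 < k := by positivity
  set K := 8 * G * k + 8 * k + 2 * (ν - 1) * k with hK
  set C' := (1 + 4 * k ^ 2) * ((3 + 2 * r₀ ^ 2) * C * Real.exp (K * (R - r₀))) with hC'
  have hC'0 : 0 < C' := by positivity
  refine ⟨C + C', by positivity, ?_⟩
  intro a ha b hb w₁ u₁ w₂ u₂ h₁ h₁0 h₂ h₂0 r hr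
  have hn := hnear a ha b hb w₁ u₁ w₂ u₂ h₁ h₁0 h₂ h₂0
  rcases le_or_gt r r₀ with hrr | hrr
  · have := hn r ⟨hr.1, hrr⟩
    nlinarith [mul_nonneg hC'0.le (sq_nonneg (a - b))]
  have hab : ∀ a ∈ Icc (a₀ / 2) B, |a| ≤ B := fun a ha => by
    rw [abs_of_nonneg (by linarith [ha.1])]; exact ha.2
  have hpos : ∀ s ∈ Icc r₀ R, 0 < s := fun s hs => hr₀.trans_le hs.1
  have hanti := antitoneOn_mul_exp_neg (convex_Icc r₀ R)
    (V := fun r => (u₁ r - u₂ r) ^ 2 + ((u₁ r - u₂ r) + r * (w₁ r - w₂ r)) ^ 2)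
    (Φ := fun r => K * r)
    (Φ' := fun r => K)
    (fun s hs => ((((h₁.hu s (hpos s hs)).sub (h₂.hu s (hpos s hs))).pow 2)).add
      (((((h₁.hu s (hpos s hs)).sub (h₂.hu s (hpos s hs)))).add
        ((hasDerivAt_id s).mul ((h₁.hw s (hpos s hs)).sub (h₂.hw s (hpos s hs))))).pow 2))
    (fun s hs => ((hasDerivAt_id s).const_mul K).congr_deriv (mul_one K)) (fun s hs => by
      have hs0 := hpos s hs
      have e1 := (h₁.abs_w_le h₁0 hν hm hq hα.le zero_le_one hs0).trans (hab a ha)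
      have e2 := (h₂.abs_w_le h₂0 hν hm hq hα.le zero_le_one hs0).trans (hab b hb)
      have eg := abs_reaction_sub_le hq hα e1 e2
      rw [← hG] at eg
      have e3 := two_mul_flux_sub_le (x₁ := u₁ s) (x₂ := u₂ s) hν hm hs0 eg
      have hsk : 1 / s ≤ k := one_div_le_one_div_of_le hr₀ hs.1
      have e4 := add_shifted_flux_sub_le (k := k) hν hG0.le hs0 hsk eg e3
      refine le_trans (le_of_eq ?_) e4
      simp only [Pi.sub_apply, Pi.add_apply, Pi.mul_apply, id]
      push_cast
      ring)
  have hle := hanti ⟨le_rfl, hrr.le.trans hr.2⟩ ⟨hrr.le, hr.2⟩ hrr.le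
  have h3 := hn r₀ ⟨hr₀, le_rfl⟩
  beta_reduce at hle
  generalize u₁ r - u₂ r = z at hle ⊢
  generalize w₁ r - w₂ r = d at hle ⊢
  generalize u₁ r₀ - u₂ r₀ = z₀ at hle h3
  generalize w₁ r₀ - w₂ r₀ = d₀ at hle h3
  have hV0 : z₀ ^ 2 + (z₀ + r₀ * d₀) ^ 2 ≤ (3 + 2 * r₀ ^ 2) * C * (a - b) ^ 2 := by
    have : z₀ ^ 2 + (z₀ + r₀ * d₀) ^ 2 ≤ (3 + 2 * r₀ ^ 2) * (d₀ ^ 2 + z₀ ^ 2) := by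
      nlinarith [sq_nonneg (z₀ - r₀ * d₀), sq_nonneg (r₀ * z₀), sq_nonneg d₀]
    refine this.trans ?_
    rw [mul_assoc]
    exact mul_le_mul_of_nonneg_left h3 (by positivity)
  have hV : z ^ 2 + (z + r * d) ^ 2 ≤
      (3 + 2 * r₀ ^ 2) * C * (a - b) ^ 2 * Real.exp (K * (R - r₀)) := by
    rw [Real.exp_neg, ← div_eq_mul_inv, div_le_iff₀ (Real.exp_pos _), mul_assoc,
      ← Real.exp_add] at hle
    refine hle.trans (mul_le_mul hV0 (Real.exp_le_exp.2 ?_) (Real.exp_pos _).le (by positivity))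
    have hK0 : 0 ≤ K := by
      have : 0 ≤ 2 * (ν - 1) * k := mul_nonneg (by linarith) hk0.le
      positivity
    nlinarith [mul_le_mul_of_nonneg_left hr.2 hK0]
  have hdz : d ^ 2 + z ^ 2 ≤ (1 + 4 * k ^ 2) * (z ^ 2 + (z + r * d) ^ 2) := by
    have hrk : 1 ≤ k * r := by
      rw [hk, one_div, ← div_eq_inv_mul, one_le_div hr₀]; exact hrr.le
    exact sq_add_sq_le_shifted hrk
  have hfin := hdz.trans (mul_le_mul_of_nonneg_left hV (by positivity))
  have : (1 + 4 * k ^ 2) * ((3 + 2 * r₀ ^ 2) * C * (a - b) ^ 2 * Real.exp (K * (R - r₀))) =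
      C' * (a - b) ^ 2 := by rw [hC']; ring
  rw [this] at hfin
  nlinarith [mul_nonneg hC.le (sq_nonneg (a - b))]

end ContinuousDependence

section Trapping

lemma antitoneOn_Icc_of_hasDerivAt_nonpos {a b : ℝ} {f f' : ℝ → ℝ}
    (hf : ∀ x ∈ Icc a b, HasDerivAt f (f' x) x) (hf' : ∀ x ∈ Ioo a b, f' x ≤ 0) :
    AntitoneOn f (Icc a b) :=
  antitoneOn_of_deriv_nonpos (convex_Icc a b)
    (fun x hx => (hf x hx).continuousAt.continuousWithinAt)
    (fun x hx => (hf x (interior_subset hx)).differentiableAt.differentiableWithinAt)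
    (fun x hx => by
      rw [(hf x (interior_subset hx)).deriv]
      rw [interior_Icc] at hx
      exact hf' x hx)

lemma HasDerivAt.nonneg_of_le_left {f : ℝ → ℝ} {f' a b : ℝ} (hf : HasDerivAt f f' b)
    (hab : a < b) (h : ∀ x ∈ Ioo a b, f x ≤ f b) : 0 ≤ f' := by
  have ht := (hasDerivAt_iff_tendsto_slope_left_right.1 hf).1
  refine ge_of_tendsto ht ?_
  filter_upwards [Ioo_mem_nhdsLT hab] with x hx
  rw [slope_def_field]
  exact div_nonneg_of_nonpos (by linarith [h x hx]) (by linarith [hx.2])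

variable {ν m q α : ℝ}

lemma FluxSol.hasDerivAt_rpow_mul_add {w u : ℝ → ℝ} (h : FluxSol ν m q α 1 w u) {s : ℝ}
    (hs : 0 < s) :
    HasDerivAt (fun r => r ^ α * w r + r ^ (α - 1) * u r)
      (s ^ (α - 1) * ((α - ν) * u s / s - phiP (q + 1) (w s))) s := by
  refine (((Real.hasDerivAt_rpow_const (p := α) (Or.inl hs.ne')).mul (h.hw s hs)).add
    ((Real.hasDerivAt_rpow_const (p := α - 1) (Or.inl hs.ne')).mul (h.hu s hs))).congr_deriv ?_
  rw [Real.rpow_sub_one hs.ne' (α - 1), Real.rpow_sub_one hs.ne' α]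
  field_simp
  ring

set_option maxHeartbeats 1000000 in
/-- A solution that is close to `ℓ r^{-α}` with a controlled flux at a large radius stays so. -/
lemma FluxSol.abs_sub_lt_of_trap {w u : ℝ → ℝ} (h : FluxSol ν m q α 1 w u) (hν : 1 ≤ ν)
    (hm : 1 < m) (hq : 1 < q) (hα : 0 < α) {ℓ K β η σ R : ℝ} (hℓ : 0 < ℓ) (hK0 : 0 < K)
    (hβ : β = (α + 1) / (m - 1)) (hη : η = β + 1 - α) (hσ0 : 0 < σ) (hση : σ ≤ η)
    (hσq : σ ≤ α * (q - 1)) (hK : (α + 1) * (3 * ℓ / 2) + 1 ≤ K ^ (m - 1)) (hR : 1 ≤ R)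
    (hR1 : ∀ r ≥ R, K * r ^ (-η) < ℓ / 16)
    (hR2 : (|α - ν| * K + (3 * ℓ / 2) ^ q) / σ * R ^ (-σ) < ℓ / 16)
    (hR3 : ∀ r ≥ R, β * K * r ^ (-η) < 1) (hR4 : ∀ r ≥ R, 3 * ℓ / 2 * r ^ (-α) ≤ 1)
    (hw : |R ^ α * w R - ℓ| < ℓ / 8) (hu : |u R| * R ^ β < K) :
    ∀ r ≥ R, |r ^ α * w r - ℓ| < ℓ / 2 := by
  have hm1 : 0 < m - 1 := by linarith
  by_contra! hcon
  obtain ⟨r₁, hr₁, hbad⟩ := hcon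
  set f : ℝ → ℝ := fun r => |r ^ α * w r - ℓ| with hf
  set g : ℝ → ℝ := fun r => |u r| * r ^ β with hg
  have hpos : ∀ r ∈ Ici R, 0 < r := fun r hr => by
    have : R ≤ r := hr
    linarith
  have hfc : ∀ r ∈ Ici R, ContinuousAt f r := fun r hr =>
    (((Real.continuousAt_rpow_const r α (Or.inr hα.le)).mul
      (h.continuousAt_w (hpos r hr))).sub continuousAt_const).abs
  have hgc : ∀ r ∈ Ici R, ContinuousAt g r := fun r hr =>
    (h.continuousAt_u (hpos r hr)).abs.mul
      (Real.continuousAt_rpow_const r β (Or.inl (hpos r hr).ne'))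
  set S := (Ici R ∩ f ⁻¹' Ici (ℓ / 2)) ∪ (Ici R ∩ g ⁻¹' Ici K) with hS
  have hSc : IsClosed S :=
    (ContinuousOn.preimage_isClosed_of_isClosed
      (fun r hr => (hfc r hr).continuousWithinAt) isClosed_Ici isClosed_Ici).union
    (ContinuousOn.preimage_isClosed_of_isClosed
      (fun r hr => (hgc r hr).continuousWithinAt) isClosed_Ici isClosed_Ici)
  have hSne : S.Nonempty := ⟨r₁, Or.inl ⟨hr₁, hbad⟩⟩
  have hSb : BddBelow S := ⟨R, by rintro x (hx | hx) <;> exact hx.1⟩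
  set T := sInf S with hT
  have hTS : T ∈ S := hSc.csInf_mem hSne hSb
  have hTR' : R ≤ T := by rcases hTS with hx | hx <;> exact hx.1
  have hgood : ∀ r ∈ Ico R T, f r < ℓ / 2 ∧ g r < K := by
    intro r hr
    have : r ∉ S := notMem_of_lt_csInf hr.2 hSb
    constructor
    · by_contra! hc; exact this (Or.inl ⟨hr.1, hc⟩)
    · by_contra! hc; exact this (Or.inr ⟨hr.1, hc⟩)
  have hTR : R < T := by
    refine lt_of_le_of_ne hTR' fun he => ?_
    rcases hTS with hx | hx
    · have h1 : ℓ / 2 ≤ f T := hx.2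
      rw [← he, hf] at h1; simp only at h1; linarith
    · have h1 : K ≤ g T := hx.2
      rw [← he, hg] at h1; simp only at h1; linarith
  have hT0 : 0 < T := hpos T hTR'
  have hgT : g T ≤ K := by
    refine le_of_tendsto ((hgc T hTR').tendsto.mono_left (nhdsWithin_le_nhds (s := Iio T))) ?_
    filter_upwards [Ioo_mem_nhdsLT hTR] with r hr
    exact (hgood r ⟨hr.1.le, hr.2⟩).2.le
  -- bounds in terms of powers
  have hub : ∀ r ∈ Ici R, g r ≤ K → |u r| ≤ K * r ^ (-β) := by
    intro r hr hgr
    have hr0 := hpos r hr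
    rw [Real.rpow_neg hr0.le, ← div_eq_mul_inv, le_div_iff₀ (by positivity)]
    exact hgr
  have hwb : ∀ r ∈ Ici R, f r < ℓ / 2 → |w r| ≤ 3 * ℓ / 2 * r ^ (-α) := by
    intro r hr hfr
    have hr0 := hpos r hr
    rw [Real.rpow_neg hr0.le, ← div_eq_mul_inv, le_div_iff₀ (by positivity)]
    have h1 : |w r| * r ^ α = |r ^ α * w r| := by
      rw [abs_mul, abs_of_pos (by positivity : 0 < r ^ α), mul_comm]
    rw [h1]
    have := abs_sub_abs_le_abs_sub (r ^ α * w r) ℓ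
    rw [abs_of_pos hℓ] at this
    have : f r = |r ^ α * w r - ℓ| := rfl
    linarith
  set C := |α - ν| * K + (3 * ℓ / 2) ^ q with hC
  have hC0 : 0 ≤ C := by positivity
  set J : ℝ → ℝ := fun r => r ^ α * w r + r ^ (α - 1) * u r with hJ
  have hJ' : ∀ r ∈ Ioo R T, |r ^ (α - 1) * ((α - ν) * u r / r - phiP (q + 1) (w r))| ≤
      C * r ^ (-σ - 1) := by
    intro r hr
    have hrR : r ∈ Ici R := hr.1.le
    have hr0 := hpos r hrR
    have hr1 : 1 ≤ r := hR.trans hrR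
    obtain ⟨g1, g2⟩ := hgood r ⟨hr.1.le, hr.2⟩
    have e1 := hub r hrR g2.le
    have e2 := hwb r hrR g1
    have e3 : |phiP (q + 1) (w r)| ≤ (3 * ℓ / 2) ^ q * r ^ (-α * q) := by
      rw [abs_phiP (by linarith), Real.rpow_mul hr0.le,
        ← Real.mul_rpow (by positivity) (by positivity)]
      have : q + 1 - 1 = q := by ring
      rw [this]
      exact Real.rpow_le_rpow (abs_nonneg _) e2 (by linarith)
    have e4 : |(α - ν) * u r / r| ≤ |α - ν| * K * r ^ (-β - 1) := by
      rw [abs_div, abs_mul, abs_of_pos hr0, Real.rpow_sub_one hr0.ne', ← mul_div_assoc]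
      refine div_le_div_of_nonneg_right ?_ hr0.le
      rw [mul_assoc]
      exact mul_le_mul_of_nonneg_left e1 (abs_nonneg _)
    have e5 : r ^ (α - 1) * r ^ (-β - 1) ≤ r ^ (-σ - 1) := by
      rw [← Real.rpow_add hr0]
      exact Real.rpow_le_rpow_of_exponent_le hr1 (by linarith)
    have e6 : r ^ (α - 1) * r ^ (-α * q) ≤ r ^ (-σ - 1) := by
      rw [← Real.rpow_add hr0]
      exact Real.rpow_le_rpow_of_exponent_le hr1 (by nlinarith)
    rw [abs_mul, abs_of_pos (by positivity : 0 < r ^ (α - 1))]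
    calc r ^ (α - 1) * |(α - ν) * u r / r - phiP (q + 1) (w r)|
        ≤ r ^ (α - 1) * (|α - ν| * K * r ^ (-β - 1) + (3 * ℓ / 2) ^ q * r ^ (-α * q)) :=
          mul_le_mul_of_nonneg_left ((abs_sub _ _).trans (add_le_add e4 e3)) (by positivity)
      _ = |α - ν| * K * (r ^ (α - 1) * r ^ (-β - 1)) +
          (3 * ℓ / 2) ^ q * (r ^ (α - 1) * r ^ (-α * q)) := by ring
      _ ≤ |α - ν| * K * r ^ (-σ - 1) + (3 * ℓ / 2) ^ q * r ^ (-σ - 1) :=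
          add_le_add (mul_le_mul_of_nonneg_left e5 (by positivity))
            (mul_le_mul_of_nonneg_left e6 (by positivity))
      _ = _ := by rw [hC]; ring
  have hpow : ∀ r ∈ Icc R T, HasDerivAt (fun x : ℝ => C / σ * x ^ (-σ)) (-(C * r ^ (-σ - 1))) r := by
    intro r hr
    refine ((Real.hasDerivAt_rpow_const (p := -σ)
      (Or.inl (hpos r hr.1).ne')).const_mul (C / σ)).congr_deriv ?_
    field_simp
  have hJd : ∀ r ∈ Icc R T, HasDerivAt J
      (r ^ (α - 1) * ((α - ν) * u r / r - phiP (q + 1) (w r))) r := fun r hr =>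
    h.hasDerivAt_rpow_mul_add (hpos r hr.1)
  have hJup := antitoneOn_Icc_of_hasDerivAt_nonpos
    (fun r hr => (hJd r hr).add (hpow r hr)) fun r hr => by
      linarith [le_abs_self (r ^ (α - 1) * ((α - ν) * u r / r - phiP (q + 1) (w r))), hJ' r hr]
  have hJlo := antitoneOn_Icc_of_hasDerivAt_nonpos
    (fun r hr => (hJd r hr).neg.add (hpow r hr)) fun r hr => by
      linarith [neg_abs_le (r ^ (α - 1) * ((α - ν) * u r / r - phiP (q + 1) (w r))), hJ' r hr]
  have hRm : R ∈ Icc R T := left_mem_Icc.2 hTR'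
  have hTm : T ∈ Icc R T := right_mem_Icc.2 hTR'
  have b1 := hJup hRm hTm hTR'
  have b2 := hJlo hRm hTm hTR'
  simp only [Pi.add_apply, Pi.neg_apply] at b1 b2
  have b3 : 0 ≤ C / σ * T ^ (-σ) := by positivity
  have hfl : ∀ r ∈ Ici R, g r ≤ K → |r ^ (α - 1) * u r| < ℓ / 16 := by
    intro r hr hgr
    have hr0 := hpos r hr
    rw [abs_mul, abs_of_pos (by positivity : 0 < r ^ (α - 1))]
    refine lt_of_le_of_lt ?_ (hR1 r hr)
    calc _ ≤ r ^ (α - 1) * (K * r ^ (-β)) :=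
          mul_le_mul_of_nonneg_left (hub r hr hgr) (by positivity)
      _ = K * r ^ (-η) := by
          rw [mul_left_comm, ← Real.rpow_add hr0, hη]; ring_nf
  have c1 := abs_lt.1 (hfl T hTR' hgT)
  have c2 := abs_lt.1 (hfl R (mem_Ici.2 le_rfl) hu.le)
  have c3 := abs_lt.1 hw
  have hfT : f T < ℓ / 2 := by
    rw [hf]
    simp only [hJ] at b1 b2
    exact abs_lt.2 ⟨by linarith, by linarith⟩
  have hgT' : K ≤ g T := by
    rcases hTS with hx | hx
    · exact absurd hx.2 (not_le.2 hfT)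
    · exact hx.2
  have hgTe : g T = K := le_antisymm hgT hgT'
  have huT : |u T| = K * T ^ (-β) := by
    rw [Real.rpow_neg hT0.le, ← div_eq_mul_inv, eq_div_iff (by positivity)]
    exact hgTe
  have hder : HasDerivAt (fun r => (u r) ^ 2 * r ^ (2 * β)) _ T :=
    ((h.hu T hT0).pow 2).mul (Real.hasDerivAt_rpow_const (p := 2 * β) (Or.inl hT0.ne'))
  have hsq : ∀ r ∈ Ici R, (u r) ^ 2 * r ^ (2 * β) = g r ^ 2 := by
    intro r hr
    rw [hg, mul_pow, sq_abs, mul_comm 2 β, Real.rpow_mul (hpos r hr).le]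
    norm_cast
  have hnn := hder.nonneg_of_le_left hTR fun r hr => by
    rw [hsq r hr.1.le, hsq T hTR', hgTe]
    have : 0 ≤ g r := mul_nonneg (abs_nonneg _) (Real.rpow_nonneg (hpos r hr.1.le).le _)
    exact pow_le_pow_left₀ this (hgood r ⟨hr.1.le, hr.2⟩).2.le 2
  have hwT := hwb T hTR' hfT
  have hwT1 : |w T| ≤ 1 := hwT.trans (hR4 T hTR')
  have hreac : |α * w T + phiP (q + 1) (w T)| ≤ (α + 1) * (3 * ℓ / 2) * T ^ (-α) := by
    have e1 : |phiP (q + 1) (w T)| ≤ |w T| := by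
      rw [abs_phiP (by linarith)]
      have : q + 1 - 1 = q := by ring
      rw [this]
      exact Real.rpow_le_self_of_le_one (abs_nonneg _) hwT1 hq.le
    have e2 := abs_add_le (α * w T) (phiP (q + 1) (w T))
    rw [abs_mul, abs_of_pos hα] at e2
    have e3 := mul_le_mul_of_nonneg_left hwT (by linarith : 0 ≤ α + 1)
    linarith
  have humul : u T * phiP m (u T) = |u T| * (K ^ (m - 1) * T ^ (-(α + 1))) := by
    rw [mul_phiP hm]
    have h0 : 0 < |u T| := by rw [huT]; positivity
    have e : |u T| ^ m = |u T| * |u T| ^ (m - 1) := by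
      rw [Real.rpow_sub_one h0.ne']; field_simp
    have e' : |u T| ^ (m - 1) = K ^ (m - 1) * T ^ (-(α + 1)) := by
      rw [huT, Real.mul_rpow hK0.le (by positivity), ← Real.rpow_mul hT0.le, hβ]
      congr 2
      field_simp
    rw [e, e']
  have hT1 : T * T ^ (-(α + 1)) = T ^ (-α) := by
    nth_rewrite 1 [← Real.rpow_one T]
    rw [← Real.rpow_add hT0]; ring_nf
  have huu : |u T| * |u T| = u T ^ 2 := by rw [← sq_abs]; ring
  have hβT : β * |u T| / T = β * K * T ^ (-η) * T ^ (-α) := by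
    rw [huT, mul_assoc (β * K), ← Real.rpow_add hT0, hη]
    have : -(β + 1 - α) + -α = -β - 1 := by ring
    rw [this, Real.rpow_sub_one hT0.ne']
    ring
  have hTα : 0 < T ^ (-α) := by positivity
  have hu0 : 0 < |u T| := by rw [huT]; positivity
  have key : u T * (-((ν - 1) / T * u T) - 1 * (T * phiP m (u T) + α * w T)
      - phiP (q + 1) (w T)) + β * u T ^ 2 / T < 0 := by
    have k1 : 0 ≤ (ν - 1) / T * u T ^ 2 :=
      mul_nonneg (div_nonneg (by linarith) hT0.le) (sq_nonneg _)
    have k2 : T * (u T * phiP m (u T)) = |u T| * (K ^ (m - 1) * T ^ (-α)) := by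
      rw [humul, ← hT1]; ring
    have k3 : -(u T * (α * w T + phiP (q + 1) (w T))) ≤
        |u T| * ((α + 1) * (3 * ℓ / 2) * T ^ (-α)) := by
      refine (neg_le_abs _).trans ?_
      rw [abs_mul]
      exact mul_le_mul_of_nonneg_left hreac hu0.le
    have k4 : β * u T ^ 2 / T = |u T| * (β * K * T ^ (-η) * T ^ (-α)) := by
      rw [← hβT, ← huu]; ring
    have k5 : |u T| * ((α + 1) * (3 * ℓ / 2) * T ^ (-α)) + |u T| * (β * K * T ^ (-η) * T ^ (-α))
        < |u T| * (K ^ (m - 1) * T ^ (-α)) := by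
      rw [← mul_add, ← add_mul]
      refine mul_lt_mul_of_pos_left (mul_lt_mul_of_pos_right ?_ hTα) hu0
      linarith [hR3 T hTR']
    rw [k4]
    have k6 : u T * (-((ν - 1) / T * u T) - 1 * (T * phiP m (u T) + α * w T)
        - phiP (q + 1) (w T)) = -((ν - 1) / T * u T ^ 2) - T * (u T * phiP m (u T)) +
        -(u T * (α * w T + phiP (q + 1) (w T))) := by ring
    rw [k6]
    linarith
  have hTβ : 0 < T ^ (2 * β) := by positivity
  have hfac : (↑2 * u T ^ (2 - 1) * (-((ν - 1) / T * u T) - 1 * (T * phiP m (u T) + α * w T)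
      - phiP (q + 1) (w T))) * T ^ (2 * β) + u T ^ 2 * (2 * β * T ^ (2 * β - 1)) =
      2 * T ^ (2 * β) * (u T * (-((ν - 1) / T * u T) - 1 * (T * phiP m (u T) + α * w T)
      - phiP (q + 1) (w T)) + β * u T ^ 2 / T) := by
    rw [Real.rpow_sub_one hT0.ne' (2 * β)]
    ring
  have hlt : 2 * T ^ (2 * β) * (u T * (-((ν - 1) / T * u T) - 1 * (T * phiP m (u T) + α * w T)
      - phiP (q + 1) (w T)) + β * u T ^ 2 / T) < 0 :=
    mul_neg_of_pos_of_neg (by positivity) key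
  rw [← hfac] at hlt
  have : (0 : ℝ) ≤ (2 * u T ^ (2 - 1) * (-((ν - 1) / T * u T) - 1 * (T * phiP m (u T) + α * w T)
      - phiP (q + 1) (w T))) * T ^ (2 * β) + u T ^ 2 * (2 * β * T ^ (2 * β - 1)) := by
    simpa using hnn
  linarith

/-- Positivity of the limit of `r^α w` persists for nearby data at a suitable large radius. -/
lemma FluxSol.exists_forall_pos_of_tendsto {w₀ u₀ : ℝ → ℝ} (h : FluxSol ν m q α 1 w₀ u₀)
    (hν : 1 ≤ ν) (hm : 1 < m) (hq : 1 < q) (hα : 0 < α) {ℓ : ℝ} (hℓ : 0 < ℓ)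
    (hL : α < (α + 1) / (m - 1) + 1)
    (hlim : Tendsto (fun r => r ^ α * w₀ r) atTop (𝓝 ℓ)) :
    ∃ R > 0, ∃ ε > 0, ∀ w u : ℝ → ℝ, FluxSol ν m q α 1 w u → |w R - w₀ R| < ε →
      |u R - u₀ R| < ε → ∀ r ≥ R, 0 < w r := by
  have hm1 : 0 < m - 1 := by linarith
  obtain ⟨β, hβ⟩ : ∃ β, β = (α + 1) / (m - 1) := ⟨_, rfl⟩
  obtain ⟨η, hη⟩ : ∃ η, η = β + 1 - α := ⟨_, rfl⟩
  have hη0 : 0 < η := by rw [hη, hβ]; linarith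
  obtain ⟨σ, hσ⟩ : ∃ σ, σ = min η (α * (q - 1)) := ⟨_, rfl⟩
  have hσ0 : 0 < σ := by
    rw [hσ]; exact lt_min hη0 (mul_pos hα (by linarith))
  obtain ⟨K₁, hK₁⟩ : ∃ K₁, K₁ = 4 * ℓ * 2 ^ (α + 1) := ⟨_, rfl⟩
  have hK₁0 : 0 < K₁ := by rw [hK₁]; positivity
  obtain ⟨K, hK⟩ : ∃ K, K = (K₁ + (α + 1) * (3 * ℓ / 2) + 1) ^ (1 / (m - 1)) := ⟨_, rfl⟩
  have hK0 : 0 < K := by rw [hK]; positivity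
  have hKm : K ^ (m - 1) = K₁ + (α + 1) * (3 * ℓ / 2) + 1 := by
    rw [hK, ← Real.rpow_mul (by positivity), one_div_mul_cancel hm1.ne', Real.rpow_one]
  have htend : ∀ c s b : ℝ, 0 < s → 0 < b → ∀ᶠ r : ℝ in atTop, c * r ^ (-s) < b := by
    intro c s b hs hb
    have := (tendsto_rpow_neg_atTop hs).const_mul c
    rw [mul_zero] at this
    exact this.eventually_lt_const hb
  have hev : ∀ᶠ r : ℝ in atTop, 1 ≤ r ∧ K * r ^ (-η) < ℓ / 16 ∧
      (|α - ν| * K + (3 * ℓ / 2) ^ q) / σ * r ^ (-σ) < ℓ / 16 ∧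
      β * K * r ^ (-η) < 1 ∧ 3 * ℓ / 2 * r ^ (-α) < 1 ∧ |r ^ α * w₀ r - ℓ| < ℓ / 16 := by
    have hl : ∀ᶠ r : ℝ in atTop, |r ^ α * w₀ r - ℓ| < ℓ / 16 := by
      have := Metric.tendsto_nhds.1 hlim (ℓ / 16) (by positivity)
      simpa [Real.dist_eq] using this
    filter_upwards [eventually_ge_atTop 1, htend K η (ℓ / 16) hη0 (by positivity),
      htend ((|α - ν| * K + (3 * ℓ / 2) ^ q) / σ) σ (ℓ / 16) hσ0 (by positivity),
      htend (β * K) η 1 hη0 one_pos, htend (3 * ℓ / 2) α 1 hα one_pos, hl] with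
      r h1 h2 h3 h4 h5 h6
    exact ⟨h1, h2, h3, h4, h5, h6⟩
  obtain ⟨R₁, hR₁⟩ := eventually_atTop.1 hev
  have hR₁1 := (hR₁ R₁ le_rfl).1
  have hR₁0 : 0 < R₁ := by linarith
  obtain ⟨R, hRmem, hRd⟩ := exists_hasDerivAt_eq_slope w₀ (fun r => phiP m (u₀ r))
    (by linarith : R₁ < 2 * R₁)
    (fun r hr => (h.continuousAt_w (hR₁0.trans_le hr.1)).continuousWithinAt)
    (fun r hr => h.hw r (hR₁0.trans hr.1))
  have hR0 : 0 < R := hR₁0.trans hRmem.1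
  have hRev : ∀ r ≥ R, _ := fun r hr => hR₁ r (hRmem.1.le.trans hr)
  have hwb : ∀ r ≥ R₁, |w₀ r| ≤ 2 * ℓ * R₁ ^ (-α) := by
    intro r hr
    have hr0 : 0 < r := hR₁0.trans_le hr
    have e1 := (hR₁ r hr).2.2.2.2.2
    have e2 := abs_sub_abs_le_abs_sub (r ^ α * w₀ r) ℓ
    rw [abs_of_pos hℓ, abs_mul, abs_of_pos (by positivity : 0 < r ^ α)] at e2
    have e3 : |w₀ r| ≤ 2 * ℓ * r ^ (-α) := by
      rw [Real.rpow_neg hr0.le, ← div_eq_mul_inv, le_div_iff₀ (by positivity)]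
      linarith
    refine e3.trans (mul_le_mul_of_nonneg_left ?_ (by positivity))
    exact Real.rpow_le_rpow_of_nonpos hR₁0 hr (by linarith)
  have hψ : |phiP m (u₀ R)| ≤ K₁ * R ^ (-(α + 1)) := by
    rw [hRd, abs_div]
    have e1 := abs_sub (w₀ (2 * R₁)) (w₀ R₁)
    have e2 := hwb (2 * R₁) (by linarith)
    have e3 := hwb R₁ le_rfl
    have e4 : |2 * R₁ - R₁| = R₁ := by
      rw [abs_of_pos (by linarith)]; ring
    rw [e4, div_le_iff₀ hR₁0]
    have e5 : R₁ ^ (-α) = R₁ ^ (-(α + 1)) * R₁ := by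
      nth_rewrite 3 [← Real.rpow_one R₁]
      rw [← Real.rpow_add hR₁0]; ring_nf
    have e6 : R₁ ^ (-(α + 1)) ≤ 2 ^ (α + 1) * R ^ (-(α + 1)) := by
      have := Real.rpow_le_rpow_of_nonpos (by positivity : 0 < R / 2)
        (by linarith [hRmem.2] : R / 2 ≤ R₁) (by linarith : -(α + 1) ≤ 0)
      refine this.trans (le_of_eq ?_)
      rw [Real.div_rpow hR0.le (by norm_num), Real.rpow_neg (by norm_num : (0:ℝ) ≤ 2)]
      field_simp
    calc _ ≤ 4 * ℓ * R₁ ^ (-α) := by linarith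
      _ = 4 * ℓ * R₁ ^ (-(α + 1)) * R₁ := by rw [e5]; ring
      _ ≤ 4 * ℓ * (2 ^ (α + 1) * R ^ (-(α + 1))) * R₁ := by gcongr
      _ = _ := by rw [hK₁]; ring
  have hu₀ : |u₀ R| * R ^ β < K := by
    rw [abs_phiP hm] at hψ
    have e1 : |u₀ R| ^ (m - 1) < (K * R ^ (-β)) ^ (m - 1) := by
      have : (K * R ^ (-β)) ^ (m - 1) =
          (K₁ + (α + 1) * (3 * ℓ / 2) + 1) * R ^ (-(α + 1)) := by
        rw [Real.mul_rpow hK0.le (by positivity), hKm, ← Real.rpow_mul hR0.le, hβ]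
        congr 2
        field_simp
      rw [this]
      refine hψ.trans_lt (mul_lt_mul_of_pos_right ?_ (by positivity))
      have : 0 < (α + 1) * (3 * ℓ / 2) := by positivity
      linarith
    have e2 := (Real.rpow_lt_rpow_iff (abs_nonneg _) (by positivity) hm1).1 e1
    rwa [Real.rpow_neg hR0.le, ← div_eq_mul_inv, lt_div_iff₀ (by positivity)] at e2
  have hRα : 0 < R ^ α := by positivity
  have hRβ : 0 < R ^ β := by positivity
  refine ⟨R, hR0, min (ℓ / 16 / R ^ α) ((K - |u₀ R| * R ^ β) / R ^ β),
    lt_min (by positivity) (div_pos (by linarith) hRβ), ?_⟩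
  intro w u hwu hw hu r hr
  have hw1 := hw.trans_le (min_le_left _ _)
  have hu1 := hu.trans_le (min_le_right _ _)
  rw [lt_div_iff₀ (by positivity)] at hw1 hu1
  have a1 : |R ^ α * w R - ℓ| < ℓ / 8 := by
    have e1 := (hRev R le_rfl).2.2.2.2.2
    have e2 : |R ^ α * w R - ℓ| ≤ |w R - w₀ R| * R ^ α + |R ^ α * w₀ R - ℓ| := by
      have : |w R - w₀ R| * R ^ α = |R ^ α * w R - R ^ α * w₀ R| := by
        rw [← mul_sub, abs_mul, abs_of_pos hRα, mul_comm]
      rw [this]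
      exact abs_sub_le _ _ _
    linarith
  have a2 : |u R| * R ^ β < K := by
    have := abs_sub_abs_le_abs_sub (u R) (u₀ R)
    nlinarith
  have := hwu.abs_sub_lt_of_trap hν hm hq hα hℓ hK0 hβ hη hσ0 (hσ ▸ min_le_left _ _)
    (hσ ▸ min_le_right _ _) (by rw [hKm]; linarith) (hRev R le_rfl).1
    (fun s hs => (hRev s hs).2.1) (hRev R le_rfl).2.2.1 (fun s hs => (hRev s hs).2.2.2.1)
    (fun s hs => (hRev s hs).2.2.2.2.1.le) a1 a2 r hr
  have h1 : 0 < r ^ α * w r := by linarith [(abs_lt.1 this).1]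
  exact pos_of_mul_pos_right h1 (Real.rpow_nonneg (hR0.le.trans hr) _)

end Trapping

section Conversion

/-- The flux `|w'|^{p-2} w'` of a function on `[0,∞)`. -/
noncomputable def flux (p : ℝ) (w : ℝ → ℝ) (r : ℝ) : ℝ := phiP p (derivWithin w (Ici 0) r)

lemma IsGlobalSolution.fluxSol {N : ℕ} {p q α a : ℝ} {w : ℝ → ℝ} (hp : 1 < p)
    (h : IsGlobalSolution N p q α a w) :
    FluxSol (N : ℝ) (p / (p - 1)) q α 1 w (flux p w) := by
  obtain ⟨h1, h2, h3, -, -⟩ := h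
  have hdiff : ∀ {f : ℝ → ℝ}, ContDiffOn ℝ 1 f (Ici 0) → ∀ r > 0,
      HasDerivAt f (derivWithin f (Ici 0) r) r := fun hf r hr =>
    ((hf.differentiableOn one_ne_zero) r hr.le).hasDerivWithinAt.hasDerivAt (Ici_mem_nhds hr)
  refine ⟨fun r hr => ?_, fun r hr => ?_⟩
  · rw [flux, phiP_conj hp]
    exact hdiff h1 r hr
  · refine (hdiff h2 r hr).congr_deriv ?_
    have e := h3 r hr
    have e' : phiP (q + 1) (w r) = |w r| ^ (q - 1) * w r := by
      rw [phiP, show q + 1 - 2 = q - 1 by ring]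
    rw [flux, phiP_conj hp, e']
    change derivWithin (fun s => phiP p (derivWithin w (Ici 0) s)) (Ici 0) r = _
    linarith

lemma IsGlobalSolution.startsAt {N : ℕ} {p q α a : ℝ} {w : ℝ → ℝ}
    (h : IsGlobalSolution N p q α a w) : StartsAt a w (flux p w) := by
  obtain ⟨h1, h2, -, h4, h5⟩ := h
  have hle : 𝓝[>] (0 : ℝ) ≤ 𝓝[≥] 0 := nhdsWithin_mono _ Ioi_subset_Ici_self
  refine ⟨?_, ?_⟩
  · rw [← h4]
    exact (h1.continuousOn 0 self_mem_Ici).mono_left hle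
  · have : Tendsto (flux p w) (𝓝[≥] 0) (𝓝 (flux p w 0)) := h2.continuousOn 0 self_mem_Ici
    rw [flux, h5, phiP_zero] at this
    exact this.mono_left hle

lemma isIsolatedZeroOn_Ici_iff {w : ℝ → ℝ} {z : ℝ} (hz : 0 < z) :
    IsIsolatedZeroOn w (Ici 0) z ↔ w z = 0 ∧ ∀ᶠ s in 𝓝[≠] z, w s ≠ 0 := by
  have : 𝓝[Ici 0 \ {z}] z = 𝓝[≠] z := by
    rw [sdiff_eq, inter_comm]
    exact nhdsWithin_inter_of_mem' (mem_nhdsWithin_of_mem_nhds (Ici_mem_nhds hz))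
  rw [IsIsolatedZeroOn, this]
  exact ⟨fun h => h.2, fun h => ⟨hz.le, h⟩⟩

end Conversion

section Rescaling

variable {ν m q α a : ℝ} {w u : ℝ → ℝ}

lemma FluxSol.rescale (h : FluxSol ν m q α 1 w u) {c b : ℝ} (ha : 0 < a) (hc : 0 < c)
    (hb : 0 < b) (h1 : b ^ (m - 1) = c / a) (h2 : b * c * a ^ q = 1) :
    FluxSol ν m q α (b * c * a) (fun r => w (c * r) / a) (fun r => b * u (c * r)) := by
  have hlin : ∀ r : ℝ, HasDerivAt (fun r => c * r) c r := fun r => by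
    simpa using (hasDerivAt_id r).const_mul c
  refine ⟨fun r hr => ?_, fun r hr => ?_⟩
  · refine (((h.hw (c * r) (by positivity)).comp r (hlin r)).div_const a).congr_deriv ?_
    rw [phiP_mul hb, h1]
    ring
  · refine (((h.hu (c * r) (by positivity)).comp r (hlin r)).const_mul b).congr_deriv ?_
    have e : phiP (q + 1) (w (c * r)) = a ^ q * phiP (q + 1) (w (c * r) / a) := by
      have := phiP_mul (p := q + 1) ha (w (c * r) / a)
      rwa [mul_div_cancel₀ _ ha.ne', show q + 1 - 1 = q by ring] at this
    rw [phiP_mul hb, h1, e]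
    have e2 : b * (a ^ q * phiP (q + 1) (w (c * r) / a) * c) =
        phiP (q + 1) (w (c * r) / a) := by
      rw [show b * (a ^ q * phiP (q + 1) (w (c * r) / a) * c) =
        (b * c * a ^ q) * phiP (q + 1) (w (c * r) / a) by ring, h2, one_mul]
    rw [sub_mul, mul_sub, e2]
    field_simp

lemma StartsAt.rescale (h : StartsAt a w u) {c : ℝ} (b : ℝ) (ha : a ≠ 0) (hc : 0 < c) :
    StartsAt 1 (fun r => w (c * r) / a) (fun r => b * u (c * r)) := by
  have hlin : Tendsto (fun r => c * r) (𝓝[>] 0) (𝓝[>] 0) := by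
    refine tendsto_nhdsWithin_iff.2 ⟨?_, ?_⟩
    · have : Tendsto (fun r => c * r) (𝓝 0) (𝓝 (c * 0)) := tendsto_id.const_mul c
      rw [mul_zero] at this
      exact this.mono_left nhdsWithin_le_nhds
    · filter_upwards [self_mem_nhdsWithin] with r hr using mul_pos hc hr
  refine ⟨?_, ?_⟩
  · simpa [div_self ha] using (h.hw.comp hlin).div_const a
  · simpa using (h.hu.comp hlin).const_mul b

lemma FluxSol.exists_rescale (h : FluxSol ν m q α 1 w u) (h0 : StartsAt a w u) (hm : 1 < m)
    (ha : 0 < a) : ∃ c > 0, ∃ b > 0,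
      FluxSol ν m q α (a ^ (1 - q)) (fun r => w (c * r) / a) (fun r => b * u (c * r)) ∧
      StartsAt 1 (fun r => w (c * r) / a) (fun r => b * u (c * r)) := by
  have hm0 : m ≠ 0 := by linarith
  obtain ⟨c, hc⟩ : ∃ c, c = a ^ ((1 - q * (m - 1)) / m) := ⟨_, rfl⟩
  obtain ⟨b, hb⟩ : ∃ b, b = a ^ (-(q + 1) / m) := ⟨_, rfl⟩
  have hc0 : 0 < c := by rw [hc]; positivity
  have hb0 : 0 < b := by rw [hb]; positivity
  have hbc : b * c = a ^ (-q) := by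
    rw [hb, hc, ← Real.rpow_add ha]
    congr 1
    field_simp
    ring
  have h1 : b ^ (m - 1) = c / a := by
    rw [hb, hc, ← Real.rpow_mul ha.le, ← Real.rpow_sub_one ha.ne']
    congr 1
    field_simp
    ring
  have h2 : b * c * a ^ q = 1 := by
    rw [hbc, ← Real.rpow_add ha, neg_add_cancel, Real.rpow_zero]
  have h3 : b * c * a = a ^ (1 - q) := by
    rw [hbc, ← Real.rpow_add_one ha.ne']
    ring_nf
  exact ⟨c, hc0, b, hb0, h3 ▸ h.rescale ha hc0 hb0 h1 h2, h0.rescale b ha.ne' hc0⟩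

end Rescaling

section Compactness

/-- Limits of differentiable functions whose derivatives converge continuously. -/
lemma hasDerivAt_of_tendsto_prod_nhds {ι : Type*} {g : Filter ι} [NeBot g] {F F' : ι → ℝ → ℝ}
    {f f' : ℝ → ℝ} (hF : ∀ i, ∀ x > 0, HasDerivAt (F i) (F' i x) x)
    (hf : ∀ x > 0, Tendsto (fun i => F i x) g (𝓝 (f x)))
    (hF' : ∀ x > 0, Tendsto (fun y : ι × ℝ => F' y.1 y.2) (g ×ˢ 𝓝 x) (𝓝 (f' x)))
    {x : ℝ} (hx : 0 < x) : HasDerivAt f (f' x) x := by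
  have hpt : ∀ x > 0, Tendsto (fun i => F' i x) g (𝓝 (f' x)) := fun x hx =>
    (hF' x hx).comp (tendsto_id.prodMk (tendsto_const_nhds (x := x)))
  have hcont : ∀ x > 0, Tendsto f' (𝓝 x) (𝓝 (f' x)) := by
    intro x hx
    refine Metric.tendsto_nhds.2 fun ε hε => ?_
    obtain ⟨s, hs, t, ht, hst⟩ := eventually_prod_iff.1
      (Metric.tendsto_nhds.1 (hF' x hx) (ε / 2) (half_pos hε))
    filter_upwards [ht, Ioi_mem_nhds hx] with y hy hy0
    refine lt_of_le_of_lt ?_ (half_lt_self hε)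
    refine le_of_tendsto ((hpt y hy0).dist tendsto_const_nhds) ?_
    filter_upwards [hs] with i hi
    exact (hst hi hy).le
  refine hasDerivAt_of_tendstoLocallyUniformlyOn isOpen_Ioi ?_
    (Eventually.of_forall fun i => hF i) hf hx
  rw [tendstoLocallyUniformlyOn_iff_forall_tendsto]
  intro x hx
  have hx' : 0 < x := hx
  rw [isOpen_Ioi.nhdsWithin_eq hx]
  have := ((hcont x hx').comp (tendsto_snd (f := g))).prodMk_nhds (hF' x hx')
  exact this.mono_right (nhds_le_uniformity _)

lemma tendsto_prod_nhds_of_lipschitz {ι : Type*} {g : Filter ι} {F : ι → ℝ → ℝ}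
    {C x l : ℝ} {s : Set ℝ} (hs : s ∈ 𝓝 x) (hC : ∀ i, ∀ y ∈ s, |F i y - F i x| ≤ C * |y - x|)
    (hl : Tendsto (fun i => F i x) g (𝓝 l)) :
    Tendsto (fun y : ι × ℝ => F y.1 y.2) (g ×ˢ 𝓝 x) (𝓝 l) := by
  have h1 : Tendsto (fun y : ι × ℝ => F y.1 x) (g ×ˢ 𝓝 x) (𝓝 l) := hl.comp tendsto_fst
  have h2 : Tendsto (fun y : ι × ℝ => F y.1 y.2 - F y.1 x) (g ×ˢ 𝓝 x) (𝓝 0) := by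
    have h3 : Tendsto (fun y : ι × ℝ => C * |y.2 - x|) (g ×ˢ 𝓝 x) (𝓝 0) := by
      have : Tendsto (fun y : ℝ => C * |y - x|) (𝓝 x) (𝓝 (C * |x - x|)) :=
        ((continuous_id.sub continuous_const).abs.const_mul C).tendsto x
      rw [sub_self, abs_zero, mul_zero] at this
      exact this.comp tendsto_snd
    refine squeeze_zero_norm' ?_ h3
    filter_upwards [tendsto_snd.eventually hs] with y hy
    exact hC y.1 y.2 hy
  simpa using h1.add h2

variable {ν m q α : ℝ}

lemma FluxSol.exists_limit {ι : Type*} (g : Ultrafilter ι) {κ : ι → ℝ} {v U : ι → ℝ → ℝ}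
    (hν : 1 ≤ ν) (hm : 1 < m) (hq : 1 < q) (hα : 0 ≤ α)
    (hκ0 : ∀ i, 0 ≤ κ i) (hκ1 : ∀ i, κ i ≤ 1) (hκ : Tendsto κ g (𝓝 0))
    (h : ∀ i, FluxSol ν m q α (κ i) (v i) (U i)) (h0 : ∀ i, StartsAt 1 (v i) (U i)) :
    ∃ w u : ℝ → ℝ, FluxSol ν m q α 0 w u ∧ StartsAt 1 w u ∧
      ∀ r > 0, Tendsto (fun i => v i r) g (𝓝 (w r)) := by
  have hν0 : 0 < ν := by linarith
  have hm0 : 0 < m := by linarith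
  have hm1 : 0 < m - 1 := by linarith
  obtain ⟨M, hM⟩ : ∃ M, M = (m * energyZero q α 1 1) ^ (1 / m) := ⟨_, rfl⟩
  have hE0 := energyZero_nonneg (a := 1) (κ := 1) hα hq zero_le_one
  have hM0 : 0 ≤ M := by rw [hM]; positivity
  have hv : ∀ i, ∀ r > 0, |v i r| ≤ 1 := fun i r hr => by
    simpa using (h i).abs_w_le (h0 i) hν hm hq hα (hκ0 i) hr
  have hU : ∀ i, ∀ r > 0, |U i r| ≤ M := fun i r hr => by
    refine ((h i).abs_u_le (h0 i) hν hm hq hα (hκ0 i) hr).trans ?_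
    rw [hM]
    have e1 := energyZero_nonneg (a := 1) hα hq (hκ0 i)
    refine Real.rpow_le_rpow (by positivity) (mul_le_mul_of_nonneg_left ?_ hm0.le)
      (by positivity)
    unfold energyZero
    have : κ i * α ≤ 1 * α := mul_le_mul_of_nonneg_right (hκ1 i) hα
    linarith
  have hφU : ∀ i, ∀ r > 0, |phiP m (U i r)| ≤ M ^ (m - 1) := fun i r hr => by
    rw [abs_phiP hm]
    exact Real.rpow_le_rpow (abs_nonneg _) (hU i r hr) hm1.le
  have hφv : ∀ i, ∀ r > 0, |phiP (q + 1) (v i r)| ≤ 1 := fun i r hr => by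
    rw [abs_phiP (by linarith)]
    exact Real.rpow_le_one (abs_nonneg _) (hv i r hr) (by linarith)
  have hdrift : ∀ i, ∀ r > 0, |κ i * (r * phiP m (U i r) + α * v i r)| ≤
      r * M ^ (m - 1) + α := by
    intro i r hr
    rw [abs_mul, abs_of_nonneg (hκ0 i)]
    have e1 : |r * phiP m (U i r) + α * v i r| ≤ r * M ^ (m - 1) + α := by
      refine (abs_add_le _ _).trans ?_
      rw [abs_mul, abs_mul, abs_of_pos hr, abs_of_nonneg hα]
      have := mul_le_mul_of_nonneg_left (hφU i r hr) hr.le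
      have := mul_le_mul_of_nonneg_left (hv i r hr) hα
      linarith
    calc _ ≤ 1 * |r * phiP m (U i r) + α * v i r| :=
          mul_le_mul_of_nonneg_right (hκ1 i) (abs_nonneg _)
      _ ≤ _ := by rw [one_mul]; exact e1
  have hlimv : ∀ r, ∃ l, 0 < r → Tendsto (fun i => v i r) g (𝓝 l) := by
    intro r
    by_cases hr : 0 < r
    · obtain ⟨l, -, hl⟩ := isCompact_Icc.ultrafilter_le_nhds' (g.map fun i => v i r)
        (s := Icc (-1) 1) (Ultrafilter.mem_map.2 (univ_mem' fun i => abs_le.1 (hv i r hr)))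
      exact ⟨l, fun _ => hl⟩
    · exact ⟨0, fun hr' => absurd hr' hr⟩
  have hlimU : ∀ r, ∃ l, 0 < r → Tendsto (fun i => U i r) g (𝓝 l) := by
    intro r
    by_cases hr : 0 < r
    · obtain ⟨l, -, hl⟩ := isCompact_Icc.ultrafilter_le_nhds' (g.map fun i => U i r)
        (s := Icc (-M) M) (Ultrafilter.mem_map.2 (univ_mem' fun i => abs_le.1 (hU i r hr)))
      exact ⟨l, fun _ => hl⟩
    · exact ⟨0, fun hr' => absurd hr' hr⟩
  choose w hw using hlimv
  choose u hu using hlimU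
  have hjv : ∀ x > 0, Tendsto (fun y : ι × ℝ => v y.1 y.2) (↑g ×ˢ 𝓝 x) (𝓝 (w x)) := by
    intro x hx
    refine tendsto_prod_nhds_of_lipschitz (s := Ioi 0) (C := M ^ (m - 1)) (Ioi_mem_nhds hx)
      (fun i y hy => ?_) (hw x hx)
    exact Convex.norm_image_sub_le_of_norm_hasDerivWithin_le
      (fun z hz => ((h i).hw z hz).hasDerivWithinAt) (fun z hz => hφU i z hz)
      (convex_Ioi 0) hx hy
  have hjU : ∀ x > 0, Tendsto (fun y : ι × ℝ => U y.1 y.2) (↑g ×ˢ 𝓝 x) (𝓝 (u x)) := by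
    intro x hx
    refine tendsto_prod_nhds_of_lipschitz (s := Ioo (x / 2) (2 * x))
      (C := (ν - 1) / (x / 2) * M + (2 * x * M ^ (m - 1) + α) + 1)
      (Ioo_mem_nhds (by linarith) (by linarith)) (fun i y hy => ?_) (hu x hx)
    refine Convex.norm_image_sub_le_of_norm_hasDerivWithin_le
      (fun z hz => ((h i).hu z (by linarith [hz.1])).hasDerivWithinAt) (fun z hz => ?_)
      (convex_Ioo (x / 2) (2 * x)) ⟨by linarith, by linarith⟩ hy
    have hz0 : 0 < z := by linarith [hz.1]
    have e1 : |(ν - 1) / z * U i z| ≤ (ν - 1) / (x / 2) * M := by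
      rw [abs_mul, abs_of_nonneg (div_nonneg (by linarith) hz0.le)]
      refine mul_le_mul ?_ (hU i z hz0) (abs_nonneg _)
        (div_nonneg (by linarith) (by positivity))
      exact div_le_div_of_nonneg_left (by linarith) (by positivity) hz.1.le
    have e2 := hdrift i z hz0
    have e3 : z * M ^ (m - 1) ≤ 2 * x * M ^ (m - 1) :=
      mul_le_mul_of_nonneg_right hz.2.le (by positivity)
    have e4 := hφv i z hz0
    rw [Real.norm_eq_abs, abs_le]
    rw [abs_le] at e1 e2 e4
    constructor <;> linarith [e1.1, e1.2, e2.1, e2.2, e4.1, e4.2]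
  have hψ := continuous_phiP hm
  have hφ := continuous_phiP (p := q + 1) (by linarith)
  refine ⟨w, u, ⟨fun r hr => ?_, fun r hr => ?_⟩, ⟨?_, ?_⟩, hw⟩
  · exact hasDerivAt_of_tendsto_prod_nhds (fun i => (h i).hw) hw
      (fun x hx => (hψ.tendsto (u x)).comp (hjU x hx)) hr
  · refine hasDerivAt_of_tendsto_prod_nhds (fun i => (h i).hu) hu (f' := fun r =>
      -((ν - 1) / r * u r) - 0 * (r * phiP m (u r) + α * w r) - phiP (q + 1) (w r))
      (fun x hx => ?_) hr
    have hid : Tendsto (fun y : ι × ℝ => y.2) (↑g ×ˢ 𝓝 x) (𝓝 x) := tendsto_snd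
    have hκ' : Tendsto (fun y : ι × ℝ => κ y.1) (↑g ×ˢ 𝓝 x) (𝓝 0) := hκ.comp tendsto_fst
    have hψU := (hψ.tendsto (u x)).comp (hjU x hx)
    have hφV := (hφ.tendsto (w x)).comp (hjv x hx)
    exact (((tendsto_const_nhds.div hid hx.ne').mul (hjU x hx)).neg.sub
      (hκ'.mul ((hid.mul hψU).add ((hjv x hx).const_mul α)))).sub hφV
  · have hlow : ∀ r ∈ Ioi (0 : ℝ), 1 - M ^ (m - 1) * r ≤ w r := fun r hr =>
      ge_of_tendsto' (hw r hr) fun i => (h i).le_w (h0 i) (R := r)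
        (fun s hs => hφU i s hs.1) (right_mem_Ioc.2 hr)
    have hup : ∀ r ∈ Ioi (0 : ℝ), w r ≤ 1 := fun r hr =>
      le_of_tendsto' (hw r hr) fun i => (abs_le.1 (hv i r hr)).2
    refine tendsto_of_tendsto_of_tendsto_of_le_of_le' ?_ tendsto_const_nhds
      (eventually_nhdsWithin_of_forall hlow) (eventually_nhdsWithin_of_forall hup)
    have : Tendsto (fun r : ℝ => 1 - M ^ (m - 1) * r) (𝓝 0) (𝓝 (1 - M ^ (m - 1) * 0)) :=
      tendsto_const_nhds.sub (tendsto_id.const_mul _)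
    rw [mul_zero, sub_zero] at this
    exact this.mono_left nhdsWithin_le_nhds
  · obtain ⟨c, hc⟩ : ∃ c, c = M ^ (m - 1) + α + 1 := ⟨_, rfl⟩
    have hb : ∀ i, ∀ s ∈ Ioc (0 : ℝ) 1,
        |κ i * (s * phiP m (U i s) + α * v i s) + phiP (q + 1) (v i s)| ≤ c := by
      intro i s hs
      refine (abs_add_le _ _).trans ?_
      have e1 := hdrift i s hs.1
      have e2 := hφv i s hs.1
      have e3 : s * M ^ (m - 1) ≤ 1 * M ^ (m - 1) :=
        mul_le_mul_of_nonneg_right hs.2 (by positivity)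
      linarith
    have hUb : ∀ r ∈ Ioc (0 : ℝ) 1, |u r| ≤ c / ν * r := fun r hr => by
      refine le_of_tendsto' (hu r hr.1).abs fun i => abs_le.2 ⟨?_, ?_⟩
      · exact (h i).le_u_of_le (h0 i) hν (fun s hs => (abs_le.1 (hb i s hs)).2) hr
      · have := (h i).u_le_of_le (h0 i) hν (fun s hs => (abs_le.1 (hb i s hs)).1) hr
        rwa [neg_div, neg_mul, neg_neg] at this
    have hlin : Tendsto (fun r : ℝ => c / ν * r) (𝓝[>] 0) (𝓝 0) := by
      have : Tendsto (fun r : ℝ => c / ν * r) (𝓝 0) (𝓝 (c / ν * 0)) := tendsto_id.const_mul _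
      rw [mul_zero] at this
      exact this.mono_left nhdsWithin_le_nhds
    refine squeeze_zero_norm' ?_ hlin
    filter_upwards [Ioc_mem_nhdsGT one_pos] with r hr using hUb r hr

end Compactness

section Oscillation

variable {ν m q α : ℝ} {w u : ℝ → ℝ}

/-- The Pohozaev functional of the limiting equation. -/
noncomputable def pohozaev (ν m q : ℝ) (w u : ℝ → ℝ) (r : ℝ) : ℝ :=
  r ^ ν * (|u r| ^ m / m + |w r| ^ (q + 1) / (q + 1)) +
    ν / (q + 1) * (r ^ (ν - 1) * u r * w r)

lemma FluxSol.hasDerivAt_pohozaev (h : FluxSol ν m q α 0 w u) (hm : 1 < m) (hq : 1 < q)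
    {r : ℝ} (hr : 0 < r) :
    HasDerivAt (pohozaev ν m q w u)
      ((1 - ν + ν / m + ν / (q + 1)) * (r ^ (ν - 1) * |u r| ^ m)) r := by
  have h1 := (hasDerivAt_abs_rpow_div hm (u r)).comp r (h.hu r hr)
  have h3 := (hasDerivAt_abs_rpow_div (by linarith : 1 < q + 1) (w r)).comp r (h.hw r hr)
  have h4 := (Real.hasDerivAt_rpow_const (p := ν) (Or.inl hr.ne')).mul (h1.add h3)
  have h5 := ((h.hasDerivAt_weighted hr).mul (h.hw r hr)).const_mul (ν / (q + 1))
  refine (h4.add h5).congr_deriv ?_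
  have e1 : r ^ ν = r ^ (ν - 1) * r := by
    rw [Real.rpow_sub_one hr.ne']; field_simp
  simp only [Pi.add_apply, Function.comp_apply]
  rw [← mul_phiP hm, ← mul_phiP (p := q + 1) (by linarith), e1]
  have hq1 : q + 1 ≠ 0 := by linarith
  have hm0 : m ≠ 0 := by linarith
  field_simp
  ring

lemma FluxSol.pohozaev_monotoneOn (h : FluxSol ν m q α 0 w u) (hm : 1 < m) (hq : 1 < q)
    (hμ : 0 < 1 - ν + ν / m + ν / (q + 1)) : MonotoneOn (pohozaev ν m q w u) (Ioi 0) :=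
  monotoneOn_of_hasDerivAt_nonneg (convex_Ioi 0) (fun _ hr => h.hasDerivAt_pohozaev hm hq hr)
    fun r hr => by
      have : 0 < r := hr
      positivity

lemma StartsAt.tendsto_pohozaev (h0 : StartsAt 1 w u) (hν : 1 ≤ ν) (hm : 1 < m) (hq : 1 < q) :
    Tendsto (pohozaev ν m q w u) (𝓝[>] 0) (𝓝 0) := by
  have h1 : Tendsto (fun r => |u r| ^ m / m) (𝓝[>] 0) (𝓝 (|0| ^ m / m)) :=
    (h0.hu.abs.rpow_const (Or.inr (by linarith))).div_const m
  have h3 : Tendsto (fun r => |w r| ^ (q + 1) / (q + 1)) (𝓝[>] 0)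
      (𝓝 (|1| ^ (q + 1) / (q + 1))) :=
    (h0.hw.abs.rpow_const (Or.inr (by linarith))).div_const (q + 1)
  have h4 := ((tendsto_rpow_zero_right (by linarith : 0 < ν)).mul (h1.add h3)).add
    (((h0.tendsto_weighted hν).mul h0.hw).const_mul (ν / (q + 1)))
  rw [abs_zero, Real.zero_rpow (by linarith), zero_mul, zero_mul, mul_zero, add_zero] at h4
  exact h4

lemma eq_zero_of_phiP_eq_zero {p x : ℝ} (h : phiP p x = 0) : x = 0 := by
  rcases lt_trichotomy x 0 with hx | hx | hx
  · exact absurd h (phiP_neg_of_neg hx).ne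
  · exact hx
  · exact absurd h (phiP_pos hx).ne'

lemma FluxSol.pohozaev_pos (h : FluxSol ν m q α 0 w u) (h0 : StartsAt 1 w u) (hν : 1 ≤ ν)
    (hm : 1 < m) (hq : 1 < q) (hμ : 0 < 1 - ν + ν / m + ν / (q + 1)) {r : ℝ} (hr : 0 < r) :
    0 < pohozaev ν m q w u r := by
  have hmono := h.pohozaev_monotoneOn hm hq hμ
  have hnn : ∀ s > 0, 0 ≤ pohozaev ν m q w u s := fun s hs => by
    refine le_of_tendsto (h0.tendsto_pohozaev hν hm hq) ?_
    filter_upwards [Ioo_mem_nhdsGT hs] with t ht using hmono ht.1 hs ht.2.le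
  refine lt_of_le_of_ne (hnn r hr) fun heq => ?_
  have hzero : ∀ s ∈ Ioo 0 r, pohozaev ν m q w u s = 0 := fun s hs =>
    le_antisymm (heq ▸ hmono hs.1 hr hs.2.le) (hnn s hs.1)
  have hu : ∀ s ∈ Ioo 0 r, u s = 0 := by
    intro s hs
    have h1 : HasDerivAt (pohozaev ν m q w u) 0 s := by
      refine (hasDerivAt_const s (0 : ℝ)).congr_of_eventuallyEq ?_
      filter_upwards [isOpen_Ioo.mem_nhds hs] with t ht using hzero t ht
    have h2 := h1.unique (h.hasDerivAt_pohozaev hm hq hs.1)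
    have h3 : 0 < s ^ (ν - 1) := Real.rpow_pos_of_pos hs.1 _
    have h4 : |u s| ^ m = 0 := by
      rcases mul_eq_zero.1 h2.symm with h5 | h5
      · exact absurd h5 hμ.ne'
      · exact (mul_eq_zero.1 h5).resolve_left h3.ne'
    exact abs_eq_zero.1 ((Real.rpow_eq_zero (abs_nonneg _) (by linarith)).1 h4)
  have hw : ∀ s ∈ Ioo 0 r, w s = 0 := by
    intro s hs
    have h1 : HasDerivAt u 0 s := by
      refine (hasDerivAt_const s (0 : ℝ)).congr_of_eventuallyEq ?_
      filter_upwards [isOpen_Ioo.mem_nhds hs] with t ht using hu t ht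
    have h2 := h1.unique (h.hu s hs.1)
    rw [hu s hs] at h2
    exact eq_zero_of_phiP_eq_zero (p := q + 1) (by linarith)
  have : Tendsto w (𝓝[>] 0) (𝓝 0) := by
    refine tendsto_const_nhds.congr' ?_
    filter_upwards [Ioo_mem_nhdsGT hr] with s hs using (hw s hs).symm
  exact zero_ne_one (tendsto_nhds_unique this h0.hw)

/-- An eventually nonnegative solution with positive Pohozaev functional is eventually positive
and strictly decreasing. -/
lemma FluxSol.exists_pos_neg_of_nonneg (h : FluxSol ν m q α 0 w u) (hν : 1 ≤ ν) (hm : 1 < m)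
    (hq : 1 < q) (hH : ∀ r > 0, 0 < pohozaev ν m q w u r) {R : ℝ} (hR : 0 < R)
    (hw : ∀ r ≥ R, 0 ≤ w r) : ∃ R₁ > 0, ∀ r ≥ R₁, 0 < w r ∧ u r < 0 := by
  have hν0 : 0 < ν := by linarith
  have hpos : ∀ r > R, 0 < w r := by
    intro r hr
    refine lt_of_le_of_ne (hw r hr.le) fun heq => ?_
    have hr0 : 0 < r := hR.trans hr
    have hmin : IsLocalMin w r := by
      filter_upwards [Ioi_mem_nhds hr] with s hs
      rw [← heq]; exact hw s (le_of_lt hs)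
    have hu := eq_zero_of_phiP_eq_zero (hmin.hasDerivAt_eq_zero (h.hw r hr0))
    have := hH r hr0
    rw [pohozaev, hu, ← heq, abs_zero, Real.zero_rpow (by linarith),
      Real.zero_rpow (by linarith)] at this
    simp at this
  have hyanti : AntitoneOn (fun r => r ^ (ν - 1) * u r) (Ioi R) := by
    refine antitoneOn_of_hasDerivAt_nonpos (convex_Ioi R)
      (fun r hr => h.hasDerivAt_weighted (hR.trans hr)) fun r hr => ?_
    have h1 : 0 < r := hR.trans hr
    have h2 := phiP_pos (p := q + 1) (hpos r hr)
    rw [zero_mul, zero_add, neg_nonpos]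
    positivity
  by_cases hneg : ∃ r₁ > R, u r₁ < 0
  · obtain ⟨r₁, hr₁, hu₁⟩ := hneg
    have hr₁0 : 0 < r₁ := hR.trans hr₁
    refine ⟨r₁, hr₁0, fun r hr => ⟨hpos r (hr₁.trans_le hr), ?_⟩⟩
    have h1 := hyanti hr₁ (hr₁.trans_le hr) hr
    beta_reduce at h1
    have h2 : r₁ ^ (ν - 1) * u r₁ < 0 := mul_neg_of_pos_of_neg (by positivity) hu₁
    exact neg_of_mul_neg_right (h1.trans_lt h2) (Real.rpow_nonneg (hr₁0.le.trans hr) _)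
  · exfalso
    push Not at hneg
    obtain ⟨S, hS⟩ : ∃ S, S = R + 1 := ⟨_, rfl⟩
    have hSR : S ∈ Ioi R := by rw [hS]; exact lt_add_one R
    have hS0 : 0 < S := hR.trans hSR
    have hwmono : MonotoneOn w (Ioi R) :=
      monotoneOn_of_hasDerivAt_nonneg (convex_Ioi R) (fun r hr => h.hw r (hR.trans hr))
        fun r hr => phiP_nonneg (hneg r hr)
    obtain ⟨c, hc⟩ : ∃ c, c = phiP (q + 1) (w S) := ⟨_, rfl⟩
    have hc0 : 0 < c := hc ▸ phiP_pos (hpos S hSR)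
    have hIci : ∀ r ∈ Ici S, r ∈ Ioi R := fun r hr => lt_of_lt_of_le (mem_Ioi.1 hSR) hr
    have hanti : AntitoneOn (fun r => r ^ (ν - 1) * u r + c / ν * r ^ ν) (Ici S) := by
      refine antitoneOn_of_hasDerivAt_nonpos (convex_Ici S) (fun r hr =>
        (h.hasDerivAt_weighted (hR.trans (hIci r hr))).add
          ((Real.hasDerivAt_rpow_const (p := ν)
            (Or.inl (hR.trans (hIci r hr)).ne')).const_mul (c / ν))) fun r hr => ?_
      have h1 : 0 < r := hR.trans (hIci r hr)
      have h2 : c ≤ phiP (q + 1) (w r) :=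
        hc ▸ monotone_phiP (by linarith) (hwmono hSR (hIci r hr) hr)
      have h3 := mul_le_mul_of_nonneg_left h2 (Real.rpow_nonneg h1.le (ν - 1))
      have h4 : c / ν * (ν * r ^ (ν - 1)) = r ^ (ν - 1) * c := by field_simp
      rw [h4]; linarith
    have htop : Tendsto (fun r : ℝ => c / ν * r ^ ν) atTop atTop :=
      (tendsto_rpow_atTop hν0).const_mul_atTop (by positivity)
    obtain ⟨r, hr1, hr2⟩ := ((htop.eventually_gt_atTop
      (S ^ (ν - 1) * u S + c / ν * S ^ ν)).and (eventually_ge_atTop S)).exists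
    have h1 := hanti self_mem_Ici hr2 hr2
    have h2 : 0 ≤ r ^ (ν - 1) * u r :=
      mul_nonneg (Real.rpow_nonneg (hS0.le.trans hr2) _) (hneg r (hIci r hr2))
    beta_reduce at h1
    linarith

lemma FluxSol.mul_rpow_le_neg_u (h : FluxSol ν m q α 0 w u) (hν : 1 ≤ ν)
    (hq : 1 < q) {R : ℝ} (hR : 0 < R) (hwu : ∀ r ≥ R, 0 < w r ∧ u r < 0) {r : ℝ}
    (hr : 2 * R ≤ r) : w r ^ q * r ≤ 2 * ν * -u r := by
  have hν0 : 0 < ν := by linarith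
  have hr0 : 0 < r := by linarith
  have hIcc : ∀ s ∈ Icc (r / 2) r, R ≤ s := fun s hs => by linarith [hs.1]
  have hwanti : AntitoneOn w (Ici R) :=
    antitoneOn_of_hasDerivAt_nonpos (convex_Ici R) (fun s hs => h.hw s (hR.trans_le hs))
      fun s hs => (phiP_neg_of_neg (hwu s hs).2).le
  obtain ⟨c, hc⟩ : ∃ c, c = phiP (q + 1) (w r) := ⟨_, rfl⟩
  have hcq : c = w r ^ q := by
    rw [hc, phiP_of_pos (hwu r (by linarith)).1, show q + 1 - 1 = q by ring]
  have hc0 : 0 < c := hc ▸ phiP_pos (hwu r (by linarith)).1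
  have hanti : AntitoneOn (fun r => r ^ (ν - 1) * u r + c / ν * r ^ ν) (Icc (r / 2) r) := by
    refine antitoneOn_of_hasDerivAt_nonpos (convex_Icc _ _) (fun s hs =>
      (h.hasDerivAt_weighted (hR.trans_le (hIcc s hs))).add
        ((Real.hasDerivAt_rpow_const (p := ν)
          (Or.inl (hR.trans_le (hIcc s hs)).ne')).const_mul (c / ν))) fun s hs => ?_
    have h1 : 0 < s := hR.trans_le (hIcc s hs)
    have h2 : c ≤ phiP (q + 1) (w s) :=
      hc ▸ monotone_phiP (by linarith)
        (hwanti (hIcc s hs) (mem_Ici.2 (by linarith)) hs.2)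
    have h3 := mul_le_mul_of_nonneg_left h2 (Real.rpow_nonneg h1.le (ν - 1))
    have h4 : c / ν * (ν * s ^ (ν - 1)) = s ^ (ν - 1) * c := by field_simp
    rw [h4]; linarith
  have h1 := hanti (left_mem_Icc.2 (by linarith)) (right_mem_Icc.2 (by linarith))
    (by linarith : r / 2 ≤ r)
  beta_reduce at h1
  have h2 : (r / 2) ^ (ν - 1) * u (r / 2) ≤ 0 :=
    mul_nonpos_of_nonneg_of_nonpos (by positivity) (hwu (r / 2) (by linarith)).2.le
  have h3 : (r / 2) ^ ν ≤ r ^ ν / 2 := by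
    rw [Real.div_rpow hr0.le (by norm_num)]
    refine div_le_div_of_nonneg_left (by positivity) (by norm_num) ?_
    nth_rewrite 1 [← Real.rpow_one 2]
    exact Real.rpow_le_rpow_of_exponent_le (by norm_num) hν
  have h4 := mul_le_mul_of_nonneg_left h3 (by positivity : 0 ≤ c / ν)
  have h5 : r ^ ν = r ^ (ν - 1) * r := by
    rw [Real.rpow_sub_one hr0.ne']; field_simp
  have h6 : r ^ (ν - 1) * (u r + c / ν * r / 2) ≤ 0 := by
    rw [h5] at h1 h4; linarith
  have h7 : u r + c / ν * r / 2 ≤ 0 :=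
    nonpos_of_mul_nonpos_right h6 (by positivity)
  rw [← hcq]
  have h8 : c * r = 2 * ν * (c / ν * r / 2) := by field_simp
  rw [h8]
  exact mul_le_mul_of_nonneg_left (by linarith) (by positivity)

lemma FluxSol.neg_u_rpow_le (h : FluxSol ν m q α 0 w u) (hν : 1 ≤ ν) (hm : 1 < m)
    {R : ℝ} (hR : 0 < R) (hwu : ∀ r ≥ R, 0 < w r ∧ u r < 0) {r : ℝ}
    (hr : R ≤ r) : r * (-u r) ^ (m - 1) ≤ (2 ^ (ν - 1)) ^ (m - 1) * w r := by
  have hr0 : 0 < r := hR.trans_le hr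
  have hIcc : ∀ s ∈ Icc r (2 * r), R ≤ s := fun s hs => hr.trans hs.1
  have hyanti : AntitoneOn (fun r => r ^ (ν - 1) * u r) (Ici R) := by
    refine antitoneOn_of_hasDerivAt_nonpos (convex_Ici R)
      (fun r hr => h.hasDerivAt_weighted (hR.trans_le hr)) fun r hr => ?_
    have h1 : 0 < r := hR.trans_le hr
    have h2 := phiP_pos (p := q + 1) (hwu r hr).1
    rw [zero_mul, zero_add, neg_nonpos]
    positivity
  obtain ⟨c, hc⟩ : ∃ c, c = (-u r / 2 ^ (ν - 1)) ^ (m - 1) := ⟨_, rfl⟩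
  have hu0 : 0 < -u r := by linarith [(hwu r hr).2]
  have hanti : AntitoneOn (fun s => w s + c * s) (Icc r (2 * r)) := by
    refine antitoneOn_of_hasDerivAt_nonpos (convex_Icc _ _) (fun s hs =>
      (h.hw s (hR.trans_le (hIcc s hs))).add ((hasDerivAt_id s).const_mul c)) fun s hs => ?_
    have hs0 : 0 < s := hR.trans_le (hIcc s hs)
    have h1 := hyanti (mem_Ici.2 hr) (mem_Ici.2 (hIcc s hs)) hs.1
    beta_reduce at h1
    have h2 : s ^ (ν - 1) ≤ r ^ (ν - 1) * 2 ^ (ν - 1) := by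
      rw [← Real.mul_rpow hr0.le (by norm_num)]
      exact Real.rpow_le_rpow hs0.le (by linarith [hs.2]) (by linarith)
    have h3 : r ^ (ν - 1) * -u r ≤ r ^ (ν - 1) * (2 ^ (ν - 1) * -u s) := by
      have := mul_le_mul_of_nonneg_right h2 (by linarith [(hwu s (hIcc s hs)).2] : 0 ≤ -u s)
      linarith
    have h4 := le_of_mul_le_mul_left h3 (by positivity)
    have h5 : -u r / 2 ^ (ν - 1) ≤ -u s := by
      rw [div_le_iff₀ (by positivity)]; linarith
    have h6 : c ≤ (-u s) ^ (m - 1) :=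
      hc ▸ Real.rpow_le_rpow (by positivity) h5 (by linarith)
    have h7 : phiP m (u s) = -(-u s) ^ (m - 1) := by
      rw [← phiP_of_pos (by linarith [(hwu s (hIcc s hs)).2] : 0 < -u s), phiP_neg, neg_neg]
    rw [h7]; linarith
  have h1 := hanti (left_mem_Icc.2 (by linarith)) (right_mem_Icc.2 (by linarith))
    (by linarith : r ≤ 2 * r)
  beta_reduce at h1
  have h2 := (hwu (2 * r) (by linarith)).1
  have h3 : c * r ≤ w r := by linarith
  rw [hc, Real.div_rpow hu0.le (by positivity), div_mul_eq_mul_div, div_le_iff₀ (by positivity)]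
    at h3
  linarith

/-- The algebraic obstruction behind the oscillation of the limiting equation. -/
lemma not_subcritical_decay {k R V C₁ C₃ h₀ : ℝ} {X : ℝ → ℝ} (hk : 0 < k)
    (hμ : ν * (q - k) < (1 + k) * (q + 1)) (hC₁ : 0 < C₁) (hC₃ : 0 < C₃) (hh₀ : 0 < h₀)
    (hX : ∀ r ≥ R, 0 < X r) (hV : ∀ r ≥ R, X r ≤ V)
    (h₁ : ∀ r ≥ R, X r ^ q * r ^ (1 + k) ≤ C₁ * X r ^ k)
    (h₃ : ∀ r ≥ R, h₀ ≤ C₃ * (r ^ (ν - 1 - k) * X r ^ (1 + k))) : False := by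
  have hdiv : ∀ r ≥ R, X r ^ (q - k) * r ^ (1 + k) ≤ C₁ := by
    intro r hr
    have h0 := hX r hr
    have h2 : 0 < X r ^ k := by positivity
    rw [Real.rpow_sub h0, div_mul_eq_mul_div, div_le_iff₀ h2]
    exact h₁ r hr
  rcases le_or_gt q k with hqk | hqk
  · have htop : Tendsto (fun r : ℝ => r ^ (1 + k)) atTop atTop :=
      tendsto_rpow_atTop (by linarith)
    obtain ⟨r, ⟨hr1, hr2⟩, hr3⟩ := ((htop.eventually_gt_atTop (C₁ * V ^ (k - q))).and
      (eventually_ge_atTop R)).and (eventually_gt_atTop 0) |>.exists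
    have h0 := hX r hr2
    have h2 := hdiv r hr2
    rw [← neg_sub, Real.rpow_neg h0.le, inv_mul_le_iff₀ (by positivity)] at h2
    have h4 : X r ^ (k - q) ≤ V ^ (k - q) :=
      Real.rpow_le_rpow h0.le (hV r hr2) (by linarith)
    have h5 := mul_le_mul_of_nonneg_right h4 hC₁.le
    linarith
  · have hqk' : 0 < q - k := by linarith
    obtain ⟨s, hs⟩ : ∃ s, s = (1 + k) / (q - k) := ⟨_, rfl⟩
    have hs0 : 0 < s := by rw [hs]; exact div_pos (by linarith) hqk'
    have hexp : 0 < -(ν - 1 - k - (1 + k) * s) := by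
      have : (1 + k) * s = (1 + k) * (1 + k) / (q - k) := by rw [hs]; ring
      rw [this, neg_sub, sub_pos, lt_div_iff₀ hqk']
      linarith
    have hlim : Tendsto (fun r : ℝ => C₃ * C₁ ^ s * r ^ (-(-(ν - 1 - k - (1 + k) * s))))
        atTop (𝓝 0) := by
      simpa using (tendsto_rpow_neg_atTop hexp).const_mul (C₃ * C₁ ^ s)
    obtain ⟨r, ⟨hr1, hr2⟩, hr3⟩ := ((hlim.eventually_lt_const hh₀).and
      (eventually_ge_atTop R)).and (eventually_gt_atTop 0) |>.exists
    have h0 := hX r hr2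
    have h2 := hdiv r hr2
    have h4 : X r ^ (1 + k) ≤ C₁ ^ s * r ^ (-((1 + k) * s)) := by
      have e1 : X r ^ (q - k) ≤ C₁ * r ^ (-(1 + k)) := by
        rw [Real.rpow_neg hr3.le, ← div_eq_mul_inv, le_div_iff₀ (by positivity)]
        exact h2
      have e2 := Real.rpow_le_rpow (by positivity) e1 hs0.le
      rw [← Real.rpow_mul h0.le, Real.mul_rpow hC₁.le (by positivity), ← Real.rpow_mul hr3.le,
        hs, mul_div_cancel₀ _ hqk'.ne', ← hs, neg_mul] at e2
      exact e2
    have h5 : r ^ (ν - 1 - k) * X r ^ (1 + k) ≤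
        C₁ ^ s * r ^ (-(-(ν - 1 - k - (1 + k) * s))) := by
      calc _ ≤ r ^ (ν - 1 - k) * (C₁ ^ s * r ^ (-((1 + k) * s))) :=
            mul_le_mul_of_nonneg_left h4 (by positivity)
        _ = C₁ ^ s * (r ^ (ν - 1 - k) * r ^ (-((1 + k) * s))) := by ring
        _ = _ := by
            rw [← Real.rpow_add hr3, neg_neg]
            rfl
    have h6 := mul_le_mul_of_nonneg_left h5 hC₃.le
    have h7 := h₃ r hr2
    linarith

lemma FluxSol.exists_neg_of_pohozaev_pos (h : FluxSol ν m q α 0 w u) (hν : 1 ≤ ν) (hm : 1 < m)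
    (hq : 1 < q) (hμ : 0 < 1 - ν + ν / m + ν / (q + 1))
    (hH : ∀ r > 0, 0 < pohozaev ν m q w u r) (R : ℝ) : ∃ r > R, w r < 0 := by
  by_contra! hcon
  obtain ⟨R₁, hR₁, hwu⟩ := h.exists_pos_neg_of_nonneg hν hm hq hH (R := max R 0 + 1)
    (by positivity) fun r hr => hcon r (by linarith [le_max_left R 0])
  have hν0 : 0 < ν := by linarith
  have hm1 : 0 < m - 1 := by linarith
  have hm0 : 0 < m := by linarith
  have hq1 : 0 < q + 1 := by linarith
  obtain ⟨k, hk⟩ : ∃ k, k = 1 / (m - 1) := ⟨_, rfl⟩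
  have hk0 : 0 < k := by rw [hk]; positivity
  have hmk : (m - 1) * k = 1 := by rw [hk]; field_simp
  obtain ⟨C, hC⟩ : ∃ C : ℝ, C = (2 ^ (ν - 1)) ^ (m - 1) := ⟨_, rfl⟩
  have hC0 : 0 < C := by rw [hC]; positivity
  have hwanti : AntitoneOn w (Ici R₁) :=
    antitoneOn_of_hasDerivAt_nonpos (convex_Ici R₁) (fun s hs => h.hw s (hR₁.trans_le hs))
      fun s hs => (phiP_neg_of_neg (hwu s hs).2).le
  have hD : ∀ r ≥ 2 * R₁, -u r ≤ C ^ k * (w r ^ k * r ^ (-k)) := by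
    intro r hr
    have hr0 : 0 < r := by linarith
    have hu0 := (hwu r (by linarith)).2
    have hw0 := (hwu r (by linarith)).1
    have h1 := h.neg_u_rpow_le hν hm hR₁ hwu (by linarith : R₁ ≤ r)
    rw [← hC, mul_comm, ← le_div_iff₀ hr0] at h1
    have h2 := Real.rpow_le_rpow (Real.rpow_nonneg (by linarith) _) h1 hk0.le
    rw [← Real.rpow_mul (by linarith), hmk, Real.rpow_one, Real.div_rpow (by positivity) hr0.le,
      Real.mul_rpow hC0.le hw0.le, mul_div_assoc] at h2
    rwa [Real.rpow_neg hr0.le, ← div_eq_mul_inv]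
  obtain ⟨C₂, hC₂⟩ : ∃ C₂ : ℝ, C₂ = C / m + 2 * ν / (q + 1) := ⟨_, rfl⟩
  have hC₂0 : 0 < C₂ := by rw [hC₂]; positivity
  refine not_subcritical_decay (k := k) (R := 2 * R₁) (V := w R₁) (C₁ := 2 * ν * C ^ k)
    (C₃ := C₂ * C ^ k) (h₀ := pohozaev ν m q w u (2 * R₁)) (X := w) (q := q) (ν := ν) hk0 ?_
    (by positivity) (by positivity) (hH _ (by positivity)) (fun r hr => (hwu r (by linarith)).1)
    (fun r hr => hwanti self_mem_Ici (mem_Ici.2 (by linarith)) (by linarith)) ?_ ?_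
  · have e1 : m = (1 + k) / k := by
      rw [eq_div_iff hk0.ne']; linarith
    have e2 : ν / m = ν * k / (1 + k) := by rw [e1]; field_simp
    rw [e2] at hμ
    have e3 : 0 < (1 - ν + ν * k / (1 + k) + ν / (q + 1)) * ((1 + k) * (q + 1)) := by
      positivity
    have e4 : (1 - ν + ν * k / (1 + k) + ν / (q + 1)) * ((1 + k) * (q + 1)) =
        (1 + k) * (q + 1) - ν * (q - k) := by field_simp; ring
    linarith
  · intro r hr
    have hr0 : 0 < r := by linarith
    have h1 := h.mul_rpow_le_neg_u hν hq hR₁ hwu hr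
    have h2 := mul_le_mul_of_nonneg_left (hD r hr) (by positivity : 0 ≤ 2 * ν)
    have h3 := mul_le_mul_of_nonneg_right (h1.trans h2) (by positivity : 0 ≤ r ^ k)
    have e1 : w r ^ q * r ^ (1 + k) = w r ^ q * r * r ^ k := by
      rw [Real.rpow_add hr0, Real.rpow_one]; ring
    have e2 : r ^ (-k) * r ^ k = 1 := by
      rw [← Real.rpow_add hr0, neg_add_cancel, Real.rpow_zero]
    rw [e1]
    refine h3.trans (le_of_eq ?_)
    rw [show 2 * ν * (C ^ k * (w r ^ k * r ^ (-k))) * r ^ k =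
      2 * ν * C ^ k * w r ^ k * (r ^ (-k) * r ^ k) by ring, e2, mul_one]
  · intro r hr
    have hr0 : 0 < r := by linarith
    have hw0 := (hwu r (by linarith)).1
    have hu0 : 0 < -u r := by linarith [(hwu r (by linarith)).2]
    have h1 := h.mul_rpow_le_neg_u hν hq hR₁ hwu hr
    have h2 := h.neg_u_rpow_le hν hm hR₁ hwu (by linarith : R₁ ≤ r)
    rw [← hC] at h2
    have h3 : pohozaev ν m q w u (2 * R₁) ≤ pohozaev ν m q w u r :=
      h.pohozaev_monotoneOn hm hq hμ (mem_Ioi.2 (by positivity)) hr0 hr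
    have e0 : r ^ ν = r ^ (ν - 1) * r := by
      rw [Real.rpow_sub_one hr0.ne']; field_simp
    have e1 : |u r| ^ m = -u r * (-u r) ^ (m - 1) := by
      rw [← abs_neg, abs_of_pos hu0, Real.rpow_sub_one hu0.ne',
        mul_div_cancel₀ _ hu0.ne']
    have e2 : |w r| ^ (q + 1) = w r * w r ^ q := by
      rw [abs_of_pos hw0, Real.rpow_add_one hw0.ne']; ring
    have h4 : pohozaev ν m q w u r ≤ C₂ * (r ^ (ν - 1) * -u r * w r) := by
      have t1 : r ^ (ν - 1) * (-u r) / m * (r * (-u r) ^ (m - 1)) ≤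
          r ^ (ν - 1) * (-u r) / m * (C * w r) :=
        mul_le_mul_of_nonneg_left h2 (by positivity)
      have t2 : r ^ (ν - 1) * w r / (q + 1) * (w r ^ q * r) ≤
          r ^ (ν - 1) * w r / (q + 1) * (2 * ν * -u r) :=
        mul_le_mul_of_nonneg_left h1 (by positivity)
      have t3 : 0 ≤ ν / (q + 1) * (r ^ (ν - 1) * -u r * w r) := by positivity
      have t4 : pohozaev ν m q w u r = r ^ (ν - 1) * (-u r) / m * (r * (-u r) ^ (m - 1)) +
          r ^ (ν - 1) * w r / (q + 1) * (w r ^ q * r) -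
          ν / (q + 1) * (r ^ (ν - 1) * -u r * w r) := by
        rw [pohozaev, e0, e1, e2]; ring
      have t5 : C₂ * (r ^ (ν - 1) * -u r * w r) = r ^ (ν - 1) * (-u r) / m * (C * w r) +
          r ^ (ν - 1) * w r / (q + 1) * (2 * ν * -u r) := by
        rw [hC₂]; ring
      linarith
    refine h3.trans (h4.trans ?_)
    have h5 : r ^ (ν - 1) * -u r * w r ≤ r ^ (ν - 1) * (C ^ k * (w r ^ k * r ^ (-k))) * w r :=
      mul_le_mul_of_nonneg_right (mul_le_mul_of_nonneg_left (hD r hr) (by positivity)) hw0.le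
    refine (mul_le_mul_of_nonneg_left h5 hC₂0.le).trans (le_of_eq ?_)
    have e3 : w r ^ (1 + k) = w r * w r ^ k := by rw [Real.rpow_add hw0, Real.rpow_one]
    have e4 : r ^ (ν - 1 - k) = r ^ (ν - 1) * r ^ (-k) := by
      rw [← Real.rpow_add hr0]; rfl
    rw [e3, e4]; ring

lemma pohozaev_neg : pohozaev ν m q (fun r => -w r) (fun r => -u r) = pohozaev ν m q w u := by
  funext r
  simp [pohozaev]

lemma FluxSol.exists_alternating (h : FluxSol ν m q α 0 w u) (h0 : StartsAt 1 w u) (hν : 1 ≤ ν)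
    (hm : 1 < m) (hq : 1 < q) (hμ : 0 < 1 - ν + ν / m + ν / (q + 1)) :
    ∃ s : ℕ → ℝ, StrictMono s ∧ 0 < s 0 ∧ ∀ i, 0 < (-1) ^ i * w (s i) := by
  have hH : ∀ r > 0, 0 < pohozaev ν m q w u r := fun r hr => h.pohozaev_pos h0 hν hm hq hμ hr
  have hex : ∀ (i : ℕ) (R : ℝ), ∃ r > R, 0 < (-1) ^ i * w r := by
    intro i R
    rcases neg_one_pow_eq_or ℝ i with hi | hi
    · obtain ⟨r, hr, hwr⟩ := h.neg.exists_neg_of_pohozaev_pos hν hm hq hμ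
        (by rwa [pohozaev_neg]) R
      exact ⟨r, hr, by rw [hi]; linarith⟩
    · obtain ⟨r, hr, hwr⟩ := h.exists_neg_of_pohozaev_pos hν hm hq hμ hH R
      exact ⟨r, hr, by rw [hi]; linarith⟩
  choose f hf1 hf2 using hex
  let s : ℕ → ℝ := fun i => Nat.rec (f 0 0) (fun j x => f (j + 1) x) i
  refine ⟨s, strictMono_nat_of_lt_succ fun i => hf1 (i + 1) (s i), hf1 0 0, fun i => ?_⟩
  cases i with
  | zero => exact hf2 0 0
  | succ j => exact hf2 (j + 1) (s j)

/-- For large initial data, solutions oscillate as many times as desired. -/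
lemma FluxSol.eventually_alternating {W U : ℝ → ℝ → ℝ} (hν : 1 ≤ ν) (hm : 1 < m) (hq : 1 < q)
    (hα : 0 ≤ α) (hμ : 0 < 1 - ν + ν / m + ν / (q + 1))
    (h : ∀ a, FluxSol ν m q α 1 (W a) (U a)) (h0 : ∀ a, StartsAt a (W a) (U a)) (n : ℕ) :
    ∀ᶠ a in atTop, ∃ s : ℕ → ℝ, StrictMono s ∧ 0 < s 0 ∧
      ∀ i ≤ n, 0 < (-1) ^ i * W a (s i) := by
  refine mem_iff_ultrafilter.2 fun g hg => ?_
  have hres : ∀ a : ℝ, ∃ c > 0, ∃ b > 0, 1 ≤ a →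
      FluxSol ν m q α (a ^ (1 - q)) (fun r => W a (c * r) / a) (fun r => b * U a (c * r)) ∧
      StartsAt 1 (fun r => W a (c * r) / a) (fun r => b * U a (c * r)) := by
    intro a
    by_cases ha : 1 ≤ a
    · obtain ⟨c, hc, b, hb, h1⟩ := (h a).exists_rescale (h0 a) hm (by linarith)
      exact ⟨c, hc, b, hb, fun _ => h1⟩
    · exact ⟨1, one_pos, 1, one_pos, fun h1 => absurd h1 ha⟩
  choose c hc b _ hcb using hres
  have hmax : ∀ a : ℝ, 1 ≤ max a 1 := fun a => le_max_right a 1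
  have hκ : Tendsto (fun a : ℝ => (max a 1) ^ (1 - q)) g (𝓝 0) := by
    have h1 : Tendsto (fun a : ℝ => max a 1) g atTop :=
      (tendsto_atTop_mono (fun a => le_max_left a 1) tendsto_id).mono_left hg
    have h2 := (tendsto_rpow_neg_atTop (by linarith : 0 < q - 1)).comp h1
    rwa [neg_sub] at h2
  obtain ⟨w, u, hwu, hst, hlim⟩ := FluxSol.exists_limit g (κ := fun a : ℝ => (max a 1) ^ (1 - q))
    (v := fun a r => W (max a 1) (c (max a 1) * r) / max a 1)
    (U := fun a r => b (max a 1) * U (max a 1) (c (max a 1) * r)) hν hm hq hα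
    (fun a => Real.rpow_nonneg (by linarith [hmax a]) _)
    (fun a => Real.rpow_le_one_of_one_le_of_nonpos (hmax a) (by linarith)) hκ
    (fun a => (hcb _ (hmax a)).1) (fun a => (hcb _ (hmax a)).2)
  obtain ⟨s, hs, hs0, hsw⟩ := hwu.exists_alternating hst hν hm hq hμ
  have hspos : ∀ i, 0 < s i := fun i => hs0.trans_le (hs.monotone (Nat.zero_le i))
  have hev : ∀ᶠ a in (g : Filter ℝ), ∀ i ∈ Finset.range (n + 1),
      0 < (-1) ^ i * (W (max a 1) (c (max a 1) * s i) / max a 1) := by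
    refine (Finset.eventually_all _).2 fun i _ => ?_
    exact ((hlim (s i) (hspos i)).const_mul ((-1) ^ i)).eventually_const_lt (hsw i)
  filter_upwards [hev, hg (eventually_ge_atTop 1)] with a ha ha1
  rw [max_eq_left ha1] at ha
  refine ⟨fun i => c a * s i, fun i j hij => mul_lt_mul_of_pos_left (hs hij) (hc a),
    mul_pos (hc a) hs0, fun i hi => ?_⟩
  have h1 := ha i (Finset.mem_range.2 (by lia))
  rw [← mul_div_assoc] at h1
  have ha0 : 0 < a := lt_of_lt_of_le one_pos ha1
  exact (div_pos_iff_of_pos_right ha0).1 h1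

end Oscillation

section SimpleZeros

variable {ν m q α : ℝ} {w u : ℝ → ℝ}

/-- The positive zeros of a function. -/
def posZeros (w : ℝ → ℝ) : Set ℝ := {r | 0 < r ∧ w r = 0}

/-- All positive zeros of `w` are simple, in terms of the flux `u`. -/
def SimpleZeros (w u : ℝ → ℝ) : Prop := ∀ r > 0, w r = 0 → u r ≠ 0

/-- `w` changes sign across `n` successive intervals of `(0,∞)`. -/
def HasSignChanges (w : ℝ → ℝ) (n : ℕ) : Prop :=
  ∃ l r : Fin n → ℝ, (∀ i, 0 < l i ∧ l i < r i ∧ w (l i) * w (r i) < 0) ∧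
    ∀ i j, i < j → r i ≤ l j

lemma HasDerivAt.eventually_mul_neg {f : ℝ → ℝ} {f' x : ℝ} (h : HasDerivAt f f' x) (hx : f x = 0)
    (hf' : f' ≠ 0) : ∀ᶠ t in 𝓝[>] 0, f (x - t) * f (x + t) < 0 := by
  have hneg : Tendsto (fun t : ℝ => -t) (𝓝[>] 0) (𝓝[<] 0) := by
    refine tendsto_nhdsWithin_iff.2 ⟨?_, ?_⟩
    · have : Tendsto (fun t : ℝ => -t) (𝓝 0) (𝓝 (-0)) := tendsto_id.neg
      rw [neg_zero] at this
      exact this.mono_left nhdsWithin_le_nhds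
    · filter_upwards [self_mem_nhdsWithin] with t ht using neg_neg_of_pos (mem_Ioi.1 ht)
  have h1 := (h.tendsto_slope_zero_left.comp hneg).mul h.tendsto_slope_zero_right
  have h2 : 0 < f' * f' := mul_self_pos.2 hf'
  filter_upwards [h1.eventually_const_lt h2, self_mem_nhdsWithin] with t ht ht0
  have ht0' : 0 < t := ht0
  simp only [Function.comp_apply, smul_eq_mul, hx, sub_zero, ← sub_eq_add_neg] at ht
  have e : (-t)⁻¹ * f (x - t) * (t⁻¹ * f (x + t)) = -(f (x - t) * f (x + t)) / t ^ 2 := by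
    field_simp
  rw [e, lt_div_iff₀ (by positivity), zero_mul] at ht
  linarith

lemma phiP_ne_zero {p x : ℝ} (hx : x ≠ 0) : phiP p x ≠ 0 := fun h =>
  hx (eq_zero_of_phiP_eq_zero h)

lemma FluxSol.hasSignChanges_of_simple (h : FluxSol ν m q α 1 w u) {n : ℕ} {z : Fin n → ℝ}
    (hz : StrictMono z) (hz0 : ∀ i, 0 < z i) (hw : ∀ i, w (z i) = 0) (hu : ∀ i, u (z i) ≠ 0) :
    HasSignChanges w n := by
  have hlim : ∀ c : ℝ, Tendsto (fun t : ℝ => c - t) (𝓝[>] 0) (𝓝 c) := fun c => by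
    have : Tendsto (fun t : ℝ => c - t) (𝓝 0) (𝓝 (c - 0)) := tendsto_const_nhds.sub tendsto_id
    rw [sub_zero] at this
    exact this.mono_left nhdsWithin_le_nhds
  have e1 : ∀ᶠ t in 𝓝[>] (0 : ℝ), ∀ i, w (z i - t) * w (z i + t) < 0 :=
    eventually_all.2 fun i =>
      (h.hw (z i) (hz0 i)).eventually_mul_neg (hw i) (phiP_ne_zero (hu i))
  have e2 : ∀ᶠ t in 𝓝[>] (0 : ℝ), ∀ i, 0 < z i - t :=
    eventually_all.2 fun i => (hlim (z i)).eventually_const_lt (hz0 i)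
  have e3 : ∀ᶠ t in 𝓝[>] (0 : ℝ), ∀ i j, i < j → z i + t ≤ z j - t := by
    refine eventually_all.2 fun i => eventually_all.2 fun j => ?_
    by_cases hij : i < j
    · have h1 := hz hij
      filter_upwards [(hlim ((z j - z i) / 2)).eventually_const_lt (by linarith :
        0 < (z j - z i) / 2)] with t ht _
      linarith
    · exact Eventually.of_forall fun t ht => absurd ht hij
  obtain ⟨t, ⟨⟨h1, h2⟩, h3⟩, ht⟩ := (((e1.and e2).and e3).and self_mem_nhdsWithin).exists
  have ht0 : 0 < t := ht
  exact ⟨fun i => z i - t, fun i => z i + t, fun i => ⟨h2 i, by linarith, h1 i⟩, h3⟩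

lemma FluxSol.exists_simple_of_hasSignChanges (h : FluxSol ν m q α 1 w u) (hν : 1 ≤ ν)
    (hm : 1 < m) (hq : 1 < q) (hα : 0 ≤ α) {n : ℕ} (hs : HasSignChanges w n) :
    ∃ z : Fin n → ℝ, StrictMono z ∧ ∀ i, 0 < z i ∧ w (z i) = 0 ∧ u (z i) ≠ 0 := by
  obtain ⟨l, r, hlr, hrl⟩ := hs
  have hex : ∀ i, ∃ z ∈ Icc (l i) (r i), w z = 0 := by
    intro i
    obtain ⟨h1, h2, h3⟩ := hlr i
    have hc : ContinuousOn w (uIcc (l i) (r i)) := by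
      rw [uIcc_of_le h2.le]
      exact fun s hs => (h.continuousAt_w (h1.trans_le hs.1)).continuousWithinAt
    have hmem : (0 : ℝ) ∈ uIcc (w (l i)) (w (r i)) := by
      rcases mul_neg_iff.1 h3 with h4 | h4
      · exact mem_uIcc_of_ge h4.2.le h4.1.le
      · exact mem_uIcc_of_le h4.1.le h4.2.le
    obtain ⟨z, hz, hz0⟩ := intermediate_value_uIcc hc hmem
    rw [uIcc_of_le h2.le] at hz
    exact ⟨z, hz, hz0⟩
  choose z hz hz0 using hex
  have hpos : ∀ i, 0 < z i := fun i => (hlr i).1.trans_le (hz i).1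
  have hne : ∀ i, z i ≠ r i := fun i hi => by
    have := (hlr i).2.2
    rw [← hi, hz0, mul_zero] at this
    exact lt_irrefl 0 this
  refine ⟨z, fun i j hij => ?_, fun i => ⟨hpos i, hz0 i, fun hui => ?_⟩⟩
  · exact ((lt_of_le_of_ne (hz i).2 (hne i)).trans_le (hrl i j hij)).trans_le (hz j).1
  · have h1 := h.eq_zero_of_eq_zero hν hm hq hα zero_le_one (hpos i) (hz0 i) hui (hz i).2
    have := (hlr i).2.2
    rw [h1, mul_zero] at this
    exact lt_irrefl 0 this

lemma FluxSol.hasAtLeastIsolatedZeros_iff (h : FluxSol ν m q α 1 w u) (hν : 1 ≤ ν)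
    (hm : 1 < m) (hq : 1 < q) (hα : 0 ≤ α) {n : ℕ} :
    HasAtLeastIsolatedZeros w n ↔ HasSignChanges w n := by
  constructor
  · rintro ⟨z, hz, hiso⟩
    have hiso' := fun i => (isIsolatedZeroOn_Ici_iff (hiso i).1).1 (hiso i).2
    refine h.hasSignChanges_of_simple hz (fun i => (hiso i).1) (fun i => (hiso' i).1)
      fun i hui => ?_
    have h1 : ∀ᶠ s in 𝓝[>] (z i), w s ≠ 0 :=
      (hiso' i).2.filter_mono (nhdsWithin_mono _ fun s hs => ne_of_gt hs)
    obtain ⟨s, hs1, hs2⟩ := (h1.and self_mem_nhdsWithin).exists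
    exact hs1 (h.eq_zero_of_eq_zero hν hm hq hα zero_le_one (hiso i).1 (hiso' i).1 hui
      (le_of_lt hs2))
  · intro hs
    obtain ⟨z, hz, hz'⟩ := h.exists_simple_of_hasSignChanges hν hm hq hα hs
    refine ⟨z, hz, fun i => ⟨(hz' i).1, (isIsolatedZeroOn_Ici_iff (hz' i).1).2
      ⟨(hz' i).2.1, ?_⟩⟩⟩
    exact (h.hw (z i) (hz' i).1).eventually_ne (phiP_ne_zero (hz' i).2.2)

lemma FluxSol.le_encard_of_hasSignChanges (h : FluxSol ν m q α 1 w u) (hν : 1 ≤ ν)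
    (hm : 1 < m) (hq : 1 < q) (hα : 0 ≤ α) {n : ℕ} (hs : HasSignChanges w n) :
    (n : ℕ∞) ≤ (posZeros w).encard := by
  obtain ⟨z, hz, hz'⟩ := h.exists_simple_of_hasSignChanges hν hm hq hα hs
  have h1 : range z ⊆ posZeros w := by
    rintro _ ⟨i, rfl⟩
    exact ⟨(hz' i).1, (hz' i).2.1⟩
  have h2 : (range z).encard = n := by
    rw [← image_univ, hz.injective.encard_image, encard_univ]
    simp
  exact h2 ▸ encard_le_encard h1

lemma FluxSol.hasSignChanges_of_le_encard (h : FluxSol ν m q α 1 w u) (hsim : SimpleZeros w u)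
    {n : ℕ} (hn : (n : ℕ∞) ≤ (posZeros w).encard) : HasSignChanges w n := by
  obtain ⟨t, ht, htn⟩ := exists_subset_encard_eq hn
  have htf : t.Finite := finite_of_encard_eq_coe htn
  have hcard : htf.toFinset.card = n := by
    rw [htf.encard_eq_coe_toFinset_card] at htn
    exact_mod_cast htn
  have hmem : ∀ i, htf.toFinset.orderEmbOfFin hcard i ∈ posZeros w := fun i =>
    ht (htf.mem_toFinset.1 (Finset.orderEmbOfFin_mem _ hcard i))
  exact h.hasSignChanges_of_simple (htf.toFinset.orderEmbOfFin hcard).strictMono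
    (fun i => (hmem i).1) (fun i => (hmem i).2) fun i => hsim _ (hmem i).1 (hmem i).2

lemma hasSignChanges_of_alternating {n : ℕ} {s : ℕ → ℝ} (hs : StrictMono s) (hs0 : 0 < s 0)
    (hw : ∀ i ≤ n, 0 < (-1) ^ i * w (s i)) : HasSignChanges w n := by
  refine ⟨fun i => s i, fun i => s (i + 1), fun i => ⟨?_, hs (Nat.lt_succ_self _), ?_⟩,
    fun i j hij => hs.monotone (Nat.succ_le_of_lt hij)⟩
  · exact hs0.trans_le (hs.monotone (Nat.zero_le _))
  · have h1 := mul_pos (hw i i.2.le) (hw (i + 1) i.2)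
    have e : (-1) ^ (i : ℕ) * w (s i) * ((-1) ^ ((i : ℕ) + 1) * w (s (i + 1))) =
        -((-1) ^ (i : ℕ) * (-1) ^ (i : ℕ) * (w (s i) * w (s (i + 1)))) := by ring
    rw [e, ← mul_pow, neg_one_mul, neg_neg, one_pow, one_mul] at h1
    linarith

end SimpleZeros

section Continuity

variable {ν m q α : ℝ} {W U : ℝ → ℝ → ℝ} {a₀ : ℝ}

lemma FluxSol.exists_abs_sub_le (hν : 1 ≤ ν) (hm : 1 < m) (hq : 1 < q) (hα : 0 < α)
    (h : ∀ a, FluxSol ν m q α 1 (W a) (U a)) (h0 : ∀ a, StartsAt a (W a) (U a)) (ha₀ : 0 < a₀)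
    (R : ℝ) : ∃ C, ∀ᶠ a in 𝓝 a₀, ∀ r ∈ Ioc 0 R, |W a r - W a₀ r| ≤ C * |a - a₀| ∧
      |U a r - U a₀ r| ≤ C * |a - a₀| := by
  obtain ⟨C, hC, hdist⟩ := FluxSol.exists_dist_sq_le hν hm hq hα ha₀ R
  refine ⟨Real.sqrt C, ?_⟩
  filter_upwards [Icc_mem_nhds (by linarith : a₀ / 2 < a₀) (by linarith : a₀ < 2 * a₀)]
    with a ha r hr
  have h1 := hdist a ha a₀ ⟨by linarith, by linarith⟩ _ _ _ _ (h a) (h0 a) (h a₀) (h0 a₀) r hr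
  have h2 : Real.sqrt C * |a - a₀| = Real.sqrt (C * (a - a₀) ^ 2) := by
    rw [Real.sqrt_mul hC.le, Real.sqrt_sq_eq_abs]
  rw [h2]
  constructor <;> refine Real.abs_le_sqrt ?_
  · linarith [sq_nonneg (U a r - U a₀ r)]
  · linarith [sq_nonneg (W a r - W a₀ r)]

lemma tendsto_prod_of_abs_sub_le {F : ℝ → ℝ → ℝ} {C R l : ℝ} {f : Filter ℝ}
    (hf : ∀ᶠ r in f, r ∈ Ioc 0 R)
    (hF : ∀ᶠ a in 𝓝 a₀, ∀ r ∈ Ioc 0 R, |F a r - F a₀ r| ≤ C * |a - a₀|)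
    (hx : Tendsto (F a₀) f (𝓝 l)) :
    Tendsto (fun y : ℝ × ℝ => F y.1 y.2) (𝓝 a₀ ×ˢ f) (𝓝 l) := by
  have h1 : Tendsto (fun y : ℝ × ℝ => F y.1 y.2 - F a₀ y.2) (𝓝 a₀ ×ˢ f) (𝓝 0) := by
    have h2 : Tendsto (fun y : ℝ × ℝ => C * |y.1 - a₀|) (𝓝 a₀ ×ˢ f) (𝓝 0) := by
      have : Tendsto (fun a : ℝ => C * |a - a₀|) (𝓝 a₀) (𝓝 (C * |a₀ - a₀|)) :=
        ((continuous_id.sub continuous_const).abs.const_mul C).tendsto a₀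
      rw [sub_self, abs_zero, mul_zero] at this
      exact this.comp tendsto_fst
    refine squeeze_zero_norm' ?_ h2
    filter_upwards [hF.prod_mk hf] with y hy using hy.1 y.2 hy.2
  simpa using h1.add (hx.comp tendsto_snd)

lemma FluxSol.tendsto_prod (hν : 1 ≤ ν) (hm : 1 < m) (hq : 1 < q) (hα : 0 < α)
    (h : ∀ a, FluxSol ν m q α 1 (W a) (U a)) (h0 : ∀ a, StartsAt a (W a) (U a)) (ha₀ : 0 < a₀)
    {x : ℝ} (hx : 0 < x) :
    Tendsto (fun y : ℝ × ℝ => W y.1 y.2) (𝓝 a₀ ×ˢ 𝓝 x) (𝓝 (W a₀ x)) ∧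
      Tendsto (fun y : ℝ × ℝ => U y.1 y.2) (𝓝 a₀ ×ˢ 𝓝 x) (𝓝 (U a₀ x)) := by
  obtain ⟨C, hC⟩ := FluxSol.exists_abs_sub_le hν hm hq hα h h0 ha₀ (2 * x)
  have hf : ∀ᶠ r in 𝓝 x, r ∈ Ioc 0 (2 * x) := Ioc_mem_nhds hx (by linarith)
  exact ⟨tendsto_prod_of_abs_sub_le hf (hC.mono fun a ha r hr => (ha r hr).1)
      ((h a₀).continuousAt_w hx),
    tendsto_prod_of_abs_sub_le hf (hC.mono fun a ha r hr => (ha r hr).2)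
      ((h a₀).continuousAt_u hx)⟩

lemma FluxSol.tendsto_param (hν : 1 ≤ ν) (hm : 1 < m) (hq : 1 < q) (hα : 0 < α)
    (h : ∀ a, FluxSol ν m q α 1 (W a) (U a)) (h0 : ∀ a, StartsAt a (W a) (U a)) (ha₀ : 0 < a₀)
    {x : ℝ} (hx : 0 < x) :
    Tendsto (fun a => W a x) (𝓝 a₀) (𝓝 (W a₀ x)) ∧
      Tendsto (fun a => U a x) (𝓝 a₀) (𝓝 (U a₀ x)) := by
  obtain ⟨h1, h2⟩ := FluxSol.tendsto_prod hν hm hq hα h h0 ha₀ hx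
  have h3 : Tendsto (fun a : ℝ => (a, x)) (𝓝 a₀) (𝓝 a₀ ×ˢ 𝓝 x) :=
    tendsto_id.prodMk tendsto_const_nhds
  exact ⟨h1.comp h3, h2.comp h3⟩

lemma FluxSol.eventually_hasSignChanges (hν : 1 ≤ ν) (hm : 1 < m) (hq : 1 < q) (hα : 0 < α)
    (h : ∀ a, FluxSol ν m q α 1 (W a) (U a)) (h0 : ∀ a, StartsAt a (W a) (U a)) (ha₀ : 0 < a₀)
    {n : ℕ} (hs : HasSignChanges (W a₀) n) : ∀ᶠ a in 𝓝 a₀, HasSignChanges (W a) n := by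
  obtain ⟨l, r, hlr, hrl⟩ := hs
  have hev : ∀ᶠ a in 𝓝 a₀, ∀ i, W a (l i) * W a (r i) < 0 := by
    refine eventually_all.2 fun i => ?_
    obtain ⟨h1, h2, h3⟩ := hlr i
    exact ((FluxSol.tendsto_param hν hm hq hα h h0 ha₀ h1).1.mul
      (FluxSol.tendsto_param hν hm hq hα h h0 ha₀ (h1.trans h2)).1).eventually_lt_const h3
  filter_upwards [hev] with a ha
  exact ⟨l, r, fun i => ⟨(hlr i).1, (hlr i).2.1, ha i⟩, hrl⟩

lemma FluxSol.exists_nhds_zeros (hν : 1 ≤ ν) (hm : 1 < m) (hq : 1 < q) (hα : 0 < α)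
    (h : ∀ a, FluxSol ν m q α 1 (W a) (U a)) (h0 : ∀ a, StartsAt a (W a) (U a)) (ha₀ : 0 < a₀)
    (hsim : SimpleZeros (W a₀) (U a₀)) {x : ℝ} (hx : 0 ≤ x) :
    ∃ O ∈ 𝓝 x, ∀ᶠ a in 𝓝 a₀, ∀ y ∈ O, 0 < y → W a y = 0 →
      (0 < x ∧ W a₀ x = 0) ∧ ∀ y' ∈ O, 0 < y' → W a y' = 0 → y' = y := by
  rcases hx.eq_or_lt with rfl | hx0
  · obtain ⟨C, hC⟩ := FluxSol.exists_abs_sub_le hν hm hq hα h h0 ha₀ 1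
    have h1 := tendsto_prod_of_abs_sub_le (F := W) (Ioc_mem_nhdsGT one_pos)
      (hC.mono fun a ha r hr => (ha r hr).1) (h0 a₀).hw
    obtain ⟨s, hs, t, ht, hst⟩ := eventually_prod_iff.1 (h1.eventually_ne ha₀.ne')
    obtain ⟨O, hO, hOt⟩ := mem_nhdsWithin_iff_exists_mem_nhds_inter.1 ht
    refine ⟨O, hO, ?_⟩
    filter_upwards [hs] with a ha y hy hy0 hya
    exact absurd hya (hst ha (hOt ⟨hy, hy0⟩))
  · obtain ⟨h1, h2⟩ := FluxSol.tendsto_prod hν hm hq hα h h0 ha₀ hx0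
    by_cases hw : W a₀ x = 0
    · obtain ⟨s, hs, t, ht, hst⟩ := eventually_prod_iff.1 (h2.eventually_ne (hsim x hx0 hw))
      obtain ⟨ε, hε, hball⟩ := Metric.mem_nhds_iff.1 (inter_mem ht (Ioi_mem_nhds hx0))
      refine ⟨Metric.ball x ε, Metric.ball_mem_nhds x hε, ?_⟩
      filter_upwards [hs] with a ha y hy hy0 hya
      have key : ∀ y₁ ∈ Metric.ball x ε, ∀ y₂ ∈ Metric.ball x ε, W a y₁ = 0 → W a y₂ = 0 →
          ¬ y₁ < y₂ := by
        intro y₁ hy₁ y₂ hy₂ e₁ e₂ hlt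
        have hsub : Icc y₁ y₂ ⊆ Metric.ball x ε := by
          rw [Real.ball_eq_Ioo] at *
          exact Icc_subset_Ioo hy₁.1 hy₂.2
        obtain ⟨ξ, hξ, hξ0⟩ := exists_hasDerivAt_eq_zero (f := W a)
          (f' := fun r => phiP m (U a r)) hlt
          (fun r hr => ((h a).continuousAt_w (hball (hsub hr)).2).continuousWithinAt)
          (e₁.trans e₂.symm) fun r hr => (h a).hw r (hball (hsub (Ioo_subset_Icc_self hr))).2
        exact hst ha (hball (hsub (Ioo_subset_Icc_self hξ))).1 (eq_zero_of_phiP_eq_zero hξ0)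
      refine ⟨⟨hx0, hw⟩, fun y' hy' _ hya' => ?_⟩
      exact le_antisymm (not_lt.1 (key y hy y' hy' hya hya'))
        (not_lt.1 (key y' hy' y hy hya' hya))
    · obtain ⟨s, hs, t, ht, hst⟩ := eventually_prod_iff.1 (h1.eventually_ne hw)
      refine ⟨{y | t y}, ht, ?_⟩
      filter_upwards [hs] with a ha y hy _ hya
      exact absurd hya (hst ha hy)

/-- On bounded intervals, the number of zeros is finite and upper semicontinuous. -/
lemma FluxSol.eventually_encard_le (hν : 1 ≤ ν) (hm : 1 < m) (hq : 1 < q) (hα : 0 < α)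
    (h : ∀ a, FluxSol ν m q α 1 (W a) (U a)) (h0 : ∀ a, StartsAt a (W a) (U a)) (ha₀ : 0 < a₀)
    (hsim : SimpleZeros (W a₀) (U a₀)) (R : ℝ) :
    (posZeros (W a₀) ∩ Iic R).Finite ∧ ∀ᶠ a in 𝓝 a₀,
      (posZeros (W a) ∩ Iic R).encard ≤ (posZeros (W a₀) ∩ Iic R).encard := by
  have hex := fun (x : ℝ) (hx : 0 ≤ x) =>
    FluxSol.exists_nhds_zeros hν hm hq hα h h0 ha₀ hsim hx
  choose! O hO hev using hex
  obtain ⟨t, ht, hcov⟩ := (isCompact_Icc (a := (0 : ℝ)) (b := R)).elim_nhds_subcover O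
    fun x hx => hO x hx.1
  have hall : ∀ᶠ a in 𝓝 a₀, ∃ c : ℝ → ℝ, InjOn c (posZeros (W a) ∩ Iic R) ∧
      MapsTo c (posZeros (W a) ∩ Iic R) (posZeros (W a₀) ∩ Iic R) ∧
      MapsTo c (posZeros (W a) ∩ Iic R) t := by
    filter_upwards [(Finset.eventually_all t).2 fun x hx => hev x (ht x hx).1] with a ha
    have hc : ∀ y, y ∈ posZeros (W a) ∩ Iic R → ∃ x, x ∈ t ∧ y ∈ O x := by
      rintro y ⟨⟨hy0, -⟩, hyR⟩
      simpa using hcov ⟨hy0.le, hyR⟩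
    choose! c hct hcO using hc
    refine ⟨c, fun y hy y' hy' e => ?_, fun y hy => ?_, fun y hy => hct y hy⟩
    · have h2 := hcO y' hy'
      rw [← e] at h2
      exact ((ha (c y) (hct y hy) y (hcO y hy) hy.1.1 hy.1.2).2 y' h2 hy'.1.1 hy'.1.2).symm
    · exact ⟨(ha (c y) (hct y hy) y (hcO y hy) hy.1.1 hy.1.2).1, (ht _ (hct y hy)).2⟩
  constructor
  · obtain ⟨c, hc1, -, hc3⟩ := hall.self_of_nhds
    exact Finite.of_injOn hc3 hc1 t.finite_toSet
  · filter_upwards [hall] with a ha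
    obtain ⟨c, hc1, hc2, -⟩ := ha
    exact encard_le_encard_of_injOn hc2 hc1

end Continuity

section NonzeroLimit

variable {ν m q α : ℝ} {W U : ℝ → ℝ → ℝ} {a₀ ℓ : ℝ}

lemma FluxSol.simpleZeros_of_tendsto {w u : ℝ → ℝ} (h : FluxSol ν m q α 1 w u) (hν : 1 ≤ ν)
    (hm : 1 < m) (hq : 1 < q) (hα : 0 ≤ α) (hℓ : ℓ ≠ 0)
    (hlim : Tendsto (fun r => r ^ α * w r) atTop (𝓝 ℓ)) : SimpleZeros w u := by
  intro r hr hw hu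
  refine hℓ (tendsto_nhds_unique hlim (tendsto_const_nhds.congr' ?_))
  filter_upwards [eventually_ge_atTop r] with s hs
  rw [h.eq_zero_of_eq_zero hν hm hq hα zero_le_one hr hw hu hs, mul_zero]

lemma FluxSol.exists_forall_ne_zero (hν : 1 ≤ ν) (hm : 1 < m) (hq : 1 < q) (hα : 0 < α)
    (hL : α < (α + 1) / (m - 1) + 1)
    (h : ∀ a, FluxSol ν m q α 1 (W a) (U a)) (h0 : ∀ a, StartsAt a (W a) (U a)) (ha₀ : 0 < a₀)
    (hℓ : ℓ ≠ 0) (hlim : Tendsto (fun r => r ^ α * W a₀ r) atTop (𝓝 ℓ)) :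
    ∃ R > 0, ∀ᶠ a in 𝓝 a₀, ∀ r ≥ R, W a r ≠ 0 := by
  have hclose : ∀ R > 0, ∀ ε > 0, ∀ᶠ a in 𝓝 a₀, |W a R - W a₀ R| < ε ∧ |U a R - U a₀ R| < ε := by
    intro R hR ε hε
    obtain ⟨h1, h2⟩ := FluxSol.tendsto_param hν hm hq hα h h0 ha₀ hR
    exact (h1.eventually (Metric.ball_mem_nhds _ hε)).and
      (h2.eventually (Metric.ball_mem_nhds _ hε))
  rcases hℓ.lt_or_gt with hℓ | hℓ
  · have hlim' : Tendsto (fun r => r ^ α * -W a₀ r) atTop (𝓝 (-ℓ)) := by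
      simpa only [mul_neg] using hlim.neg
    obtain ⟨R, hR, ε, hε, htrap⟩ := (h a₀).neg.exists_forall_pos_of_tendsto hν hm hq hα
      (neg_pos.2 hℓ) hL hlim'
    refine ⟨R, hR, ?_⟩
    filter_upwards [hclose R hR ε hε] with a ha r hr
    refine neg_ne_zero.1 (htrap _ _ (h a).neg ?_ ?_ r hr).ne'
    · rw [← neg_sub', abs_neg]; exact ha.1
    · rw [← neg_sub', abs_neg]; exact ha.2
  · obtain ⟨R, hR, ε, hε, htrap⟩ := (h a₀).exists_forall_pos_of_tendsto hν hm hq hα hℓ hL hlim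
    refine ⟨R, hR, ?_⟩
    filter_upwards [hclose R hR ε hε] with a ha r hr
    exact (htrap _ _ (h a) ha.1 ha.2 r hr).ne'

lemma FluxSol.eventually_encard_posZeros_le (hν : 1 ≤ ν) (hm : 1 < m) (hq : 1 < q) (hα : 0 < α)
    (hL : α < (α + 1) / (m - 1) + 1)
    (h : ∀ a, FluxSol ν m q α 1 (W a) (U a)) (h0 : ∀ a, StartsAt a (W a) (U a)) (ha₀ : 0 < a₀)
    (hℓ : ℓ ≠ 0) (hlim : Tendsto (fun r => r ^ α * W a₀ r) atTop (𝓝 ℓ)) :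
    (posZeros (W a₀)).Finite ∧
      ∀ᶠ a in 𝓝 a₀, (posZeros (W a)).encard ≤ (posZeros (W a₀)).encard := by
  obtain ⟨R, hR, hne⟩ := FluxSol.exists_forall_ne_zero hν hm hq hα hL h h0 ha₀ hℓ hlim
  obtain ⟨hfin, hev⟩ := FluxSol.eventually_encard_le hν hm hq hα h h0 ha₀
    ((h a₀).simpleZeros_of_tendsto hν hm hq hα.le hℓ hlim) R
  have hsub : ∀ a, (∀ r ≥ R, W a r ≠ 0) → posZeros (W a) ∩ Iic R = posZeros (W a) := fun a ha =>
    inter_eq_left.2 fun r hr => le_of_not_ge fun hRr => ha r hRr hr.2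
  rw [hsub a₀ hne.self_of_nhds] at hfin hev
  refine ⟨hfin, ?_⟩
  filter_upwards [hne, hev] with a ha1 ha2
  rwa [hsub a ha1] at ha2

lemma FluxSol.exists_gt_limit_eq_zero (hν : 1 ≤ ν) (hm : 1 < m) (hq : 1 < q) (hα : 0 < α)
    (hL : α < (α + 1) / (m - 1) + 1) (hμ : 0 < 1 - ν + ν / m + ν / (q + 1))
    (h : ∀ a, FluxSol ν m q α 1 (W a) (U a)) (h0 : ∀ a, StartsAt a (W a) (U a)) {L : ℝ → ℝ}
    (hlim : ∀ a, Tendsto (fun r => r ^ α * W a r) atTop (𝓝 (L a))) (A : ℝ) :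
    ∃ a, A < a ∧ 0 < a ∧ L a = 0 := by
  by_contra! hne
  obtain ⟨B, hB⟩ : ∃ B, B = max A 0 := ⟨_, rfl⟩
  have hA : ∀ a, B < a → 0 < a := fun a ha => (hB ▸ le_max_right A 0 : 0 ≤ B).trans_lt ha
  have hLne : ∀ a, B < a → L a ≠ 0 := fun a ha =>
    hne a ((hB ▸ le_max_left A 0 : A ≤ B).trans_lt ha) (hA a ha)
  have hev := fun (a : ℝ) (ha : B < a) => FluxSol.eventually_encard_posZeros_le hν hm hq hα hL h h0
    (hA a ha) (hLne a ha) (hlim a)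
  have hcont : ContinuousOn (fun a => (posZeros (W a)).ncard) (Ioi B) := by
    intro b hb
    refine ContinuousAt.continuousWithinAt (tendsto_const_nhds.congr' ?_)
    have hs : HasSignChanges (W b) (posZeros (W b)).ncard :=
      (h b).hasSignChanges_of_le_encard
        ((h b).simpleZeros_of_tendsto hν hm hq hα.le (hLne b hb) (hlim b))
        (hev b hb).1.cast_ncard_eq.le
    filter_upwards [(hev b hb).2, FluxSol.eventually_hasSignChanges hν hm hq hα h h0 (hA b hb) hs]
      with a ha1 ha2
    have h1 := (h a).le_encard_of_hasSignChanges hν hm hq hα.le ha2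
    rw [(hev b hb).1.cast_ncard_eq] at h1
    rw [ncard_def, ncard_def, le_antisymm h1 ha1]
  obtain ⟨n, hn⟩ : ∃ n, n = (posZeros (W (B + 1))).ncard := ⟨_, rfl⟩
  obtain ⟨a, ⟨s, hs, hs0, hsw⟩, ha⟩ := ((FluxSol.eventually_alternating hν hm hq hα.le hμ h h0
    (n + 1)).and (eventually_gt_atTop B)).exists
  have h1 := (h a).le_encard_of_hasSignChanges hν hm hq hα.le
    (hasSignChanges_of_alternating hs hs0 hsw)
  have h2 : (posZeros (W a)).ncard = n :=
    hn ▸ isPreconnected_Ioi.constant hcont ha (by simp : B + 1 ∈ Ioi B)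
  rw [← (hev a ha).1.cast_ncard_eq, h2] at h1
  exact absurd (Nat.cast_le.1 h1) (by lia)

lemma FluxSol.exists_seq_limit_eq_zero (hν : 1 ≤ ν) (hm : 1 < m) (hq : 1 < q) (hα : 0 < α)
    (hL : α < (α + 1) / (m - 1) + 1) (hμ : 0 < 1 - ν + ν / m + ν / (q + 1))
    (h : ∀ a, FluxSol ν m q α 1 (W a) (U a)) (h0 : ∀ a, StartsAt a (W a) (U a)) {L : ℝ → ℝ}
    (hlim : ∀ a, Tendsto (fun r => r ^ α * W a r) atTop (𝓝 (L a))) :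
    ∃ b : ℕ → ℝ, StrictMono b ∧ Tendsto b atTop atTop ∧
      ∀ k, L (b k) = 0 ∧ HasSignChanges (W (b k)) (k + 1) := by
  have hex : ∀ (k : ℕ) (A : ℝ), ∃ a, max A k < a ∧ L a = 0 ∧ HasSignChanges (W a) (k + 1) := by
    intro k A
    obtain ⟨B, hB⟩ := eventually_atTop.1
      (FluxSol.eventually_alternating hν hm hq hα.le hμ h h0 (k + 1))
    obtain ⟨a, ha, -, haL⟩ := FluxSol.exists_gt_limit_eq_zero hν hm hq hα hL hμ h h0 hlim
      (max B (max A k))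
    obtain ⟨s, hs, hs0, hsw⟩ := hB a ((le_max_left _ _).trans ha.le)
    exact ⟨a, (le_max_right _ _).trans_lt ha, haL, hasSignChanges_of_alternating hs hs0 hsw⟩
  choose f hf hfL hfs using hex
  obtain ⟨b, hb0, hb⟩ : ∃ b : ℕ → ℝ, b 0 = f 0 0 ∧ ∀ k, b (k + 1) = f (k + 1) (b k) :=
    ⟨fun k => Nat.rec (f 0 0) (fun k x => f (k + 1) x) k, rfl, fun k => rfl⟩
  have hb' : ∀ k, ∃ A, b k = f k A := fun k => by
    cases k with
    | zero => exact ⟨0, hb0⟩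
    | succ k => exact ⟨b k, hb k⟩
  refine ⟨b, strictMono_nat_of_lt_succ fun k => ?_, ?_, fun k => ?_⟩
  · rw [hb k]
    exact (le_max_left _ _).trans_lt (hf _ _)
  · refine tendsto_atTop_mono (fun k => ?_) tendsto_natCast_atTop_atTop
    obtain ⟨A, hA⟩ := hb' k
    rw [hA]
    exact (le_max_right _ _).trans (hf _ _).le
  · obtain ⟨A, hA⟩ := hb' k
    rw [hA]
    exact ⟨hfL _ _, hfs _ _⟩

end NonzeroLimit

section Singular

variable {ν m q α a : ℝ} {w u : ℝ → ℝ}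

lemma abs_phiP_le_of_abs_le {p x M : ℝ} (hp : 2 ≤ p) (hx : |x| ≤ M) :
    |phiP p x| ≤ M ^ (p - 2) * |x| := by
  rw [phiP, abs_mul, abs_of_nonneg (Real.rpow_nonneg (abs_nonneg x) _)]
  exact mul_le_mul_of_nonneg_right (Real.rpow_le_rpow (abs_nonneg x) hx (by linarith))
    (abs_nonneg x)

lemma FluxSol.simpleZeros (h : FluxSol ν m q α 1 w u) (h0 : StartsAt a w u) (hν : 1 ≤ ν)
    (hm : 2 ≤ m) (hq : 1 < q) (hα : 0 ≤ α) (ha : a ≠ 0) : SimpleZeros w u := by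
  intro r₁ hr₁ hw hu
  obtain ⟨M, hM⟩ : ∃ M, M = (m * energyZero q α 1 a) ^ (1 / m) := ⟨_, rfl⟩
  obtain ⟨K, hK⟩ : ∃ K, K = M ^ (m - 2) := ⟨_, rfl⟩
  obtain ⟨K', hK'⟩ : ∃ K', K' = |a| ^ (q + 1 - 2) := ⟨_, rfl⟩
  have hE : 0 ≤ m * energyZero q α 1 a :=
    mul_nonneg (by linarith) (energyZero_nonneg hα hq zero_le_one)
  have hK0 : 0 ≤ K := by rw [hK, hM]; positivity
  have hK'0 : 0 ≤ K' := by rw [hK']; positivity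
  have hzero : ∀ ε ∈ Ioc 0 r₁, w ε = 0 := by
    intro ε hε
    obtain ⟨C, hC⟩ : ∃ C, C = K + 2 * ((ν - 1) / ε) + 2 * (r₁ * K) + (α + K') := ⟨_, rfl⟩
    have hderiv : ∀ r ∈ Icc ε r₁, HasDerivAt (fun s => -(w s ^ 2 + u s ^ 2))
        (-(2 * (w r * phiP m (u r)) + 2 * (u r * (-((ν - 1) / r * u r)
          - 1 * (r * phiP m (u r) + α * w r) - phiP (q + 1) (w r))))) r := by
      intro r hr
      have hr0 : 0 < r := hε.1.trans_le hr.1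
      refine (((h.hw r hr0).pow 2).add ((h.hu r hr0).pow 2)).neg.congr_deriv ?_
      push_cast
      ring
    have hanti := antitoneOn_mul_exp_neg (convex_Icc ε r₁) hderiv
      (Φ := fun r => -(C * r)) (Φ' := fun _ => -C)
      (fun r _ => ((hasDerivAt_id r).const_mul C).neg.congr_deriv (by ring)) (fun r hr => by
        have hr0 : 0 < r := hε.1.trans_le hr.1
        have h1 := abs_phiP_le_of_abs_le hm
          (h.abs_u_le h0 hν (by linarith) hq hα zero_le_one hr0)
        have h2 := abs_phiP_le_of_abs_le (p := q + 1) (by linarith)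
          (h.abs_w_le h0 hν (by linarith) hq hα zero_le_one hr0)
        rw [← hM, ← hK] at h1
        rw [← hK'] at h2
        have h3 : (ν - 1) / r ≤ (ν - 1) / ε :=
          div_le_div_of_nonneg_left (by linarith) hε.1 hr.1
        have e1 : -(w r * phiP m (u r)) ≤ K * (|w r| * |u r|) := by
          refine (neg_le_abs _).trans ?_
          rw [abs_mul]
          nlinarith [mul_le_mul_of_nonneg_left h1 (abs_nonneg (w r))]
        have e2 : u r * phiP m (u r) * r ≤ r₁ * K * u r ^ 2 := by
          have h4 : u r * phiP m (u r) ≤ K * u r ^ 2 := by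
            refine (le_abs_self _).trans ?_
            rw [abs_mul, ← sq_abs (u r)]
            nlinarith [mul_le_mul_of_nonneg_left h1 (abs_nonneg (u r))]
          have h5 : u r * phiP m (u r) * r ≤ K * u r ^ 2 * r :=
            mul_le_mul_of_nonneg_right h4 hr0.le
          have h6 : K * u r ^ 2 * r ≤ K * u r ^ 2 * r₁ :=
            mul_le_mul_of_nonneg_left hr.2 (by positivity)
          linarith
        have e3 : u r * phiP (q + 1) (w r) ≤ K' * (|w r| * |u r|) := by
          refine (le_abs_self _).trans ?_
          rw [abs_mul]
          nlinarith [mul_le_mul_of_nonneg_left h2 (abs_nonneg (u r))]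
        have e4 : α * (u r * w r) ≤ α * (|w r| * |u r|) := by
          refine mul_le_mul_of_nonneg_left ((le_abs_self _).trans ?_) hα
          rw [abs_mul, mul_comm]
        have e5 : (ν - 1) / r * u r ^ 2 ≤ (ν - 1) / ε * u r ^ 2 :=
          mul_le_mul_of_nonneg_right h3 (sq_nonneg _)
        have e6 : 2 * (|w r| * |u r|) ≤ w r ^ 2 + u r ^ 2 := by
          rw [← sq_abs (w r), ← sq_abs (u r)]
          linarith [two_mul_le_add_sq |w r| |u r|]
        have e7 := mul_le_mul_of_nonneg_left e6 (by linarith : 0 ≤ K + (α + K'))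
        have h3' : 0 ≤ (ν - 1) / ε := div_nonneg (by linarith) hε.1.le
        have e8 : 0 ≤ (2 * ((ν - 1) / ε) + 2 * (r₁ * K)) * w r ^ 2 := by positivity
        rw [hC]
        linarith)
    have h1 := hanti (left_mem_Icc.2 hε.2) (right_mem_Icc.2 hε.2) hε.2
    simp only [hw, hu] at h1
    have h2 := Real.exp_pos (-(-(C * ε)))
    have h3 : w ε ^ 2 + u ε ^ 2 ≤ 0 := by
      by_contra! hlt
      linarith [mul_pos hlt h2]
    exact pow_eq_zero_iff two_ne_zero |>.1
      (le_antisymm (by linarith [sq_nonneg (u ε)]) (sq_nonneg _))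
  refine ha (tendsto_nhds_unique h0.hw (tendsto_const_nhds.congr' ?_))
  filter_upwards [Ioc_mem_nhdsGT hr₁] with r hr using (hzero r hr).symm

lemma exists_first_zero {f : ℝ → ℝ} {r z : ℝ} (hf : ContinuousOn f (Ioi r))
    (hpos : ∀ᶠ s in 𝓝[>] r, 0 < f s) (hz : r < z) (hfz : f z = 0) :
    ∃ y, r < y ∧ f y = 0 ∧ ∀ s ∈ Ioo r y, 0 < f s := by
  obtain ⟨b, hb, hsub⟩ := mem_nhdsGT_iff_exists_Ioo_subset.1 hpos
  obtain ⟨c, hc1, hc2⟩ := exists_between (lt_min hb hz)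
  have hcb : c < b := hc2.trans_le (min_le_left _ _)
  have hK : IsCompact (Icc c z ∩ f ⁻¹' {0}) :=
    isCompact_Icc.of_isClosed_subset
      ((hf.mono fun s hs => hc1.trans_le hs.1).preimage_isClosed_of_isClosed isClosed_Icc
        isClosed_singleton) inter_subset_left
  obtain ⟨y, ⟨hy, hy0⟩, hleast⟩ := hK.exists_isLeast
    ⟨z, right_mem_Icc.2 (hc2.le.trans (min_le_right _ _)), hfz⟩
  refine ⟨y, hc1.trans_le hy.1, hy0, fun s hs => ?_⟩
  rcases lt_or_ge s b with hsb | hbs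
  · exact hsub ⟨hs.1, hsb⟩
  · by_contra! hle
    have hcs : c ≤ s := hcb.le.trans hbs
    obtain ⟨x, hx, hx0⟩ := intermediate_value_Icc' hcs
      (hf.mono fun t ht => hc1.trans_le ht.1) ⟨hle, (hsub ⟨hc1, hcb⟩).le⟩
    exact absurd (hleast ⟨⟨hx.1, hx.2.trans (hs.2.le.trans hy.2)⟩, hx0⟩)
      (not_le.2 (hx.2.trans_lt hs.2))

lemma FluxSol.hasDerivAt_moment (h : FluxSol ν m q α 1 w u) {r : ℝ} (hr : 0 < r) :
    HasDerivAt (fun s => s ^ ν * w s + s ^ (ν - 1) * u s)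
      (r ^ (ν - 1) * ((ν - α) * w r - phiP (q + 1) (w r))) r := by
  refine (((Real.hasDerivAt_rpow_const (p := ν) (Or.inl hr.ne')).mul (h.hw r hr)).add
    (h.hasDerivAt_weighted hr)).congr_deriv ?_
  have e : r ^ ν = r ^ (ν - 1) * r := by
    rw [Real.rpow_sub_one hr.ne', div_mul_cancel₀ _ hr.ne']
  rw [e]
  ring

lemma FluxSol.false_of_pos_of_small (h : FluxSol ν m q α 1 w u) {r₁ r₂ ℓ : ℝ} (hr₁ : 0 ≤ r₁)
    (hr : r₁ < r₂) (hpos : ∀ s ∈ Ioo r₁ r₂, 0 < w s)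
    (hsmall : ∀ s ∈ Ioo r₁ r₂, |w s| ^ (q - 1) < ν - α) (hw : w r₂ = 0) (hℓ : 0 ≤ ℓ)
    (hlim : Tendsto (fun s => s ^ ν * w s + s ^ (ν - 1) * u s) (𝓝[>] r₁) (𝓝 ℓ)) : False := by
  have hmono : StrictMonoOn (fun s => s ^ ν * w s + s ^ (ν - 1) * u s) (Ioc r₁ r₂) := by
    refine strictMonoOn_of_deriv_pos (convex_Ioc r₁ r₂) (fun s hs =>
      (h.hasDerivAt_moment (hr₁.trans_lt hs.1)).continuousAt.continuousWithinAt) fun s hs => ?_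
    rw [interior_Ioc] at hs
    have hs0 : 0 < s := hr₁.trans_lt hs.1
    rw [(h.hasDerivAt_moment hs0).deriv]
    refine mul_pos (Real.rpow_pos_of_pos hs0 _) ?_
    have e : phiP (q + 1) (w s) = |w s| ^ (q - 1) * w s := by
      rw [phiP]; congr 2; ring
    rw [e, ← sub_mul]
    exact mul_pos (sub_pos.2 (hsmall s hs)) (hpos s hs)
  obtain ⟨c, hc1, hc2⟩ := exists_between hr
  have h1 : ℓ ≤ c ^ ν * w c + c ^ (ν - 1) * u c := by
    refine le_of_tendsto hlim ?_
    filter_upwards [Ioo_mem_nhdsGT hc1] with s hs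
    exact (hmono ⟨hs.1, (hs.2.trans hc2).le⟩ ⟨hc1, hc2.le⟩ hs.2).le
  have h2 := hmono ⟨hc1, hc2.le⟩ (right_mem_Ioc.2 hr) hc2
  simp only [hw, mul_zero, zero_add] at h2
  have hr₂ : 0 < r₂ := hr₁.trans_lt hr
  have hu : 0 < u r₂ := by
    by_contra! hle
    linarith [mul_nonpos_of_nonneg_of_nonpos (Real.rpow_nonneg hr₂.le (ν - 1)) hle]
  have h3 := (h.hw r₂ hr₂).neg.nonneg_of_le_left hr fun x hx => by
    simpa [hw] using (hpos x hx).le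
  linarith [phiP_pos (p := m) hu]

lemma FluxSol.posZeros_eq_empty (h : FluxSol ν m q α 1 w u) (h0 : StartsAt a w u) (hν : 1 ≤ ν)
    (hm : 1 < m) (hq : 1 < q) (hα : 0 ≤ α) (ha : 0 < a) (hsmall : a ^ (q - 1) < ν - α) :
    posZeros w = ∅ := by
  by_contra hne
  obtain ⟨z, hz, hwz⟩ := nonempty_iff_ne_empty.2 hne
  obtain ⟨y, hy, hwy, hpos⟩ := exists_first_zero
    (fun s hs => (h.continuousAt_w hs).continuousWithinAt) (h0.hw.eventually_const_lt ha) hz hwz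
  refine h.false_of_pos_of_small le_rfl hy hpos (fun s hs => ?_) hwy le_rfl ?_
  · refine (Real.rpow_le_rpow (abs_nonneg _) ?_ (by linarith)).trans_lt hsmall
    exact (h.abs_w_le h0 hν hm hq hα zero_le_one hs.1).trans_eq (abs_of_pos ha)
  · simpa using ((tendsto_rpow_zero_right (by linarith : 0 < ν)).mul h0.hw).add
      (h0.tendsto_weighted hν)

lemma FluxSol.not_lt_of_pos_flux (h : FluxSol ν m q α 1 w u) {r z : ℝ} (hr : 0 < r)
    (hsmall : ∀ s > r, |w s| ^ (q - 1) < ν - α) (hwr : w r = 0) (hu : 0 < u r) (hwz : w z = 0) :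
    ¬ r < z := by
  intro hz
  have hev : ∀ᶠ s in 𝓝[>] r, 0 < w s := by
    filter_upwards [((h.hw r hr).tendsto_slope.mono_left
      (nhdsWithin_mono r fun s hs => ne_of_gt hs : 𝓝[>] r ≤ 𝓝[≠] r)).eventually_const_lt
      (phiP_pos hu), self_mem_nhdsWithin] with t ht htr
    rw [slope_def_field, hwr, sub_zero] at ht
    exact (div_pos_iff_of_pos_right (sub_pos.2 htr)).1 ht
  obtain ⟨y, hy, hwy, hpos⟩ := exists_first_zero
    (fun s hs => (h.continuousAt_w (hr.trans hs)).continuousWithinAt) hev hz hwz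
  refine h.false_of_pos_of_small hr.le hy hpos (fun s hs => hsmall s hs.1) hwy ?_
    ((h.hasDerivAt_moment hr).continuousAt.tendsto.mono_left nhdsWithin_le_nhds)
  rw [hwr]
  have := Real.rpow_nonneg hr.le (ν - 1)
  positivity

lemma FluxSol.subsingleton_posZeros_inter_Ioi (h : FluxSol ν m q α 1 w u)
    (hsim : SimpleZeros w u) {R : ℝ} (hsmall : ∀ s > R, |w s| ^ (q - 1) < ν - α) :
    (posZeros w ∩ Ioi R).Subsingleton := by
  have key : ∀ y ∈ posZeros w ∩ Ioi R, ∀ z ∈ posZeros w ∩ Ioi R, ¬ y < z := by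
    rintro y ⟨⟨hy0, hwy⟩, hyR⟩ z ⟨⟨-, hwz⟩, -⟩
    rcases (hsim y hy0 hwy).lt_or_gt with hu | hu
    · refine h.neg.not_lt_of_pos_flux hy0 (fun s hs => ?_) (neg_eq_zero.2 hwy) (neg_pos.2 hu)
        (neg_eq_zero.2 hwz)
      rw [abs_neg]
      exact hsmall s (lt_trans hyR hs)
    · exact h.not_lt_of_pos_flux hy0 (fun s hs => hsmall s (lt_trans hyR hs)) hwy hu hwz
  exact fun y hy z hz => le_antisymm (not_lt.1 (key z hz y hy)) (not_lt.1 (key y hy z hz))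

lemma FluxSol.exists_energy_lt {ℓ E : ℝ} (h : FluxSol ν m q α 1 w u) (hm : 1 < m) (hq : 1 < q)
    (hα : 0 < α) (hlim : Tendsto (fun r => r ^ α * w r) atTop (𝓝 ℓ)) (hE : 0 < E) :
    ∃ R > 0, energy m q α 1 w u R < E := by
  have hw : Tendsto w atTop (𝓝 0) := by
    have h1 := (tendsto_rpow_neg_atTop hα).mul hlim
    rw [zero_mul] at h1
    refine h1.congr' ?_
    filter_upwards [eventually_gt_atTop 0] with r hr
    rw [← mul_assoc, ← Real.rpow_add hr, neg_add_cancel, Real.rpow_zero, one_mul]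
  have hξ : ∀ n : ℕ, ∃ ξ ∈ Ioo ((n : ℝ) + 1) (n + 2),
      phiP m (u ξ) = (w (n + 2) - w (n + 1)) / (n + 2 - (n + 1)) := fun n => by
    have hpos : ∀ s : ℝ, (n : ℝ) + 1 ≤ s → 0 < s := fun s hs =>
      (by positivity : (0 : ℝ) < n + 1).trans_le hs
    exact exists_hasDerivAt_eq_slope w (fun r => phiP m (u r)) (by linarith)
      (fun s hs => (h.continuousAt_w (hpos s hs.1)).continuousWithinAt)
      fun s hs => h.hw s (hpos s hs.1.le)
  choose ξ hξ1 hξ2 using hξ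
  have hξt : Tendsto ξ atTop atTop :=
    tendsto_atTop_mono (fun n => by linarith [(hξ1 n).1]) tendsto_natCast_atTop_atTop
  have hφ : Tendsto (fun n => phiP m (u (ξ n))) atTop (𝓝 0) := by
    have h1 := (hw.comp (tendsto_natCast_atTop_atTop.atTop_add
      (tendsto_const_nhds (x := (2 : ℝ))))).sub
      (hw.comp (tendsto_natCast_atTop_atTop.atTop_add (tendsto_const_nhds (x := (1 : ℝ)))))
    rw [sub_zero] at h1
    refine h1.congr fun n => ?_
    rw [hξ2 n, show (n : ℝ) + 2 - (n + 1) = 1 by ring, div_one]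
    rfl
  have hu : Tendsto (fun n => u (ξ n)) atTop (𝓝 0) := by
    have hm' : 1 < m / (m - 1) := by
      rw [lt_div_iff₀ (by linarith)]; linarith
    have h1 := ((continuous_phiP hm').tendsto 0).comp hφ
    rw [phiP_zero] at h1
    exact h1.congr fun n => phiP_conj hm _
  have hen : Tendsto (fun n => energy m q α 1 w u (ξ n)) atTop (𝓝 0) := by
    have h1 : Tendsto (fun n => |u (ξ n)| ^ m / m) atTop (𝓝 (|0| ^ m / m)) :=
      (hu.abs.rpow_const (Or.inr (by linarith))).div_const m
    have h2 := (((hw.comp hξt).pow 2).div_const 2).const_mul (1 * α)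
    have h3 : Tendsto (fun n => |w (ξ n)| ^ (q + 1) / (q + 1)) atTop
        (𝓝 (|0| ^ (q + 1) / (q + 1))) :=
      ((hw.comp hξt).abs.rpow_const (Or.inr (by linarith))).div_const (q + 1)
    have h4 := (h1.add h2).add h3
    rw [abs_zero, Real.zero_rpow (by linarith), Real.zero_rpow (by linarith)] at h4
    simpa [energy] using h4
  obtain ⟨n, hn⟩ := (hen.eventually_lt_const hE).exists
  exact ⟨ξ n, (by positivity : (0 : ℝ) < n + 1).trans (hξ1 n).1, hn⟩

end Singular

section Threshold

variable {ν m q α : ℝ} {W U : ℝ → ℝ → ℝ}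

lemma exists_pos_rpow_lt {s c : ℝ} (hs : 0 < s) (hc : 0 < c) : ∃ δ > 0, δ ^ s < c := by
  refine ⟨(c / 2) ^ (1 / s), by positivity, ?_⟩
  rw [← Real.rpow_mul (by positivity), one_div_mul_cancel hs.ne', Real.rpow_one]
  linarith

/-- The set of initial values whose solution changes sign at least `n` times. -/
def signChangeSet (W : ℝ → ℝ → ℝ) (n : ℕ) : Set ℝ := {a | 0 < a ∧ HasSignChanges (W a) n}

lemma signChangeSet_nonempty (hν : 1 ≤ ν) (hm : 1 < m) (hq : 1 < q) (hα : 0 ≤ α)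
    (hμ : 0 < 1 - ν + ν / m + ν / (q + 1))
    (h : ∀ a, FluxSol ν m q α 1 (W a) (U a)) (h0 : ∀ a, StartsAt a (W a) (U a)) (n : ℕ) :
    (signChangeSet W n).Nonempty := by
  obtain ⟨a, ⟨s, hs, hs0, hsw⟩, ha⟩ := ((FluxSol.eventually_alternating hν hm hq hα hμ h h0
    n).and (eventually_gt_atTop 0)).exists
  exact ⟨a, ha, hasSignChanges_of_alternating hs hs0 hsw⟩

lemma bddBelow_signChangeSet (n : ℕ) : BddBelow (signChangeSet W n) := ⟨0, fun _ ha => ha.1.le⟩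

lemma sInf_signChangeSet_pos (hν : 1 ≤ ν) (hm : 1 < m) (hq : 1 < q) (hα : 0 ≤ α) (hαν : α < ν)
    (hμ : 0 < 1 - ν + ν / m + ν / (q + 1))
    (h : ∀ a, FluxSol ν m q α 1 (W a) (U a)) (h0 : ∀ a, StartsAt a (W a) (U a)) (k : ℕ) :
    0 < sInf (signChangeSet W (k + 1)) := by
  obtain ⟨δ, hδ, hδ'⟩ := exists_pos_rpow_lt (sub_pos.2 hq) (sub_pos.2 hαν)
  refine hδ.trans_le (le_csInf (signChangeSet_nonempty hν hm hq hα hμ h h0 _) ?_)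
  rintro a ⟨ha, hs⟩
  by_contra! hlt
  have h1 := (h a).le_encard_of_hasSignChanges hν hm hq hα hs
  rw [(h a).posZeros_eq_empty (h0 a) hν hm hq hα ha
    ((Real.rpow_le_rpow ha.le hlt.le (by linarith)).trans_lt hδ')] at h1
  simp at h1

lemma FluxSol.eventually_encard_posZeros_le_add_one (hν : 1 ≤ ν) (hm : 2 ≤ m) (hq : 1 < q)
    (hα : 0 < α) (hαν : α < ν)
    (h : ∀ a, FluxSol ν m q α 1 (W a) (U a)) (h0 : ∀ a, StartsAt a (W a) (U a)) {a₀ ℓ : ℝ}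
    (ha₀ : 0 < a₀) (hlim : Tendsto (fun r => r ^ α * W a₀ r) atTop (𝓝 ℓ)) :
    ∀ᶠ a in 𝓝 a₀, (posZeros (W a)).encard ≤ (posZeros (W a₀)).encard + 1 := by
  have hm1 : 1 < m := by linarith
  obtain ⟨δ, hδ, hδ'⟩ := exists_pos_rpow_lt (sub_pos.2 hq) (sub_pos.2 hαν)
  have hE : 0 < energyZero q α 1 δ := by
    have : 0 < q + 1 := by linarith
    unfold energyZero
    positivity
  obtain ⟨R, hR, hRE⟩ := (h a₀).exists_energy_lt hm1 hq hα hlim hE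
  have hcont : Tendsto (fun a => energy m q α 1 (W a) (U a) R) (𝓝 a₀)
      (𝓝 (energy m q α 1 (W a₀) (U a₀) R)) := by
    obtain ⟨h1, h2⟩ := FluxSol.tendsto_param hν hm1 hq hα h h0 ha₀ hR
    exact (((h2.abs.rpow_const (Or.inr (by linarith))).div_const m).add
      (((h1.pow 2).div_const 2).const_mul (1 * α))).add
      ((h1.abs.rpow_const (Or.inr (by linarith))).div_const (q + 1))
  filter_upwards [hcont.eventually_lt_const hRE, lt_mem_nhds ha₀, (FluxSol.eventually_encard_le
    hν hm1 hq hα h h0 ha₀ ((h a₀).simpleZeros (h0 a₀) hν hm hq hα.le ha₀.ne') R).2]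
    with a ha ha0 hle
  have hsmall : ∀ s > R, |W a s| ^ (q - 1) < ν - α := fun s hs => by
    have h1 := ((energyZero_le_energy hm1 s).trans ((h a).energy_antitoneOn hν hm1 hq zero_le_one
      hR (hR.trans hs) hs.le)).trans ha.le
    have h2 := abs_le_of_energyZero_le hα.le hq zero_le_one h1
    rw [abs_of_pos hδ] at h2
    exact (Real.rpow_le_rpow (abs_nonneg _) h2 (by linarith)).trans_lt hδ'
  have h1 := encard_le_one_iff_subsingleton.2 ((h a).subsingleton_posZeros_inter_Ioi
    ((h a).simpleZeros (h0 a) hν hm hq hα.le ha0.ne') hsmall)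
  calc (posZeros (W a)).encard
      = (posZeros (W a) ∩ Iic R ∪ posZeros (W a) ∩ Ioi R).encard := by
        rw [← inter_union_distrib_left, Iic_union_Ioi, inter_univ]
    _ ≤ (posZeros (W a) ∩ Iic R).encard + (posZeros (W a) ∩ Ioi R).encard :=
        encard_union_le _ _
    _ ≤ (posZeros (W a₀)).encard + 1 :=
        add_le_add (hle.trans (encard_le_encard inter_subset_left)) h1

lemma FluxSol.encard_posZeros_sInf (hν : 1 ≤ ν) (hm : 2 ≤ m) (hq : 1 < q) (hα : 0 < α)
    (hαν : α < ν) (hL : α < (α + 1) / (m - 1) + 1) (hμ : 0 < 1 - ν + ν / m + ν / (q + 1))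
    (h : ∀ a, FluxSol ν m q α 1 (W a) (U a)) (h0 : ∀ a, StartsAt a (W a) (U a)) {L : ℝ → ℝ}
    (hlim : ∀ a, Tendsto (fun r => r ^ α * W a r) atTop (𝓝 (L a))) (k : ℕ) :
    (posZeros (W (sInf (signChangeSet W (k + 1))))).encard = k ∧
      L (sInf (signChangeSet W (k + 1))) = 0 := by
  have hm1 : 1 < m := by linarith
  have hne := signChangeSet_nonempty hν hm1 hq hα.le hμ h h0 (k + 1)
  have hb0 := sInf_signChangeSet_pos hν hm1 hq hα.le hαν hμ h h0 k
  have hclos := csInf_mem_closure hne (bddBelow_signChangeSet _)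
  obtain ⟨b, hb⟩ : ∃ b, b = sInf (signChangeSet W (k + 1)) := ⟨_, rfl⟩
  rw [← hb] at hb0 hclos ⊢
  have hfreq := mem_closure_iff_frequently.1 hclos
  have hnot : ¬ HasSignChanges (W b) (k + 1) := by
    intro hs
    obtain ⟨a, ⟨ha1, ha2⟩, ha3⟩ := ((((FluxSol.eventually_hasSignChanges hν hm1 hq hα h h0 hb0
      hs).and (lt_mem_nhds hb0)).filter_mono (nhdsWithin_le_nhds (s := Iio b))).and
      self_mem_nhdsWithin).exists
    exact absurd (hb ▸ csInf_le (bddBelow_signChangeSet _) ⟨ha2, ha1⟩) (not_le.2 ha3)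
  have hlt : (posZeros (W b)).encard < (k + 1 : ℕ) := by
    by_contra! hle
    exact hnot ((h b).hasSignChanges_of_le_encard
      ((h b).simpleZeros (h0 b) hν hm hq hα.le hb0.ne') hle)
  constructor
  · obtain ⟨a, ha, hle⟩ := (hfreq.and_eventually
      (FluxSol.eventually_encard_posZeros_le_add_one hν hm hq hα hαν h h0 hb0 (hlim b))).exists
    have h1 := ((h a).le_encard_of_hasSignChanges hν hm1 hq hα.le ha.2).trans hle
    have hfin : (posZeros (W b)).Finite := finite_of_encard_le_coe hlt.le
    rw [← hfin.cast_ncard_eq] at h1 hlt ⊢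
    norm_cast at h1 hlt ⊢
    lia
  · by_contra hLb
    obtain ⟨a, ha, hle⟩ := (hfreq.and_eventually
      (FluxSol.eventually_encard_posZeros_le hν hm1 hq hα hL h h0 hb0 hLb (hlim b)).2).exists
    exact absurd (((h a).le_encard_of_hasSignChanges hν hm1 hq hα.le ha.2).trans hle)
      (not_le.2 hlt)

end Threshold

/-- Assume (L) and `1 < q < q*`. (ii) The set `{a > 0 : L(a) = 0}` is unbounded above,
and there is an increasing sequence `(a_m) → ∞` with `L(a_m) = 0` and `w(·,a_m)`
having at least `m+1` isolated zeros. (iii) If moreover `p < 2` and `α < N`, then for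
any `m`, `ā_m = inf{a > 0 : w(·,a) has ≥ m+1 isolated zeros} ∈ (0,∞)`, and for
`m ≥ 1`, `w(·,ā_m)` has precisely `m` zeros and `L(ā_m) = 0`. -/
theorem stmt13 (N : ℕ) (hN : 1 ≤ N) (p q α : ℝ) (hp : 1 < p) (hq : 1 < q) (hα : 0 < α)
    (hL : 2 < p ∨ (p < 2 ∧ α < p / (2 - p)))
    (hq2 : p < (N : ℝ) → q < ((N : ℝ) * (p - 1) + p) / ((N : ℝ) - p))
    (W : ℝ → ℝ → ℝ) (hW : ∀ a : ℝ, IsGlobalSolution N p q α a (W a))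
    (L : ℝ → ℝ)
    (hLdef : ∀ a : ℝ, Tendsto (fun r => r ^ α * W a r) atTop (𝓝 (L a))) :
    ((∀ A : ℝ, ∃ a : ℝ, A < a ∧ 0 < a ∧ L a = 0) ∧
     (∃ aseq : ℕ → ℝ, StrictMono aseq ∧ Tendsto aseq atTop atTop ∧
        ∀ m : ℕ, L (aseq m) = 0 ∧ HasAtLeastIsolatedZeros (W (aseq m)) (m + 1))) ∧
    (p < 2 → α < (N : ℝ) →
      ∀ m : ℕ,
        {a : ℝ | 0 < a ∧ HasAtLeastIsolatedZeros (W a) (m + 1)}.Nonempty ∧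
        0 < sInf {a : ℝ | 0 < a ∧ HasAtLeastIsolatedZeros (W a) (m + 1)} ∧
        (1 ≤ m →
          {r : ℝ | 0 < r ∧
              W (sInf {a : ℝ | 0 < a ∧ HasAtLeastIsolatedZeros (W a) (m + 1)}) r = 0}.Finite ∧
          Set.ncard {r : ℝ | 0 < r ∧
              W (sInf {a : ℝ | 0 < a ∧ HasAtLeastIsolatedZeros (W a) (m + 1)}) r = 0} = m ∧
          L (sInf {a : ℝ | 0 < a ∧ HasAtLeastIsolatedZeros (W a) (m + 1)}) = 0)) := by
  have hν : (1 : ℝ) ≤ N := by exact_mod_cast hN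
  have hp1 : 0 < p - 1 := by linarith
  have hm : 1 < p / (p - 1) := by rw [lt_div_iff₀ hp1]; linarith
  have em : p / (p - 1) - 1 = 1 / (p - 1) := by field_simp; ring
  have hL' : α < (α + 1) / (p / (p - 1) - 1) + 1 := by
    rw [em, div_div_eq_mul_div, div_one]
    rcases hL with hp2 | ⟨hp2, hαp⟩
    · nlinarith
    · rw [lt_div_iff₀ (by linarith)] at hαp
      linarith
  have hμ : 0 < 1 - (N : ℝ) + N / (p / (p - 1)) + N / (q + 1) := by
    have e : 1 - (N : ℝ) + N / (p / (p - 1)) + N / (q + 1) =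
        (p * (q + 1) - N * (q + 1) + N * p) / (p * (q + 1)) := by
      field_simp
      ring
    rw [e]
    refine div_pos ?_ (by positivity)
    rcases le_or_gt (N : ℝ) p with hNp | hNp
    · nlinarith
    · have := hq2 hNp
      rw [lt_div_iff₀ (by linarith)] at this
      linarith
  have h := fun a => (hW a).fluxSol hp
  have h0 := fun a => (hW a).startsAt
  have hiff : ∀ a n, HasAtLeastIsolatedZeros (W a) n ↔ HasSignChanges (W a) n := fun a _ =>
    (h a).hasAtLeastIsolatedZeros_iff hν hm hq hα.le
  simp only [hiff]
  refine ⟨⟨FluxSol.exists_gt_limit_eq_zero hν hm hq hα hL' hμ h h0 hLdef,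
    FluxSol.exists_seq_limit_eq_zero hν hm hq hα hL' hμ h h0 hLdef⟩, fun hp2 hαN k =>
    ⟨signChangeSet_nonempty hν hm hq hα.le hμ h h0 _,
      sInf_signChangeSet_pos hν hm hq hα.le hαN hμ h h0 k, fun _ => ?_⟩⟩
  obtain ⟨h1, h2⟩ := FluxSol.encard_posZeros_sInf hν (by rw [le_div_iff₀ hp1]; linarith) hq hα hαN
    hL' hμ h h0 hLdef k
  refine ⟨finite_of_encard_eq_coe h1, ?_, h2⟩
  rw [ncard_def]
  exact congrArg ENat.toNat h1
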